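/- Let U ⊆ ℝⁿ be an open connected neighbourhood of 0 and let f : U → ℝ be a real-analytic function, not identically zero, with f(0) = 0. Let P ∈ ℝ[x₁,…,xₙ,y] be an irreducible polynomial such that P(x, f(x)) = 0 for all x ∈ U, let d = deg P, let Z = {x ∈ U : f(x) = 0}, and set k = 2(2d−1)^(3n+1). Then any two C^k functions f₁ : U₁ → ℝ and f₂ : U₂ → ℝ on open neighbourhoods U₁, U₂ of 0 that are both C^k-Z-realizations of the k-Z-jet of f are isotopical near Z at zero: there exist an open neighbourhood Ω ⊆ U₁ ∩ U₂ of 0 and a continuous map H : Ω × [0,1] → ℝⁿ such that H(x,0) = x for all x ∈ Ω; H(x,t) = x for all x ∈ Ω ∩ Z and t ∈ [0,1]; for every t ∈ [0,1] the map x ↦ H(x,t) is a homeomorphism of Ω onto its image; and H(x,1) ∈ U₁ with f₁(H(x,1)) = f₂(x) for all x ∈ Ω. -/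

import Mathlib

/-- The exponents in `N` variables of total degree at most `m`. -/
noncomputable def monos (N m : ℕ) : Finset (Fin N →₀ ℕ) :=
  (Finset.range (m + 1)).biUnion fun j => Finset.finsuppAntidiag Finset.univ j

lemma mem_monos {N m : ℕ} {b : Fin N →₀ ℕ} : b ∈ monos N m ↔ ∑ i, b i ≤ m := by
  simp [monos, Finset.mem_finsuppAntidiag]

lemma card_monos_succ (N m : ℕ) :
    (monos N (m + 1)).card = (monos N m).card + N.multichoose (m + 1) := by
  rw [monos, Finset.range_add_one, Finset.biUnion_insert, Finset.union_comm,
    Finset.card_union_of_disjoint]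
  · rw [Finset.card_finsuppAntidiag_nat_eq_multichoose]; simp [monos]
  · rw [Finset.disjoint_left]
    intro b hb hb'
    have h1 : b ∈ monos N m := hb
    rw [mem_monos] at h1
    have h2 : ∑ i, b i = m + 1 := (Finset.mem_finsuppAntidiag.1 hb').1
    omega

lemma card_monos (N m : ℕ) : (monos N m).card = (N + 1).multichoose m := by
  induction m with
  | zero => simp [monos]
  | succ m ih => rw [card_monos_succ, ih, Nat.multichoose_succ_succ]; ring

lemma multichoose_mono (N : ℕ) : Monotone (N + 1).multichoose := by
  refine monotone_nat_of_le_succ fun m => ?_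
  rw [Nat.multichoose_succ_succ]; omega

lemma card_monos_add_le (N m d : ℕ) :
    (monos (N + 1) (m + d)).card ≤
      (monos (N + 1) m).card + d * (monos N (m + d)).card := by
  induction d with
  | zero => simp
  | succ d ih =>
    rw [← add_assoc, card_monos_succ]
    have h1 : (monos N (m + d)).card ≤ (monos N (m + d + 1)).card := by
      rw [card_monos, card_monos]; exact multichoose_mono N (Nat.le_succ _)
    have h2 : (N + 1).multichoose (m + d + 1) = (monos N (m + d + 1)).card := (card_monos _ _).symm
    rw [h2]
    nlinarith [Nat.mul_le_mul_left d h1]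

lemma card_monos_le (N m : ℕ) : (monos N m).card * N.factorial ≤ (m + N) ^ N := by
  rw [card_monos, Nat.multichoose_eq, show N + 1 + m - 1 = m + N by omega,
    Nat.choose_symm_add, mul_comm, ← Nat.ascFactorial_eq_factorial_mul_choose]
  exact Nat.ascFactorial_le_pow_add m N

lemma le_card_monos (N m : ℕ) : m ^ N ≤ (monos N m).card * N.factorial := by
  rw [card_monos, Nat.multichoose_eq, show N + 1 + m - 1 = m + N by omega,
    Nat.choose_symm_add, mul_comm, ← Nat.ascFactorial_eq_factorial_mul_choose]
  exact (Nat.pow_le_pow_left (Nat.le_succ _) _).trans (Nat.pow_succ_le_ascFactorial _ N)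

open Filter Topology in
lemma exists_card_monos_lt (n d E a c : ℕ) (hE : 0 < E) (ha : d * E ^ n < a) :
    ∃ B, d ≤ E * B + c ∧ d * (monos n (E * B + c)).card < a * (monos n B).card := by
  have h1 : Tendsto (fun B : ℕ => (d : ℝ) * (E + ((c + n : ℕ) : ℝ) / (B : ℝ)) ^ n) atTop
      (𝓝 ((d : ℝ) * (E + 0) ^ n)) := by
    refine Tendsto.const_mul _ (Tendsto.pow (Tendsto.const_add _ ?_) _)
    exact tendsto_const_div_atTop_nhds_zero_nat _
  have h2 : ∀ᶠ B : ℕ in atTop, (d : ℝ) * (E + ((c + n : ℕ) : ℝ) / (B : ℝ)) ^ n < a := by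
    apply h1.eventually_lt_const
    rw [add_zero]; exact_mod_cast ha
  obtain ⟨B, hB, hB1, hB2⟩ := (h2.and ((eventually_ge_atTop 1).and (eventually_ge_atTop d))).exists
  refine ⟨B, by nlinarith, ?_⟩
  have hBpos : (0 : ℝ) < B := by exact_mod_cast hB1
  have h3 : d * (E * B + c + n) ^ n < a * B ^ n := by
    have : (d : ℝ) * (E + ((c + n : ℕ) : ℝ) / (B : ℝ)) ^ n * B ^ n < a * B ^ n :=
      mul_lt_mul_of_pos_right hB (by positivity)
    rw [mul_assoc, ← mul_pow, add_mul, div_mul_cancel₀ _ hBpos.ne'] at this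
    exact_mod_cast (by push_cast at this ⊢; rw [add_assoc]; exact this :
      (((d * (E * B + c + n) ^ n : ℕ)) : ℝ) < ((a * B ^ n : ℕ) : ℝ))
  have h4 := card_monos_le n (E * B + c)
  have h5 := le_card_monos n B
  have h6 : 0 < n.factorial := Nat.factorial_pos n
  by_contra hcon
  push Not at hcon
  have := Nat.mul_le_mul_right n.factorial hcon
  nlinarith [Nat.mul_le_mul_left d h4, Nat.mul_le_mul_left a h5]

open MvPolynomial in
lemma exists_algebraic_relation {R : Type*} [CommRing R] [IsDomain R] (n d D E A : ℕ) (hE : 0 < E)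
    (hED : E ≤ D) (hA : d * E ^ n ≤ A) :
    ∃ B : ℕ, ∀ (P G H : MvPolynomial (Fin (n + 1)) R) (Ξ : Fin n → MvPolynomial (Fin (n + 1)) R),
      P ≠ 0 → P.totalDegree ≤ d → G.totalDegree ≤ D → H.totalDegree ≤ E →
      (∀ i, (Ξ i).totalDegree ≤ E) →
      ∃ c : ℕ → (Fin n →₀ ℕ) → R, (∃ a ≤ A, ∃ b ∈ monos n B, c a b ≠ 0) ∧
        P ∣ ∑ a ∈ Finset.range (A + 1), ∑ b ∈ monos n B,
          C (c a b) * (G ^ a * H ^ (A - a) * ((∏ i, Ξ i ^ b i) * H ^ (B - ∑ i, b i))) := by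
  classical
  obtain ⟨B, hdB, hB⟩ := exists_card_monos_lt n d E (A + 1) (D * A) hE (by omega)
  refine ⟨B, fun P G H Ξ hP hPd hG hH hΞ => ?_⟩
  set m := E * B + D * A with hm
  obtain ⟨m', hm'⟩ : ∃ m', m = m' + d := ⟨m - d, by omega⟩
  let U : ℕ → (Fin n →₀ ℕ) → MvPolynomial (Fin (n + 1)) R := fun a b =>
    G ^ a * H ^ (A - a) * ((∏ i, Ξ i ^ b i) * H ^ (B - ∑ i, b i))
  have hU : ∀ a ≤ A, ∀ b ∈ monos n B, (U a b).totalDegree ≤ m := by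
    intro a ha b hb
    rw [mem_monos] at hb
    have e1 : (G ^ a).totalDegree ≤ a * D :=
      (totalDegree_pow _ _).trans (Nat.mul_le_mul_left _ hG)
    have e2 : ∀ j, (H ^ j).totalDegree ≤ j * E := fun j =>
      (totalDegree_pow _ _).trans (Nat.mul_le_mul_left _ hH)
    have e3 : (∏ i, Ξ i ^ b i).totalDegree ≤ (∑ i, b i) * E := by
      refine (totalDegree_finsetProd _ _).trans ?_
      rw [Finset.sum_mul]
      exact Finset.sum_le_sum fun i _ =>
        (totalDegree_pow _ _).trans (Nat.mul_le_mul_left _ (hΞ i))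
    refine (totalDegree_mul _ _).trans ?_
    have e4 := totalDegree_mul (G ^ a) (H ^ (A - a))
    have e5 := totalDegree_mul (∏ i, Ξ i ^ b i) (H ^ (B - ∑ i, b i))
    have e6 : (A - a) * E ≤ (A - a) * D := Nat.mul_le_mul_left _ hED
    have e7 : a * D + (A - a) * D = D * A := by
      rw [← add_mul, Nat.add_sub_cancel' ha, mul_comm]
    have e8 : (∑ i, b i) * E + (B - ∑ i, b i) * E = E * B := by
      rw [← add_mul, Nat.add_sub_cancel' hb, mul_comm]
    have := e2 (A - a); have := e2 (B - ∑ i, b i)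
    omega
  let I := (Finset.range (A + 1) ×ˢ monos n B : Finset _)
  let J := monos (n + 1) m'
  let K := monos (n + 1) m
  let toPoly : ((I → R) × (J → R)) →ₗ[R] MvPolynomial (Fin (n + 1)) R :=
    (Fintype.linearCombination R (fun i : I => U i.1.1 i.1.2)).coprod
      (Fintype.linearCombination R (fun j : J => P * monomial j.1 (1 : R)))
  have hdeg : ∀ v, (toPoly v).totalDegree ≤ m := by
    intro v
    rw [← mem_restrictTotalDegree]
    simp only [toPoly, LinearMap.coprod_apply, Fintype.linearCombination_apply]
    refine Submodule.add_mem _ (Submodule.sum_mem _ fun i _ => Submodule.smul_mem _ _ ?_)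
      (Submodule.sum_mem _ fun j _ => Submodule.smul_mem _ _ ?_)
    · rw [mem_restrictTotalDegree]
      have := i.2
      simp only [I, Finset.mem_product, Finset.mem_range] at this
      exact hU _ (by omega) _ this.2
    · rw [mem_restrictTotalDegree]
      have h1 := mem_monos.1 j.2
      have h2 : (monomial j.1 (1 : R)).totalDegree ≤ m' := by
        rw [totalDegree_monomial _ one_ne_zero, Finsupp.sum_fintype _ _ (fun _ => rfl)]
        exact h1
      have := totalDegree_mul P (monomial j.1 (1 : R))
      omega
  let L : ((I → R) × (J → R)) →ₗ[R] (K → R) :=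
    LinearMap.pi fun κ => (lcoeff R κ.1) ∘ₗ toPoly
  have hL : ∀ v, L v = 0 → toPoly v = 0 := by
    intro v hv
    ext κ
    rw [coeff_zero]
    by_cases hκ : κ ∈ K
    · exact congrFun hv ⟨κ, hκ⟩
    · apply coeff_eq_zero_of_totalDegree_lt
      have h1 : ¬ ∑ i, κ i ≤ m := fun h => hκ (mem_monos.2 h)
      have h2 : ∑ i ∈ κ.support, κ i = ∑ i, κ i :=
        Finsupp.sum_fintype κ (fun _ x => x) (fun _ => rfl)
      have := hdeg v
      omega
  have hninj : ¬ Function.Injective L := by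
    intro hinj
    have e : ((I ⊕ J) → R) ≃ₗ[R] ((I → R) × (J → R)) := LinearEquiv.sumArrowLequivProdArrow _ _ _ _
    have h1 := card_le_of_injective R (L ∘ₗ e.toLinearMap) (by
      simpa using hinj)
    have h2 := card_monos_add_le n m' d
    rw [← hm'] at h2
    simp only [Fintype.card_sum, Fintype.card_coe, I, J, K, Finset.card_product,
      Finset.card_range] at h1
    omega
  obtain ⟨v, hv, hv0⟩ : ∃ v, L v = 0 ∧ v ≠ 0 := by
    by_contra hcon
    push Not at hcon
    exact hninj ((injective_iff_map_eq_zero L).2 hcon)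
  have hpoly := hL v hv
  let c : ℕ → (Fin n →₀ ℕ) → R := fun a b => if h : (a, b) ∈ I then v.1 ⟨(a, b), h⟩ else 0
  have hsum : Fintype.linearCombination R (fun i : I => U i.1.1 i.1.2) v.1 =
      ∑ a ∈ Finset.range (A + 1), ∑ b ∈ monos n B, C (c a b) * U a b := by
    rw [Fintype.linearCombination_apply, ← Finset.sum_product', ← Finset.sum_coe_sort I]
    refine Finset.sum_congr rfl fun i _ => ?_
    have : c i.1.1 i.1.2 = v.1 i := by simp [c]
    rw [this, smul_eq_C_mul]
  have hsum2 : Fintype.linearCombination R (fun j : J => P * monomial j.1 (1 : R)) v.2 =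
      P * ∑ j : J, monomial j.1 (v.2 j) := by
    rw [Fintype.linearCombination_apply, Finset.mul_sum]
    refine Finset.sum_congr rfl fun j _ => ?_
    rw [← mul_smul_comm, smul_monomial, smul_eq_mul, mul_one]
  have htot : (∑ a ∈ Finset.range (A + 1), ∑ b ∈ monos n B, C (c a b) * U a b) +
      P * ∑ j : J, monomial j.1 (v.2 j) = 0 := by
    rw [← hsum, ← hsum2]; exact hpoly
  refine ⟨c, ?_, ?_⟩
  · by_contra hcon
    push Not at hcon
    apply hv0
    have hc : v.1 = 0 := by
      ext i
      have := i.2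
      simp only [I, Finset.mem_product, Finset.mem_range] at this
      have h3 := hcon i.1.1 (by omega) i.1.2 this.2
      simpa [c] using h3
    have h4 : Fintype.linearCombination R (fun i : I => U i.1.1 i.1.2) v.1 = 0 := by
      rw [hc, map_zero]
    rw [← hsum, h4, zero_add, mul_eq_zero] at htot
    have h5 := htot.resolve_left hP
    refine Prod.ext hc ?_
    ext j
    have h6 := congrArg (coeff j.1) h5
    rw [coeff_sum, Finset.sum_eq_single j] at h6
    · simpa using h6
    · intro j' _ hj'
      rw [coeff_monomial, if_neg (fun h => hj' (Subtype.ext h))]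
    · simp
  · rw [eq_neg_of_add_eq_zero_left htot]
    exact (Dvd.intro _ rfl).neg_right

/-- The weight `∑ bᵢ (B+1)ⁱ`, injective on exponents of degree at most `B`. -/
def wt {n : ℕ} (B : ℕ) (b : Fin n →₀ ℕ) : ℕ := ∑ i, b i * (B + 1) ^ (i : ℕ)

lemma wt_injOn {n B : ℕ} : Set.InjOn (wt B) (monos n B : Set (Fin n →₀ ℕ)) := by
  intro b hb b' hb' h
  have key : ∀ b ∈ monos n B, ∀ i, b i < B + 1 := fun b hb i => by
    have := mem_monos.1 hb
    have h2 := Finset.single_le_sum (f := fun i => b i) (fun _ _ => Nat.zero_le _)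
      (Finset.mem_univ i)
    have h3 : b i ≤ ∑ i, b i := h2
    omega
  let g : Fin n → Fin (B + 1) := fun i => ⟨b i, key b hb i⟩
  let g' : Fin n → Fin (B + 1) := fun i => ⟨b' i, key b' hb' i⟩
  have h3 : g = g' := by
    apply finFunctionFinEquiv.injective
    ext
    rw [finFunctionFinEquiv_apply, finFunctionFinEquiv_apply]
    exact h
  ext i
  exact congrArg Fin.val (congrFun h3 i)

open Filter Topology Metric in
lemma exists_selected_maximizer (n B : ℕ) {r : ℝ} (hr : 0 < r)
    {ψ : EuclideanSpace ℝ (Fin n) → ℝ}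
    (hcont : ContinuousOn ψ (closedBall 0 r)) (h0 : 0 < ψ 0) (hsph : ∀ x, ‖x‖ = r → ψ x = 0)
    (hdiff : ∀ x ∈ ball (0 : EuclideanSpace ℝ (Fin n)) r, DifferentiableAt ℝ ψ x) :
    ∃ z ∈ ball (0 : EuclideanSpace ℝ (Fin n)) r, (∀ y ∈ closedBall 0 r, ψ y ≤ ψ z) ∧
      ∀ (G : EuclideanSpace ℝ (Fin n) → ℝ), ContinuousOn G (closedBall 0 r) →
      ∀ S ⊆ monos n B, ∀ b₀ ∈ S, (∀ b ∈ S, wt B b₀ ≤ wt B b) →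
      ∀ q : (Fin n →₀ ℕ) → Polynomial ℝ,
      (∀ x ∈ ball (0 : EuclideanSpace ℝ (Fin n)) r, ∑ b ∈ S, (q b).eval (G x) *
        ∏ i, (fderiv ℝ ψ x (EuclideanSpace.single i 1)) ^ b i = 0) →
      (q b₀).eval (G z) = 0 := by
  let lin : ℝ → EuclideanSpace ℝ (Fin n) → ℝ := fun τ x => ∑ i : Fin n, τ ^ (B + 1) ^ (i : ℕ) * x i
  have hlin : Continuous fun p : ℝ × EuclideanSpace ℝ (Fin n) => lin p.1 p.2 := by fun_prop
  have hlin0 : ∀ x, lin 0 x = 0 := fun x => by simp [lin]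
  have hmax : ∀ τ, ∃ x ∈ closedBall (0 : EuclideanSpace ℝ (Fin n)) r,
      ∀ y ∈ closedBall (0 : EuclideanSpace ℝ (Fin n)) r,
      ψ y - lin τ y ≤ ψ x - lin τ x := by
    intro τ
    have hc : ContinuousOn (fun x => ψ x - lin τ x) (closedBall (0 : EuclideanSpace ℝ (Fin n)) r) :=
      hcont.sub (hlin.comp (Continuous.prodMk_right τ)).continuousOn
    obtain ⟨x, hx, hx'⟩ := (isCompact_closedBall (0 : EuclideanSpace ℝ (Fin n)) r).exists_isMaxOn
      ⟨0, by simp [hr.le]⟩ hc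
    exact ⟨x, hx, fun y hy => hx' hy⟩
  choose x hxmem hxmax using hmax
  let 𝒰 : Ultrafilter ℝ := Ultrafilter.of (𝓝[>] (0 : ℝ))
  have h𝒰 : (𝒰 : Filter ℝ) ≤ 𝓝[>] 0 := Ultrafilter.of_le _
  have hτ : Tendsto (fun τ : ℝ => τ) 𝒰 (𝓝 0) := h𝒰.trans nhdsWithin_le_nhds
  have hpos : ∀ᶠ τ : ℝ in 𝒰, 0 < τ := h𝒰 self_mem_nhdsWithin
  obtain ⟨z, hz, hzlim⟩ :=
    (isCompact_closedBall (0 : EuclideanSpace ℝ (Fin n)) r).ultrafilter_le_nhds (𝒰.map x)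
    (by
      rw [le_principal_iff, Ultrafilter.mem_coe, Ultrafilter.mem_map]
      exact univ_mem' hxmem)
  replace hzlim : Tendsto x 𝒰 (𝓝 z) := hzlim
  have hzlim' : Tendsto x 𝒰 (𝓝[closedBall 0 r] z) :=
    tendsto_nhdsWithin_iff.2 ⟨hzlim, Eventually.of_forall hxmem⟩
  have hlimlin : ∀ {y : ℝ → EuclideanSpace ℝ (Fin n)} {y₀ : EuclideanSpace ℝ (Fin n)},
      Tendsto y 𝒰 (𝓝 y₀) →
      Tendsto (fun τ => lin τ (y τ)) 𝒰 (𝓝 0) := by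
    intro y y₀ hy
    have := (hlin.tendsto (0, y₀)).comp (hτ.prodMk_nhds hy)
    simp only [hlin0] at this
    exact this
  have hψlim : Tendsto (fun τ => ψ (x τ)) 𝒰 (𝓝 (ψ z)) := (hcont z hz).tendsto.comp hzlim'
  have hzmax : ∀ y ∈ closedBall (0 : EuclideanSpace ℝ (Fin n)) r, ψ y ≤ ψ z := by
    intro y hy
    have h1 : Tendsto (fun τ => ψ y - lin τ y) 𝒰 (𝓝 (ψ y - 0)) :=
      (hlimlin tendsto_const_nhds).const_sub _
    have h2 : Tendsto (fun τ => ψ (x τ) - lin τ (x τ)) 𝒰 (𝓝 (ψ z - 0)) :=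
      hψlim.sub (hlimlin hzlim)
    simpa using le_of_tendsto_of_tendsto' h1 h2 fun τ => hxmax τ y hy
  have hzball : z ∈ ball (0 : EuclideanSpace ℝ (Fin n)) r := by
    rw [mem_ball_zero_iff]
    rw [mem_closedBall_zero_iff] at hz
    refine lt_of_le_of_ne hz fun h => ?_
    have := hzmax 0 (by simp [hr.le])
    rw [hsph z h] at this
    linarith
  refine ⟨z, hzball, hzmax, fun G hG S hS b₀ hb₀ hlow q hq => ?_⟩
  have hxball : ∀ᶠ τ in (𝒰 : Filter ℝ), x τ ∈ ball (0 : EuclideanSpace ℝ (Fin n)) r :=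
    hzlim (isOpen_ball.mem_nhds hzball)
  have hder : ∀ᶠ τ in (𝒰 : Filter ℝ), ∀ i : Fin n,
      fderiv ℝ ψ (x τ) (EuclideanSpace.single i 1) = τ ^ (B + 1) ^ (i : ℕ) := by
    filter_upwards [hxball] with τ hτ i
    have hmaxl : IsLocalMax (fun y => ψ y - lin τ y) (x τ) := by
      filter_upwards [isOpen_ball.mem_nhds hτ] with y hy
      exact hxmax τ y (ball_subset_closedBall hy)
    let l : EuclideanSpace ℝ (Fin n) →L[ℝ] ℝ :=
      ∑ i : Fin n, τ ^ (B + 1) ^ (i : ℕ) • EuclideanSpace.proj i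
    have hl : ∀ y, lin τ y = l y := fun y => by simp only [lin, l, sum_apply]; rfl
    have hd : HasFDerivAt (fun y => ψ y - lin τ y) (fderiv ℝ ψ (x τ) - l) (x τ) := by
      simp only [hl]
      exact (hdiff _ hτ).hasFDerivAt.sub l.hasFDerivAt
    have h3 := hmaxl.hasFDerivAt_eq_zero hd
    have h4 := congrArg
      (fun L : EuclideanSpace ℝ (Fin n) →L[ℝ] ℝ => L (EuclideanSpace.single i 1)) h3
    simp only [sub_apply, zero_apply] at h4
    rw [← hl] at h4
    have h5 : lin τ (EuclideanSpace.single i 1) = τ ^ (B + 1) ^ (i : ℕ) := by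
      simp [lin]
    linarith
  have hGlim : Tendsto (fun τ => G (x τ)) 𝒰 (𝓝 (G z)) := (hG z hz).tendsto.comp hzlim'
  have hrel : ∀ᶠ τ in (𝒰 : Filter ℝ),
      ∑ b ∈ S, (q b).eval (G (x τ)) * τ ^ (wt B b - wt B b₀) = 0 := by
    filter_upwards [hder, hxball, hpos] with τ h1 h2 h3
    have h4 := hq _ h2
    have h5 : ∀ b ∈ S, ∏ i, (fderiv ℝ ψ (x τ) (EuclideanSpace.single i 1)) ^ b i =
        τ ^ (wt B b - wt B b₀) * τ ^ wt B b₀ := by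
      intro b hb
      rw [← pow_add, Nat.sub_add_cancel (hlow b hb), wt, ← Finset.prod_pow_eq_pow_sum]
      refine Finset.prod_congr rfl fun i _ => ?_
      rw [h1 i, ← pow_mul, mul_comm]
    rw [Finset.sum_congr rfl fun b hb => by rw [h5 b hb, ← mul_assoc], ← Finset.sum_mul] at h4
    exact (mul_eq_zero.1 h4).resolve_right (pow_ne_zero _ h3.ne')
  have hlimsum : Tendsto (fun τ => ∑ b ∈ S, (q b).eval (G (x τ)) * τ ^ (wt B b - wt B b₀)) 𝒰
      (𝓝 (∑ b ∈ S, (q b).eval (G z) * 0 ^ (wt B b - wt B b₀))) :=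
    tendsto_finsetSum _ fun b _ =>
      (((q b).continuous.tendsto _).comp hGlim).mul (hτ.pow _)
  have h6 : ∑ b ∈ S, (q b).eval (G z) * (0 : ℝ) ^ (wt B b - wt B b₀) = (q b₀).eval (G z) := by
    rw [Finset.sum_eq_single b₀]
    · simp
    · intro b hb hne
      have h7 : wt B b ≠ wt B b₀ := fun h => hne (wt_injOn (hS hb) (hS hb₀) h)
      have := hlow b hb
      rw [zero_pow (by omega), mul_zero]
    · exact fun h => absurd hb₀ h
  rw [h6] at hlimsum
  exact tendsto_nhds_unique hlimsum (tendsto_const_nhds.congr' (hrel.mono fun τ h => h.symm))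

section
open Filter Topology

lemma Polynomial.exists_bounds_nhdsGT_zero {p : Polynomial ℝ} (hp : p ≠ 0) :
    ∃ (α : ℕ) (K : ℝ), 1 ≤ K ∧ ∀ᶠ l in 𝓝[>] (0 : ℝ),
      l ^ α ≤ K * |p.eval l| ∧ |p.eval l| ≤ K * l ^ α := by
  obtain ⟨u, hu, hdvd⟩ := Polynomial.exists_eq_pow_rootMultiplicity_mul_and_not_dvd p hp 0
  set α := Polynomial.rootMultiplicity 0 p
  have hu0 : u.eval 0 ≠ 0 := fun h => hdvd (Polynomial.dvd_iff_isRoot.2 h)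
  have hc : Tendsto (fun l => |u.eval l|) (𝓝[>] 0) (𝓝 |u.eval 0|) :=
    (u.continuous.abs.tendsto 0).mono_left nhdsWithin_le_nhds
  have hpos : 0 < |u.eval 0| := abs_pos.2 hu0
  have h1 := hc.eventually_const_lt (half_lt_self hpos)
  have h2 := hc.eventually_lt_const (lt_add_one |u.eval 0|)
  refine ⟨α, max (|u.eval 0| + 1) (2 / |u.eval 0|), ?_, ?_⟩
  · exact le_max_of_le_left (by linarith)
  filter_upwards [h1, h2, self_mem_nhdsWithin] with l h1 h2 h3
  have h3 : 0 < l := h3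
  have hl : 0 < l ^ α := by positivity
  have e : |p.eval l| = l ^ α * |u.eval l| := by
    rw [hu]; simp [abs_mul, abs_of_pos h3]
  rw [e]
  constructor
  · have : 1 ≤ 2 / |u.eval 0| * |u.eval l| := by
      rw [div_mul_eq_mul_div, le_div_iff₀ hpos]; linarith
    have h4 : 2 / |u.eval 0| * |u.eval l| ≤
        max (|u.eval 0| + 1) (2 / |u.eval 0|) * |u.eval l| :=
      mul_le_mul_of_nonneg_right (le_max_right _ _) (abs_nonneg _)
    nlinarith
  · rw [mul_comm]
    exact mul_le_mul_of_nonneg_right (h2.le.trans (le_max_left _ _)) hl.le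

lemma exists_two_comparable_terms {A : ℕ} {t : ℕ → ℝ} (hs : ∑ j ∈ Finset.range (A + 1), t j = 0)
    (hne : ∃ j ≤ A, t j ≠ 0) :
    ∃ j ≤ A, ∃ i ≤ A, i < j ∧ t i ≠ 0 ∧ t j ≠ 0 ∧ |t i| ≤ (A + 1) * |t j| ∧
      |t j| ≤ (A + 1) * |t i| := by
  obtain ⟨j, hj, hjmax⟩ := (Finset.range (A + 1)).exists_max_image (fun j => |t j|) ⟨0, by simp⟩
  have hjpos : 0 < |t j| := by
    obtain ⟨i, hi, hti⟩ := hne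
    exact (abs_pos.2 hti).trans_le (hjmax i (by simp; omega))
  have hother : ∃ i ∈ (Finset.range (A + 1)).erase j, |t j| ≤ (A + 1) * |t i| := by
    by_contra hcon
    push Not at hcon
    rw [← Finset.add_sum_erase _ _ hj] at hs
    have h1 : |t j| ≤ ∑ i ∈ (Finset.range (A + 1)).erase j, |t i| := by
      rw [eq_neg_of_add_eq_zero_left hs, abs_neg]
      exact Finset.abs_sum_le_sum_abs _ _
    have h2 : ∑ i ∈ (Finset.range (A + 1)).erase j, |t i| ≤
        ∑ i ∈ (Finset.range (A + 1)).erase j, |t j| / (A + 1) :=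
      Finset.sum_le_sum fun i hi => by
        rw [le_div_iff₀ (by positivity), mul_comm]; exact (hcon i hi).le
    rw [Finset.sum_const, Finset.card_erase_of_mem hj, Finset.card_range, nsmul_eq_mul,
      Nat.add_sub_cancel] at h2
    have h3 : (A : ℝ) * (|t j| / (A + 1)) < |t j| := by
      rw [← mul_div_assoc, div_lt_iff₀ (by positivity)]; nlinarith
    linarith
  obtain ⟨i, hi, hij⟩ := hother
  rw [Finset.mem_erase, Finset.mem_range] at hi
  rw [Finset.mem_range] at hj
  have hA : (0 : ℝ) ≤ A := Nat.cast_nonneg _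
  have hi' : |t i| ≤ |t j| := hjmax i (by simp; omega)
  have hipos : 0 < |t i| := by
    by_contra h
    have : |t i| = 0 := le_antisymm (not_lt.1 h) (abs_nonneg _)
    rw [this] at hij; linarith
  have h1 : |t i| ≤ (A + 1) * |t j| := by nlinarith
  rcases lt_or_gt_of_ne hi.1 with h | h
  · exact ⟨j, by omega, i, by omega, h, abs_pos.1 hipos, abs_pos.1 hjpos, h1, hij⟩
  · exact ⟨i, by omega, j, by omega, h, abs_pos.1 hjpos, abs_pos.1 hipos, hij, h1⟩

lemma newton_dichotomy_aux {A b α β : ℕ} (hb : 1 ≤ b) (hbA : b ≤ A) {K l t : ℝ} (hK : 1 ≤ K)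
    (hl : 0 < l) (hl1 : l ≤ 1) (ht : 0 < t) (h1 : l ^ α * t ^ b ≤ K * l ^ (β + b))
    (h2 : l ^ (β + b) ≤ K * (l ^ α * t ^ b)) : t ^ A ≤ K ^ A * l ∨ 1 / K ≤ t := by
  rcases Nat.lt_or_ge α (β + b) with h | h
  · left
    obtain ⟨e, he⟩ : ∃ e, β + b = α + 1 + e := ⟨β + b - (α + 1), by omega⟩
    have h3 : t ^ b ≤ K * l := by
      rw [he, pow_add, pow_succ] at h1
      have h4 : l ^ e ≤ 1 := pow_le_one₀ hl.le hl1
      have h5 : 0 < l ^ α := by positivity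
      have h6 : l ^ α * t ^ b ≤ l ^ α * (K * l) := by
        calc _ ≤ _ := h1
          _ = l ^ α * (K * l) * l ^ e := by ring
          _ ≤ l ^ α * (K * l) * 1 := by gcongr
          _ = _ := mul_one _
      exact le_of_mul_le_mul_left h6 h5
    have h4 : t ≤ K := by
      by_contra hcon
      push Not at hcon
      have h5 : t ≤ t ^ b := le_self_pow₀ (by linarith) (by omega)
      nlinarith
    obtain ⟨c, rfl⟩ : ∃ c, A = b + c := ⟨A - b, by omega⟩
    calc t ^ (b + c) = t ^ b * t ^ c := pow_add _ _ _
      _ ≤ (K * l) * K ^ c := by gcongr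
      _ = K ^ (1 + c) * l := by ring
      _ ≤ K ^ (b + c) * l := by gcongr
  · right
    obtain ⟨e, he⟩ : ∃ e, α = β + b + e := ⟨α - (β + b), by omega⟩
    have h3 : 1 ≤ K * t ^ b := by
      have h5 : 0 < l ^ (β + b) := by positivity
      have h4 : l ^ e ≤ 1 := pow_le_one₀ hl.le hl1
      have h6 : l ^ (β + b) * 1 ≤ l ^ (β + b) * (K * t ^ b) := by
        calc _ = l ^ (β + b) := mul_one _
          _ ≤ _ := h2
          _ = l ^ (β + b) * (K * t ^ b) * l ^ e := by rw [he]; ring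
          _ ≤ l ^ (β + b) * (K * t ^ b) * 1 := by gcongr
          _ = _ := mul_one _
      exact le_of_mul_le_mul_left h6 h5
    rw [div_le_iff₀ (by linarith)]
    by_contra hcon
    push Not at hcon
    have h7 : t < 1 := by nlinarith
    have h8 : t ^ b ≤ t := pow_le_of_le_one ht.le h7.le (by omega)
    nlinarith

lemma newton_dichotomy {A : ℕ} {q : Polynomial (Polynomial ℝ)} (hq : q ≠ 0)
    (hdeg : q.natDegree ≤ A) {M : ℝ → ℝ}
    (hM : ∀ᶠ l in 𝓝[>] (0 : ℝ), 0 < M l ∧ (q.map (Polynomial.evalRingHom l)).eval (M l) = 0) :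
    ∃ C : ℝ, 1 ≤ C ∧ ∀ᶠ l in 𝓝[>] (0 : ℝ), (M l * l) ^ A ≤ C * l ∨ 1 / C ≤ M l * l := by
  have hex : ∀ j, ∃ (α : ℕ) (K : ℝ), 1 ≤ K ∧ (q.coeff j ≠ 0 → ∀ᶠ l in 𝓝[>] (0 : ℝ),
      l ^ α ≤ K * |(q.coeff j).eval l| ∧ |(q.coeff j).eval l| ≤ K * l ^ α) := by
    intro j
    by_cases h : q.coeff j = 0
    · exact ⟨0, 1, le_rfl, fun h' => absurd h h'⟩
    · obtain ⟨α, K, h1, h2⟩ := Polynomial.exists_bounds_nhdsGT_zero h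
      exact ⟨α, K, h1, fun _ => h2⟩
  choose α κ hκ hακ using hex
  set K₀ := ∑ j ∈ Finset.range (A + 1), κ j
  have hκK : ∀ j ≤ A, κ j ≤ K₀ := fun j hj =>
    Finset.single_le_sum (f := κ) (fun i _ => zero_le_one.trans (hκ i)) (by simp; omega)
  have hK₀ : 1 ≤ K₀ := (hκ 0).trans (hκK 0 (Nat.zero_le _))
  have hall : ∀ᶠ l in 𝓝[>] (0 : ℝ), ∀ j ∈ Finset.range (A + 1), q.coeff j ≠ 0 →
      l ^ α j ≤ K₀ * |(q.coeff j).eval l| ∧ |(q.coeff j).eval l| ≤ K₀ * l ^ α j := by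
    rw [Filter.eventually_all_finset]
    intro j hj
    by_cases h : q.coeff j = 0
    · exact Eventually.of_forall fun _ h' => absurd h h'
    · filter_upwards [hακ j h, self_mem_nhdsWithin] with l h1 h2 _
      have h2 : 0 < l := h2
      have h3 := hκK j (by simp at hj; omega)
      exact ⟨h1.1.trans (by gcongr), h1.2.trans (by gcongr)⟩
  have hA : (0 : ℝ) ≤ A := Nat.cast_nonneg _
  set K := (A + 1) * K₀ ^ 2 with hKdef
  have hK : 1 ≤ K := by nlinarith
  refine ⟨K ^ A * K, by nlinarith [one_le_pow₀ (n := A) hK], ?_⟩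
  filter_upwards [hM, hall, self_mem_nhdsWithin, nhdsWithin_le_nhds (eventually_le_nhds
    (show (0 : ℝ) < 1 by norm_num))] with l hM hall hl hl1
  have hl : 0 < l := hl
  obtain ⟨hMpos, hroot⟩ := hM
  rw [Polynomial.eval_eq_sum_range' (n := A + 1)
    (lt_of_le_of_lt Polynomial.natDegree_map_le (by omega))] at hroot
  simp only [Polynomial.coeff_map, Polynomial.coe_evalRingHom] at hroot
  have hne0 : ∀ j ≤ A, q.coeff j ≠ 0 → (q.coeff j).eval l * M l ^ j ≠ 0 := by
    intro j hj h
    refine mul_ne_zero (fun h0 => ?_) (pow_pos hMpos j).ne'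
    have := (hall j (by simp; omega) h).1
    rw [h0, abs_zero, mul_zero] at this
    exact absurd this (not_le.2 (by positivity))
  obtain ⟨j, hj, i, hi, hij, hti, htj, h1, h2⟩ := exists_two_comparable_terms hroot
    ⟨q.natDegree, hdeg, hne0 _ hdeg (by simpa using hq)⟩
  have hqi : q.coeff i ≠ 0 := fun h => hti (by simp [h])
  have hqj : q.coeff j ≠ 0 := fun h => htj (by simp [h])
  obtain ⟨hi1, hi2⟩ := hall i (by simp; omega) hqi
  obtain ⟨hj1, hj2⟩ := hall j (by simp; omega) hqj
  obtain ⟨b, rfl⟩ : ∃ b, j = i + b := ⟨j - i, by omega⟩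
  rw [abs_mul, abs_mul, abs_of_pos (pow_pos hMpos _), abs_of_pos (pow_pos hMpos _)] at h1 h2
  have hMi : 0 < M l ^ i := pow_pos hMpos _
  set X := |(q.coeff i).eval l|
  set Y := |(q.coeff (i + b)).eval l|
  have h1' : X ≤ (A + 1) * (Y * M l ^ b) := by
    refine le_of_mul_le_mul_right ?_ hMi
    rw [pow_add] at h1; linarith
  have h2' : Y * M l ^ b ≤ (A + 1) * X := by
    refine le_of_mul_le_mul_right ?_ hMi
    rw [pow_add] at h2; linarith
  have hMb : 0 < M l ^ b := pow_pos hMpos _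
  have g1 : l ^ α (i + b) * M l ^ b ≤ K * l ^ α i := by
    calc _ ≤ (K₀ * Y) * M l ^ b := by gcongr
      _ = K₀ * (Y * M l ^ b) := by ring
      _ ≤ K₀ * ((A + 1) * (K₀ * l ^ α i)) :=
        mul_le_mul_of_nonneg_left (h2'.trans (by gcongr)) (by linarith)
      _ = _ := by rw [hKdef]; ring
  have g2 : l ^ α i ≤ K * (l ^ α (i + b) * M l ^ b) := by
    calc _ ≤ K₀ * X := hi1
      _ ≤ K₀ * ((A + 1) * ((K₀ * l ^ α (i + b)) * M l ^ b)) := by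
        exact mul_le_mul_of_nonneg_left (h1'.trans (by gcongr)) (by linarith)
      _ = _ := by rw [hKdef]; ring
  have hlb : 0 < l ^ b := by positivity
  have := newton_dichotomy_aux (A := A) (b := b) (α := α (i + b)) (β := α i) (by omega) (by omega)
    hK hl hl1 (mul_pos hMpos hl)
    (by rw [mul_pow, pow_add]; nlinarith [mul_le_mul_of_nonneg_right g1 hlb.le])
    (by rw [mul_pow, pow_add]; nlinarith [mul_le_mul_of_nonneg_right g2 hlb.le])
  refine this.imp (fun h => h.trans ?_) (fun h => le_trans ?_ h)
  · have := one_le_pow₀ (n := A) hK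
    gcongr; nlinarith
  · have := one_le_pow₀ (n := A) hK
    gcongr; nlinarith

end

section
open Filter Topology Polynomial

lemma AnalyticAt.exists_analytic_implicit {f : ℝ × ℝ → ℝ} (hf : AnalyticAt ℝ f (0, 0))
    (h0 : f (0, 0) = 0) {c : ℝ} (hc : c ≠ 0) (h1 : HasDerivAt (fun w => f (0, w)) c 0) :
    ∃ φ : ℝ → ℝ, AnalyticAt ℝ φ 0 ∧ φ 0 = 0 ∧ ∀ᶠ s in 𝓝 0, f (s, φ s) = 0 := by
  have cdf : ContDiffAt ℝ (⊤ : WithTop ℕ∞) f ((0, 0) : ℝ × ℝ) := hf.contDiffAt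
  have h2 : HasDerivAt (fun w => f (0, w)) ((fderiv ℝ f (0, 0) ∘L .inr ℝ ℝ ℝ) 1) 0 := by
    have h3 : HasFDerivAt f (fderiv ℝ f (0, 0)) ((fun w : ℝ => ((0 : ℝ), w)) 0) :=
      hf.differentiableAt.hasFDerivAt
    have h4 : HasFDerivAt (fun w : ℝ => ((0 : ℝ), w)) (.inr ℝ ℝ ℝ) 0 :=
      (ContinuousLinearMap.inr ℝ ℝ ℝ).hasFDerivAt
    exact (h3.comp 0 h4).hasDerivAt
  have h3 : (fderiv ℝ f (0, 0) ∘L .inr ℝ ℝ ℝ) 1 = c := h2.unique h1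
  have hinv : (fderiv ℝ f (0, 0) ∘L .inr ℝ ℝ ℝ).IsInvertible := by
    refine ⟨ContinuousLinearEquiv.unitsEquivAut ℝ (Units.mk0 c hc), ?_⟩
    ext
    rw [h3]; simp
  refine ⟨cdf.implicitFunction (by simp) hinv, ?_, ?_, ?_⟩
  · exact (cdf.contDiffAt_implicitFunction (by simp) hinv).analyticAt
  · exact cdf.implicitFunction_apply_self (by simp) hinv
  · have := cdf.eventually_apply_implicitFunction (by simp) hinv
    rw [h0] at this
    exact this

lemma Polynomial.taylor_coeff_eq_sum {R : Type*} [CommSemiring R] {N : ℕ} {f : R[X]}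
    (hf : f.natDegree ≤ N) (r : R) (i : ℕ) :
    (taylor r f).coeff i =
      ∑ j ∈ Finset.range (N + 1), f.coeff j * (r ^ (j - i) * (j.choose i : R)) := by
  conv_lhs => rw [f.as_sum_range_C_mul_X_pow' (n := N + 1) (by omega)]
  rw [map_sum, finsetSum_coeff]
  refine Finset.sum_congr rfl fun j _ => ?_
  rw [taylor_apply, mul_comp, C_comp, pow_comp, X_comp, coeff_C_mul, coeff_X_add_C_pow]

end

section
open Filter Topology Polynomial

lemma eval_eq_sum_add_pow_mul {N m : ℕ} (hmN : m ≤ N) {f : ℝ[X]} (hf : f.natDegree ≤ N) (w : ℝ) :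
    f.eval w = ∑ i ∈ Finset.range m, f.coeff i * w ^ i +
      (∑ i ∈ Finset.range (N + 1 - m), f.coeff (m + i) * w ^ i) * w ^ m := by
  rw [eval_eq_sum_range' (n := N + 1) (by omega),
    ← Finset.sum_range_add_sum_Ico _ (show m ≤ N + 1 by omega), Finset.sum_Ico_eq_sum_range,
    Finset.sum_mul]
  congr 1
  refine Finset.sum_congr rfl fun i _ => ?_
  rw [pow_add]; ring

lemma tendsto_sum_mul_pow_zero {ι : Type*} {l : Filter ι} {k : ℕ} (hk : 0 < k) {a : ℕ → ι → ℝ}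
    {α : ℕ → ℝ} (ha : ∀ i, Tendsto (a i) l (𝓝 (α i))) {w : ι → ℝ} (hw : Tendsto w l (𝓝 0)) :
    Tendsto (fun s => ∑ i ∈ Finset.range k, a i s * w s ^ i) l (𝓝 (α 0)) := by
  have : Tendsto (fun s => ∑ i ∈ Finset.range k, a i s * w s ^ i) l
      (𝓝 (∑ i ∈ Finset.range k, α i * 0 ^ i)) :=
    tendsto_finsetSum _ fun i _ => (ha i).mul (hw.pow i)
  rwa [Finset.sum_eq_single 0 (fun i _ hi => by simp [hi]) (fun h => by simp at h; omega),
    pow_zero, mul_one] at this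

lemma exists_bound_of_tendsto_coeff {ι : Type*} {l : Filter ι} {m : ℕ} {b : ℕ → ι → ℝ}
    {β : ℕ → ℝ} (hb : ∀ i < m, Tendsto (b i) l (𝓝 (β i))) {R : ι → ℝ} {c : ℝ} (hc : c ≠ 0)
    (hR : Tendsto R l (𝓝 c)) {ω : ι → ℝ}
    (h : ∀ᶠ s in l, ∑ i ∈ Finset.range m, b i s * ω s ^ i + R s * ω s ^ m = 0) :
    ∃ C, ∀ᶠ s in l, |ω s| ≤ C := by
  have hcpos : 0 < |c| := abs_pos.2 hc
  have h1 := hR.abs.eventually_const_lt (half_lt_self hcpos)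
  have h2 : ∀ᶠ s in l, ∀ i ∈ Finset.range m, |b i s| < |β i| + 1 := by
    rw [eventually_all_finset]
    intro i hi
    exact (hb i (by simpa using hi)).abs.eventually_lt_const (lt_add_one _)
  set S := ∑ i ∈ Finset.range m, (|β i| + 1)
  refine ⟨max 1 (S / (|c| / 2)), ?_⟩
  filter_upwards [h, h1, h2] with s h h1 h2
  by_contra hcon
  push Not at hcon
  obtain ⟨hω1, hω2⟩ := max_lt_iff.1 hcon
  rw [div_lt_iff₀ (by linarith)] at hω2
  have h3 : |R s| * |ω s| ^ m ≤ ∑ i ∈ Finset.range m, |b i s| * |ω s| ^ i := by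
    rw [← abs_pow, ← abs_mul, eq_neg_of_add_eq_zero_right h, abs_neg]
    refine (Finset.abs_sum_le_sum_abs _ _).trans (le_of_eq ?_)
    exact Finset.sum_congr rfl fun i _ => by rw [abs_mul, abs_pow]
  rcases Nat.eq_zero_or_pos m with hm | hm
  · subst hm
    simp at h3
    rw [h3, abs_zero] at h1
    linarith
  · have h4 : ∑ i ∈ Finset.range m, |b i s| * |ω s| ^ i ≤ S * |ω s| ^ (m - 1) := by
      rw [Finset.sum_mul]
      refine Finset.sum_le_sum fun i hi => ?_
      have h5 := h2 i hi
      rw [Finset.mem_range] at hi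
      have h6 : |ω s| ^ i ≤ |ω s| ^ (m - 1) := pow_le_pow_right₀ hω1.le (by omega)
      gcongr
    have h5 : 0 < |ω s| ^ (m - 1) := by positivity
    have h6 : |ω s| ^ m = |ω s| * |ω s| ^ (m - 1) := by
      rw [← pow_succ', Nat.sub_add_cancel hm]
    have h7 : |R s| * |ω s| ≤ S := by
      refine le_of_mul_le_mul_right ?_ h5
      rw [mul_assoc, ← h6]; exact h3.trans h4
    nlinarith

/-- `w` is an analytic function of a root of the variable along `𝒰`. -/
def IsPuiseux (𝒰 : Filter ℝ) (w : ℝ → ℝ) : Prop :=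
  ∃ e : ℕ, 0 < e ∧ ∃ ψ : ℝ → ℝ, AnalyticAt ℝ ψ 0 ∧
    ∀ᶠ s in 𝒰, w s = ψ (s ^ ((e : ℝ)⁻¹))

lemma tendsto_rpow_inv_nhdsGT_zero {q : ℕ} (hq : 0 < q) :
    Tendsto (fun s : ℝ => s ^ ((q : ℝ)⁻¹)) (𝓝[>] 0) (𝓝[>] 0) := by
  have hq' : (0 : ℝ) < (q : ℝ)⁻¹ := by positivity
  refine tendsto_nhdsWithin_iff.2 ⟨?_, ?_⟩
  · have := (Real.continuousAt_rpow_const 0 _ (Or.inr hq'.le)).tendsto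
    rw [Real.zero_rpow hq'.ne'] at this
    exact this.mono_left nhdsWithin_le_nhds
  · filter_upwards [self_mem_nhdsWithin] with s hs
    exact Real.rpow_pos_of_pos hs _

lemma isPuiseux_centered {m N : ℕ} {𝒰 : Ultrafilter ℝ} (h𝒰 : (𝒰 : Filter ℝ) ≤ 𝓝[>] 0)
    (ih : ∀ m' < m, ∀ 𝒱 : Ultrafilter ℝ, (𝒱 : Filter ℝ) ≤ 𝓝[>] 0 → ∀ G : ℝ → ℝ[X],
      (∀ s, (G s).natDegree ≤ N) → (∀ i, AnalyticAt ℝ (fun s => (G s).coeff i) 0) →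
      ∀ w : ℝ → ℝ, Tendsto w 𝒱 (𝓝 0) → (∀ᶠ s in 𝒱, (G s).eval (w s) = 0) →
      (∀ i < m', (G 0).coeff i = 0) → (G 0).coeff m' ≠ 0 → IsPuiseux 𝒱 w)
    {F : ℝ → ℝ[X]} (hdeg : ∀ s, (F s).natDegree ≤ N)
    (han : ∀ i, AnalyticAt ℝ (fun s => (F s).coeff i) 0)
    {w : ℝ → ℝ} (hw : Tendsto w 𝒰 (𝓝 0)) (hroot : ∀ᶠ s in 𝒰, (F s).eval (w s) = 0)
    (hlow : ∀ i < m, (F 0).coeff i = 0) (hm : (F 0).coeff m ≠ 0) (hm0 : 0 < m)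
    (hcen : ∀ᶠ s in 𝓝 0, (F s).coeff (m - 1) = 0) : IsPuiseux 𝒰 w := by
  classical
  have hmN : m ≤ N := by
    by_contra h
    exact hm (coeff_eq_zero_of_natDegree_lt ((hdeg 0).trans_lt (not_le.1 h)))
  let T := (Finset.range m).filter fun i => ¬ ∀ᶠ s in 𝓝 0, (F s).coeff i = 0
  have hex : ∀ i, ∃ (o : ℕ) (h : ℝ → ℝ), AnalyticAt ℝ h 0 ∧ (i ∈ T → h 0 ≠ 0 ∧
      ∀ᶠ s in 𝓝 0, (F s).coeff i = s ^ o * h s) := by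
    intro i
    by_cases hi : i ∈ T
    · obtain ⟨o, h, h1, h2, h3⟩ :=
        (han i).exists_eventuallyEq_pow_smul_nonzero_iff.2 (Finset.mem_filter.1 hi).2
      exact ⟨o, h, h1, fun _ => ⟨h2, by simpa using h3⟩⟩
    · exact ⟨0, 0, analyticAt_const, fun h => absurd h hi⟩
  choose o h han_h hT using hex
  have hnT : ∀ i < m, i ∉ T → ∀ᶠ s in 𝓝 0, (F s).coeff i = 0 := by
    intro i hi hiT
    by_contra hcon
    exact hiT (Finset.mem_filter.2 ⟨Finset.mem_range.2 hi, hcon⟩)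
  have h𝒰0 : (𝒰 : Filter ℝ) ≤ 𝓝 0 := h𝒰.trans nhdsWithin_le_nhds
  have htail : ∀ (l : Filter ℝ) (g v : ℝ → ℝ), Tendsto g l (𝓝 0) → Tendsto v l (𝓝 0) →
      Tendsto (fun s => ∑ i ∈ Finset.range (N + 1 - m), (F (g s)).coeff (m + i) * v s ^ i) l
        (𝓝 ((F 0).coeff m)) := by
    intro l g v hg hv
    exact tendsto_sum_mul_pow_zero (a := fun i s => (F (g s)).coeff (m + i)) (by omega)
      (fun i => (han (m + i)).continuousAt.tendsto.comp hg) hv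
  rcases T.eq_empty_or_nonempty with hTe | hTne
  · refine ⟨1, one_pos, fun _ => 0, analyticAt_const, ?_⟩
    have hz : ∀ᶠ s in 𝓝 (0 : ℝ), ∀ i ∈ Finset.range m, (F s).coeff i = 0 := by
      rw [eventually_all_finset]
      exact fun i hi => hnT i (Finset.mem_range.1 hi) (by simp [hTe])
    filter_upwards [hroot, h𝒰0 hz,
      (htail 𝒰 id w h𝒰0 hw).eventually_ne hm] with s h1 h2 h3
    rw [eval_eq_sum_add_pow_mul hmN (hdeg s), Finset.sum_eq_zero (fun i hi => by
      rw [h2 i hi, zero_mul]), zero_add] at h1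
    exact eq_zero_of_pow_eq_zero ((mul_eq_zero.1 h1).resolve_left h3)
  obtain ⟨j₀, hj₀, hmin⟩ := T.exists_min_image (fun i => (o i : ℚ) / ((m - i : ℕ) : ℚ)) hTne
  have hTlt : ∀ i ∈ T, i < m := fun i hi => Finset.mem_range.1 (Finset.mem_filter.1 hi).1
  obtain ⟨q, hqdef⟩ : ∃ q, q = m - j₀ := ⟨_, rfl⟩
  obtain ⟨p, hpdef⟩ : ∃ p, p = o j₀ := ⟨_, rfl⟩
  have hj₀m := hTlt j₀ hj₀
  have hq : 0 < q := by omega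
  have hmin' : ∀ i ∈ T, p * (m - i) ≤ q * o i := by
    intro i hi
    have h1 := hmin i hi
    have h2 := hTlt i hi
    have h3 : (0 : ℚ) < ((m - i : ℕ) : ℚ) := by exact_mod_cast (by omega : 0 < m - i)
    have h4 : (0 : ℚ) < ((m - j₀ : ℕ) : ℚ) := by exact_mod_cast (by omega : 0 < m - j₀)
    rw [div_le_div_iff₀ h4 h3] at h1
    rw [hpdef, hqdef, mul_comm (m - j₀)]
    exact_mod_cast h1
  have hp : 0 < p := by
    rcases Nat.eq_zero_or_pos p with hp | hp
    · exfalso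
      have h1 := (hT j₀ hj₀).2.self_of_nhds
      rw [← hpdef, hp, pow_zero, one_mul, hlow j₀ hj₀m] at h1
      exact (hT j₀ hj₀).1 h1.symm
    · exact hp
  have hpowq : Tendsto (fun s : ℝ => s ^ q) (𝓝 0) (𝓝 0) := by
    have := (continuous_pow q).tendsto (0 : ℝ)
    rwa [zero_pow hq.ne'] at this
  have hcomp : ∀ {g : ℝ → ℝ}, AnalyticAt ℝ g 0 → AnalyticAt ℝ (fun s => g (s ^ q)) 0 := by
    intro g hg
    have h1 : AnalyticAt ℝ (fun s : ℝ => s ^ q) 0 := analyticAt_id.pow q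
    exact AnalyticAt.comp_of_eq (g := g) hg h1 (zero_pow hq.ne')
  let b : ℕ → ℝ → ℝ := fun i s => if i < m then
    (if i ∈ T then s ^ (q * o i - p * (m - i)) * h i (s ^ q) else 0)
    else (F (s ^ q)).coeff i * s ^ (p * (i - m))
  have hban : ∀ i, AnalyticAt ℝ (b i) 0 := by
    intro i
    by_cases h1 : i < m
    · by_cases h2 : i ∈ T
      · simp only [b, h1, h2, if_true]
        exact (analyticAt_id.pow _).mul (hcomp (han_h i))
      · simp only [b, h1, h2, if_true, if_false]; exact analyticAt_const
    · simp only [b, h1, if_false]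
      exact (hcomp (han i)).mul (analyticAt_id.pow _)
  let 𝒱 : Ultrafilter ℝ := 𝒰.map (fun s => s ^ ((q : ℝ)⁻¹))
  have h𝒱 : (𝒱 : Filter ℝ) ≤ 𝓝[>] 0 := (map_mono h𝒰).trans (tendsto_rpow_inv_nhdsGT_zero hq)
  have h𝒱0 : (𝒱 : Filter ℝ) ≤ 𝓝 0 := h𝒱.trans nhdsWithin_le_nhds
  have hpq : ∀ᶠ s in (𝒰 : Filter ℝ), 0 < s ∧ (s ^ ((q : ℝ)⁻¹)) ^ q = s := by
    filter_upwards [h𝒰 self_mem_nhdsWithin] with s hs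
    exact ⟨hs, Real.rpow_inv_natCast_pow (le_of_lt hs) hq.ne'⟩
  have hpush : Tendsto (fun s : ℝ => s ^ q) 𝒱 𝒰 := by
    change Tendsto (fun s : ℝ => s ^ q) (map _ (𝒰 : Filter ℝ)) 𝒰
    rw [tendsto_map'_iff]
    exact tendsto_id.congr' (hpq.mono fun s hs => hs.2.symm)
  let ω : ℝ → ℝ := fun s => w (s ^ q) / s ^ p
  have hpos : ∀ᶠ s in (𝒱 : Filter ℝ), 0 < s := h𝒱 self_mem_nhdsWithin
  have hwω : ∀ᶠ s in (𝒱 : Filter ℝ), w (s ^ q) = s ^ p * ω s := by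
    filter_upwards [hpos] with s hs
    exact (mul_div_cancel₀ _ (pow_pos hs p).ne').symm
  have hw' : Tendsto (fun s => w (s ^ q)) 𝒱 (𝓝 0) := hw.comp hpush
  have hlowb : ∀ᶠ s in (𝒱 : Filter ℝ), ∀ i ∈ Finset.range m,
      (F (s ^ q)).coeff i * s ^ (p * i) = b i s * s ^ (p * m) := by
    rw [eventually_all_finset]
    intro i hi
    rw [Finset.mem_range] at hi
    by_cases h2 : i ∈ T
    · filter_upwards [h𝒱0 (hpowq.eventually (hT i h2).2)] with s hs
      simp only [b, hi, h2, if_true, hs]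
      have h3 := hmin' i h2
      have h4 : q * o i + p * i = q * o i - p * (m - i) + p * m := by
        obtain ⟨c, rfl⟩ : ∃ c, m = i + c := ⟨m - i, by omega⟩
        rw [Nat.add_sub_cancel_left] at h3 ⊢
        rw [mul_add]; omega
      calc _ = h i (s ^ q) * s ^ (q * o i + p * i) := by rw [pow_add, pow_mul]; ring
        _ = _ := by rw [h4, pow_add]; ring
    · filter_upwards [h𝒱0 (hpowq.eventually (hnT i hi h2))] with s hs
      simp [b, hi, h2, hs]
  have hrootb : ∀ᶠ s in (𝒱 : Filter ℝ), ∑ i ∈ Finset.range m, b i s * ω s ^ i +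
      (∑ i ∈ Finset.range (N + 1 - m), (F (s ^ q)).coeff (m + i) * w (s ^ q) ^ i) * ω s ^ m
        = 0 := by
    filter_upwards [hpush.eventually hroot, hwω, hlowb, hpos] with s h1 h2 h3 h4
    rw [eval_eq_sum_add_pow_mul hmN (hdeg _)] at h1
    have h5 : (0 : ℝ) < s ^ (p * m) := by positivity
    refine (mul_eq_zero.1 ?_).resolve_left h5.ne'
    rw [← h1, mul_add, Finset.mul_sum]
    congr 1
    · refine Finset.sum_congr rfl fun i hi => ?_
      rw [h2, mul_pow, ← pow_mul, ← mul_assoc (Polynomial.coeff _ _), h3 i hi]; ring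
    · have : w (s ^ q) ^ m = s ^ (p * m) * ω s ^ m := by rw [h2, mul_pow, ← pow_mul]
      rw [this]; ring
  obtain ⟨C, hC⟩ := exists_bound_of_tendsto_coeff (l := (𝒱 : Filter ℝ)) (b := b)
    (fun i _ => (hban i).continuousAt.tendsto.mono_left h𝒱0) hm
    (htail 𝒱 (fun s => s ^ q) (fun s => w (s ^ q)) (hpowq.mono_left h𝒱0) hw') hrootb
  obtain ⟨ω₀, -, hω₀⟩ := (isCompact_Icc (a := -C) (b := C)).ultrafilter_le_nhds (𝒱.map ω) (by
    rw [le_principal_iff, Ultrafilter.mem_coe, Ultrafilter.mem_map]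
    exact hC.mono fun s hs => abs_le.1 hs)
  replace hω₀ : Tendsto ω 𝒱 (𝓝 ω₀) := hω₀
  let B : ℝ → ℝ[X] := fun s => ∑ i ∈ Finset.range (N + 1), Polynomial.C (b i s) * X ^ i
  have hBdeg : ∀ s, (B s).natDegree ≤ N := fun s =>
    natDegree_sum_le_of_forall_le _ _ fun i hi =>
      (natDegree_C_mul_X_pow_le _ _).trans (by simp at hi; omega)
  have hBcoeff : ∀ s, ∀ i ≤ N, (B s).coeff i = b i s := by
    intro s i hi
    simp only [B, finsetSum_coeff, coeff_C_mul, coeff_X_pow]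
    rw [Finset.sum_eq_single i (fun j _ hj => by simp [hj.symm]) (fun h => by simp at h; omega)]
    simp
  have hBan : ∀ i, AnalyticAt ℝ (fun s => (taylor ω₀ (B s)).coeff i) 0 := by
    intro i
    simp only [taylor_coeff_eq_sum (hBdeg _)]
    refine Finset.analyticAt_fun_sum _ fun j hj => ?_
    have : (fun s => (B s).coeff j) = b j :=
      funext fun s => hBcoeff s j (by simp at hj; omega)
    rw [funext_iff] at this
    simp only [this]
    exact (hban j).mul analyticAt_const
  have hBroot : ∀ᶠ s in (𝒱 : Filter ℝ), (taylor ω₀ (B s)).eval (ω s - ω₀) = 0 := by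
    filter_upwards [hrootb, hwω] with s h1 h2
    rw [taylor_eval, sub_add_cancel, eval_eq_sum_add_pow_mul hmN (hBdeg s), ← h1, Finset.sum_mul,
      Finset.sum_mul]
    congr 1
    · refine Finset.sum_congr rfl fun i hi => ?_
      rw [hBcoeff s i (by simp at hi; omega)]
    · refine Finset.sum_congr rfl fun i hi => ?_
      rw [hBcoeff s (m + i) (by simp at hi; omega)]
      simp only [b, Nat.not_lt.2 (Nat.le_add_right m i), if_false, Nat.add_sub_cancel_left, h2]
      rw [mul_pow, ← pow_mul]; ring
  have hb0 : ∀ i, m < i → b i 0 = 0 := by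
    intro i hi
    have : p * (i - m) ≠ 0 := Nat.mul_ne_zero hp.ne' (by omega)
    simp [b, Nat.not_lt.2 hi.le, this]
  have hbm : b m 0 = (F 0).coeff m := by simp [b, hq.ne']
  have hbj₀ : b j₀ 0 ≠ 0 := by
    simp only [b, hj₀m, hj₀, if_true, zero_pow hq.ne']
    rw [hpdef, hqdef, mul_comm (m - j₀), Nat.sub_self, pow_zero, one_mul]
    exact (hT j₀ hj₀).1
  have hbm1 : b (m - 1) 0 = 0 := by
    have h1 : m - 1 ∉ T := fun h => (Finset.mem_filter.1 h).2 hcen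
    simp [b, h1, Nat.sub_lt hm0 one_pos]
  have hexm' : ∃ m' < m, (taylor ω₀ (B 0)).coeff m' ≠ 0 := by
    by_cases hω : ω₀ = 0
    · refine ⟨j₀, hj₀m, ?_⟩
      rw [hω, taylor_zero, hBcoeff 0 _ (by omega)]
      exact hbj₀
    · refine ⟨m - 1, by omega, ?_⟩
      rw [taylor_coeff_eq_sum (hBdeg 0), Finset.sum_eq_single m]
      · rw [hBcoeff 0 m hmN, hbm, Nat.sub_sub_self hm0, pow_one,
          Nat.choose_symm_of_eq_add (show m = m - 1 + 1 by omega), Nat.choose_one_right]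
        exact mul_ne_zero hm (mul_ne_zero hω (by exact_mod_cast hm0.ne'))
      · intro i hi him
        rw [hBcoeff 0 i (by simp at hi; omega)]
        rcases lt_trichotomy i (m - 1) with h1 | h1 | h1
        · rw [Nat.choose_eq_zero_of_lt h1]; simp
        · rw [h1, hbm1, zero_mul]
        · rw [hb0 i (by omega), zero_mul]
      · intro h1; simp at h1; omega
  have hfind : ∃ m', (taylor ω₀ (B 0)).coeff m' ≠ 0 := hexm'.imp fun _ h => h.2
  have hfind_lt : Nat.find hfind < m := by
    obtain ⟨m', h1, h2⟩ := hexm'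
    exact (Nat.find_min' hfind h2).trans_lt h1
  obtain ⟨e, he, ψ, hψ, hψe⟩ := ih (Nat.find hfind) hfind_lt 𝒱 h𝒱 (fun s => taylor ω₀ (B s))
    (fun s => by rw [natDegree_taylor]; exact hBdeg s) hBan (fun s => ω s - ω₀)
    (by simpa using hω₀.sub_const ω₀) hBroot
    (fun i hi => by simpa using Nat.find_min hfind hi) (Nat.find_spec hfind)
  refine ⟨q * e, Nat.mul_pos hq he, fun s => s ^ (e * p) * (ω₀ + ψ s),
    (analyticAt_id.pow _).mul (analyticAt_const.add hψ), ?_⟩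
  have hψe' : ∀ᶠ s in (𝒰 : Filter ℝ), ω (s ^ ((q : ℝ)⁻¹)) - ω₀ =
      ψ ((s ^ ((q : ℝ)⁻¹)) ^ ((e : ℝ)⁻¹)) := hψe
  filter_upwards [hψe', hpq] with s h1 h2
  have h3 : (s ^ ((q : ℝ)⁻¹)) ^ ((e : ℝ)⁻¹) = s ^ (((q * e : ℕ) : ℝ)⁻¹) := by
    rw [← Real.rpow_mul h2.1.le, Nat.cast_mul, mul_inv]
  have h4 : (s ^ (((q * e : ℕ) : ℝ)⁻¹)) ^ e = s ^ ((q : ℝ)⁻¹) := by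
    rw [← h3]
    exact Real.rpow_inv_natCast_pow (Real.rpow_nonneg h2.1.le _) he.ne'
  have h5 : 0 < s ^ ((q : ℝ)⁻¹) := Real.rpow_pos_of_pos h2.1 _
  rw [h3] at h1
  rw [← h1, pow_mul, h4]
  simp only [ω, h2.2]
  field_simp
  ring

end

section
open Filter Topology Polynomial

lemma isPuiseux_of_root_tendsto_zero {N : ℕ} (m : ℕ) : ∀ 𝒰 : Ultrafilter ℝ,
    (𝒰 : Filter ℝ) ≤ 𝓝[>] 0 → ∀ F : ℝ → ℝ[X],
    (∀ s, (F s).natDegree ≤ N) → (∀ i, AnalyticAt ℝ (fun s => (F s).coeff i) 0) →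
    ∀ w : ℝ → ℝ, Tendsto w 𝒰 (𝓝 0) → (∀ᶠ s in 𝒰, (F s).eval (w s) = 0) →
    (∀ i < m, (F 0).coeff i = 0) → (F 0).coeff m ≠ 0 → IsPuiseux 𝒰 w := by
  induction m using Nat.strong_induction_on with
  | _ m ih =>
  intro 𝒰 h𝒰 F hdeg han w hw hroot hlow hm
  have hmN : m ≤ N := by
    by_contra h
    exact hm (coeff_eq_zero_of_natDegree_lt ((hdeg 0).trans_lt (not_le.1 h)))
  have h𝒰0 : (𝒰 : Filter ℝ) ≤ 𝓝 0 := h𝒰.trans nhdsWithin_le_nhds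
  rcases Nat.eq_zero_or_pos m with rfl | hm0
  · exfalso
    have h1 : Tendsto (fun s => (F s).eval (w s)) 𝒰 (𝓝 ((F 0).coeff 0)) := by
      simp only [fun s => eval_eq_sum_range' (n := N + 1) (Nat.lt_succ_of_le (hdeg s)) (w s)]
      exact tendsto_sum_mul_pow_zero (a := fun i s => (F s).coeff i) (by omega)
        (fun i => (han i).continuousAt.tendsto.mono_left h𝒰0) hw
    exact hm (tendsto_nhds_unique h1 (tendsto_const_nhds.congr' (hroot.mono fun s h => h.symm)))
  have hjoint : AnalyticAt ℝ (fun v : ℝ × ℝ => (taylor v.2 (F v.1)).coeff (m - 1)) (0, 0) := by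
    simp only [fun v : ℝ × ℝ => taylor_coeff_eq_sum (hdeg v.1) v.2 (m - 1)]
    refine Finset.analyticAt_fun_sum _ fun j _ => ?_
    have h1 : AnalyticAt ℝ (fun v : ℝ × ℝ => (F v.1).coeff j) (0, 0) :=
      AnalyticAt.comp_of_eq (g := fun s => (F s).coeff j) (han j) analyticAt_fst rfl
    exact h1.mul ((analyticAt_snd.pow _).mul analyticAt_const)
  have hderiv : HasDerivAt (fun w : ℝ => (taylor w (F 0)).coeff (m - 1)) ((F 0).coeff m * m) 0 := by
    simp only [taylor_coeff_eq_sum (hdeg 0)]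
    have h1 : ∀ j ∈ Finset.range (N + 1), HasDerivAt
        (fun w : ℝ => (F 0).coeff j * (w ^ (j - (m - 1)) * (j.choose (m - 1) : ℝ)))
        ((F 0).coeff j * ((((j - (m - 1) : ℕ) : ℝ) * 0 ^ (j - (m - 1) - 1)) *
          (j.choose (m - 1) : ℝ))) 0 := fun j _ =>
      ((hasDerivAt_pow _ (0 : ℝ)).mul_const _).const_mul _
    refine (HasDerivAt.fun_sum h1).congr_deriv ?_
    rw [Finset.sum_eq_single m]
    · rw [Nat.sub_sub_self hm0, Nat.sub_self, pow_zero, Nat.cast_one,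
        Nat.choose_symm_of_eq_add (show m = m - 1 + 1 by omega), Nat.choose_one_right]
      ring
    · intro j _ hjm
      rcases lt_or_gt_of_ne hjm with h | h
      · rw [hlow j h, zero_mul]
      · rw [zero_pow (by omega)]; simp
    · intro h; simp at h; omega
  obtain ⟨φ, hφ, hφ0, hφroot⟩ := hjoint.exists_analytic_implicit
    (by simp [hlow (m - 1) (by omega)])
    (mul_ne_zero hm (by exact_mod_cast hm0.ne')) hderiv
  have hG : IsPuiseux 𝒰 (fun s => w s - φ s) := by
    refine isPuiseux_centered (m := m) (N := N) h𝒰 ih (F := fun s => taylor (φ s) (F s))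
      (fun s => by rw [natDegree_taylor]; exact hdeg s) (fun i => ?_) ?_ ?_ ?_ ?_ hm0 hφroot
    · simp only [taylor_coeff_eq_sum (hdeg _)]
      exact Finset.analyticAt_fun_sum _ fun j _ =>
        (han j).mul ((hφ.pow _).mul analyticAt_const)
    · have := hφ.continuousAt.tendsto.mono_left h𝒰0
      rw [hφ0] at this
      simpa using hw.sub this
    · filter_upwards [hroot] with s hs
      rw [taylor_eval, sub_add_cancel, hs]
    · intro i hi
      rw [hφ0, taylor_zero, hlow i hi]
    · rw [hφ0, taylor_zero]; exact hm
  obtain ⟨e, he, ψ, hψ, hψe⟩ := hG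
  refine ⟨e, he, fun s => ψ s + φ (s ^ e), hψ.add ?_, ?_⟩
  · have h1 : AnalyticAt ℝ (fun s : ℝ => s ^ e) 0 := analyticAt_id.pow e
    exact AnalyticAt.comp_of_eq (g := φ) hφ h1 (zero_pow he.ne')
  · filter_upwards [hψe, h𝒰 self_mem_nhdsWithin] with s hs hs0
    rw [← hs, Real.rpow_inv_natCast_pow (le_of_lt hs0) he.ne']
    ring

/-- A bounded algebraic function is a Puiseux series along any ultrafilter. -/
lemma isPuiseux_of_root {𝒰 : Ultrafilter ℝ} (h𝒰 : (𝒰 : Filter ℝ) ≤ 𝓝[>] 0) {q : ℝ[X][X]}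
    (hq : q ≠ 0) {ζ : ℝ → ℝ} {K : ℝ} (hK : ∀ᶠ s in 𝒰, |ζ s| ≤ K)
    (hroot : ∀ᶠ s in 𝒰, (q.map (evalRingHom s)).eval (ζ s) = 0) : IsPuiseux 𝒰 ζ := by
  classical
  obtain ⟨ζ₀, -, hζ₀⟩ := (isCompact_Icc (a := -K) (b := K)).ultrafilter_le_nhds (𝒰.map ζ) (by
    rw [le_principal_iff, Ultrafilter.mem_coe, Ultrafilter.mem_map]
    exact hK.mono fun s hs => abs_le.1 hs)
  replace hζ₀ : Tendsto ζ 𝒰 (𝓝 ζ₀) := hζ₀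
  -- divide all coefficients by the largest common power of the parameter
  obtain ⟨k, q', hqq', j, hj⟩ : ∃ (k : ℕ) (q' : ℝ[X][X]), q = C (X ^ k) * q' ∧
      ∃ j, (q'.coeff j).eval 0 ≠ 0 := by
    have hne : ∃ k : ℕ, ¬ (C (X ^ k : ℝ[X]) ∣ q) := by
      obtain ⟨i, hi⟩ : ∃ i, q.coeff i ≠ 0 := by
        by_contra h; push Not at h; exact hq (Polynomial.ext (by simpa using h))
      refine ⟨(q.coeff i).natDegree + 1, fun h => ?_⟩
      rw [C_dvd_iff_dvd_coeff] at h
      have := natDegree_le_of_dvd (h i) hi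
      rw [natDegree_X_pow] at this
      omega
    have hk0 : Nat.find hne ≠ 0 := by
      intro h0
      have := Nat.find_spec hne
      rw [h0] at this
      simp at this
    obtain ⟨k, hk⟩ := Nat.exists_eq_succ_of_ne_zero hk0
    have hdvd : C (X ^ k : ℝ[X]) ∣ q := not_not.1 (Nat.find_min hne (by omega : k < _))
    obtain ⟨q', hq'⟩ := hdvd
    refine ⟨k, q', hq', ?_⟩
    by_contra hcon
    push Not at hcon
    apply Nat.find_spec hne
    have : C (X : ℝ[X]) ∣ q' := by
      rw [C_dvd_iff_dvd_coeff]
      intro i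
      rw [X_dvd_iff, coeff_zero_eq_eval_zero]
      exact hcon i
    rw [hk, pow_succ, C_mul, hq']
    exact mul_dvd_mul_left _ this
  have hroot' : ∀ᶠ s in 𝒰, (q'.map (evalRingHom s)).eval (ζ s) = 0 := by
    filter_upwards [hroot, h𝒰 self_mem_nhdsWithin] with s h1 h2
    rw [hqq', Polynomial.map_mul, eval_mul, map_C, eval_C] at h1
    refine (mul_eq_zero.1 h1).resolve_left ?_
    have : (0 : ℝ) < s := h2
    simp [this.ne']
  let F : ℝ → ℝ[X] := fun s => taylor ζ₀ (q'.map (evalRingHom s))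
  have hFdeg : ∀ s, (F s).natDegree ≤ q'.natDegree := fun s => by
    rw [natDegree_taylor]; exact natDegree_map_le
  have hF0 : F 0 ≠ 0 := by
    intro h
    rw [taylor_eq_zero] at h
    apply hj
    have := congrArg (fun p => coeff p j) h
    simpa using this
  have hfind : ∃ m, (F 0).coeff m ≠ 0 := by
    by_contra h; push Not at h; exact hF0 (Polynomial.ext (by simpa using h))
  obtain ⟨e, he, ψ, hψ, hψe⟩ := isPuiseux_of_root_tendsto_zero (N := q'.natDegree) (Nat.find hfind)
    𝒰 h𝒰 F hFdeg (fun i => by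
      simp only [F, taylor_coeff_eq_sum (natDegree_map_le (f := evalRingHom _) (p := q'))]
      refine Finset.analyticAt_fun_sum _ fun j _ => AnalyticAt.mul ?_ analyticAt_const
      simp only [coeff_map, coe_evalRingHom]
      exact AnalyticAt.aeval_polynomial analyticAt_id (q'.coeff j)) (fun s => ζ s - ζ₀)
    (by simpa using hζ₀.sub_const ζ₀)
    (by filter_upwards [hroot'] with s hs; rw [taylor_eval, sub_add_cancel, hs])
    (fun i hi => by simpa using Nat.find_min hfind hi) (Nat.find_spec hfind)
  refine ⟨e, he, fun s => ψ s + ζ₀, hψ.add analyticAt_const, ?_⟩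
  filter_upwards [hψe] with s hs
  rw [← hs]; ring

end

section
open MvPolynomial

lemma MvPolynomial.hasFDerivAt_eval {σ E : Type*} [Fintype σ] [NormedAddCommGroup E]
    [NormedSpace ℝ E] {v : E → σ → ℝ} {v' : σ → E →L[ℝ] ℝ} {x : E}
    (hv : ∀ i, HasFDerivAt (fun y => v y i) (v' i) x) (p : MvPolynomial σ ℝ) :
    HasFDerivAt (fun y => eval (v y) p) (∑ i, eval (v x) (pderiv i p) • v' i) x := by
  classical
  induction p using MvPolynomial.induction_on with
  | C a => simpa using hasFDerivAt_const a x
  | add p q hp hq =>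
    refine ((hp.add hq).congr_fderiv ?_).congr_of_eventuallyEq (.of_forall fun y => ?_)
    · simp [add_smul, Finset.sum_add_distrib]
    · simp
  | mul_X p j hp =>
    have h := hp.mul (hv j)
    refine (h.congr_fderiv ?_).congr_of_eventuallyEq (.of_forall fun y => by simp)
    simp only [Derivation.leibniz, map_add, smul_eq_mul, map_mul, eval_X, pderiv_X, add_smul,
      Finset.sum_add_distrib, Finset.smul_sum, smul_smul]
    congr 1
    rw [Finset.sum_eq_single j]
    · simp
    · intro i _ hij
      simp [Pi.single_eq_of_ne' hij]
    · simp

lemma MvPolynomial.totalDegree_pderiv_le {σ R : Type*} [CommSemiring R] (i : σ)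
    (p : MvPolynomial σ R) : (pderiv i p).totalDegree ≤ p.totalDegree - 1 := by
  classical
  conv_lhs => rw [p.as_sum, map_sum]
  refine totalDegree_finsetSum_le fun s hs => ?_
  rw [pderiv_monomial]
  by_cases hsi : s i = 0
  · simp [hsi]
  refine (totalDegree_monomial_le _ _).trans ?_
  have h1 := le_totalDegree hs
  have h2 : (s - Finsupp.single i 1) + Finsupp.single i 1 = s :=
    tsub_add_cancel_of_le (by
      intro j
      by_cases hj : j = i
      · subst hj; simp; omega
      · simp [Ne.symm hj])
  have h3 : (s - Finsupp.single i 1).sum (fun _ e => e) + 1 = s.sum fun _ e => e := by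
    conv_rhs => rw [← h2]
    rw [Finsupp.sum_add_index' (by simp) (by simp)]
    simp
  simp only [Function.id_def] at *
  change (s - Finsupp.single i 1).sum (fun _ e => e) ≤ _
  omega

lemma exists_annihilator_pderiv_ne_zero {n : ℕ} {U : Set (EuclideanSpace ℝ (Fin n))}
    (hU : IsOpen U) (h0 : (0 : EuclideanSpace ℝ (Fin n)) ∈ U) {f : EuclideanSpace ℝ (Fin n) → ℝ}
    {P : MvPolynomial (Fin (n + 1)) ℝ} (hP : P ≠ 0)
    (hPf : ∀ x ∈ U, eval (Fin.snoc (fun i => x i) (f x)) P = 0) :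
    ∃ Q : MvPolynomial (Fin (n + 1)) ℝ, Q ≠ 0 ∧ Q.totalDegree ≤ P.totalDegree ∧
      (∀ x ∈ U, eval (Fin.snoc (fun i => x i) (f x)) Q = 0) ∧
      ∃ x ∈ U, eval (Fin.snoc (fun i => x i) (f x)) (pderiv (Fin.last n) Q) ≠ 0 := by
  classical
  let T : Set ℕ := {m | ∃ Q : MvPolynomial (Fin (n + 1)) ℝ, Q ≠ 0 ∧ Q.totalDegree = m ∧
      (∀ x ∈ U, eval (Fin.snoc (fun i => x i) (f x)) Q = 0)}
  have hT : ∃ m, m ∈ T := ⟨P.totalDegree, P, hP, rfl, hPf⟩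
  obtain ⟨Q, hQ, hQd, hQf⟩ := Nat.find_spec hT
  refine ⟨Q, hQ, hQd ▸ Nat.find_min' hT ⟨P, hP, rfl, hPf⟩, hQf, ?_⟩
  by_contra! hcon
  have hpos : Q.totalDegree ≠ 0 := by
    intro h
    rw [totalDegree_eq_zero_iff_eq_C] at h
    have := hQf 0 h0
    rw [h, eval_C] at this
    rw [this, C_0] at h
    exact hQ h
  have hz : pderiv (Fin.last n) Q = 0 := by
    by_contra hne
    have h1 := Nat.find_min' hT ⟨_, hne, rfl, hcon⟩
    have h2 := totalDegree_pderiv_le (Fin.last n) Q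
    omega
  have hindep : ∀ (w : Fin n → ℝ) (s t : ℝ), eval (Fin.snoc w s) Q = eval (Fin.snoc w t) Q := by
    intro w s t
    have hd : ∀ u : ℝ, HasFDerivAt (fun u : ℝ => eval (Fin.snoc w u : Fin (n + 1) → ℝ) Q)
        (0 : ℝ →L[ℝ] ℝ) u := by
      intro u
      have hv : ∀ i : Fin (n + 1), HasFDerivAt (fun u : ℝ => (Fin.snoc w u : Fin (n + 1) → ℝ) i)
          ((Fin.snoc (fun _ => 0) (ContinuousLinearMap.id ℝ ℝ) :
            Fin (n + 1) → (ℝ →L[ℝ] ℝ)) i) u := by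
        intro i
        refine Fin.lastCases ?_ (fun j => ?_) i
        · simpa [Function.id_def] using hasFDerivAt_id (𝕜 := ℝ) u
        · simpa using hasFDerivAt_const (w j) u
      have := MvPolynomial.hasFDerivAt_eval hv Q
      rw [Fin.sum_univ_castSucc] at this
      simpa [hz] using this
    exact is_const_of_fderiv_eq_zero (𝕜 := ℝ) (fun u => (hd u).differentiableAt)
      (fun u => (hd u).fderiv) s t
  let V : Set (Fin (n + 1) → ℝ) := {v | WithLp.toLp 2 (fun i : Fin n => v i.castSucc) ∈ U}
  have hV : IsOpen V := by
    refine hU.preimage ?_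
    fun_prop
  obtain ⟨u, hu, huV⟩ := isOpen_pi_iff'.1 hV 0 (by
    change WithLp.toLp 2 (fun i : Fin n => (0 : ℝ)) ∈ U
    exact h0)
  apply hQ
  refine funext_set u (fun i => infinite_of_mem_nhds 0 ((hu i).1.mem_nhds (hu i).2)) fun v hv => ?_
  have hvU := huV hv
  have h1 := hQf _ hvU
  rw [map_zero, ← h1]
  have h2 : v = Fin.snoc (fun i : Fin n => v i.castSucc) (v (Fin.last n)) := by
    ext i
    refine Fin.lastCases ?_ (fun j => ?_) i <;> simp
  conv_lhs => rw [h2]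
  exact hindep _ _ _
end

section
open MvPolynomial Metric

variable {n : ℕ}

/-- The gradient of `f` has squared length `gradSq f`. -/
noncomputable def gradSq (f : EuclideanSpace ℝ (Fin n) → ℝ) (x : EuclideanSpace ℝ (Fin n)) : ℝ :=
  ∑ i, (fderiv ℝ f x (EuclideanSpace.single i 1)) ^ 2

/-- The function maximized over a ball in order to bound `f` by its gradient. -/
noncomputable def objective (f : EuclideanSpace ℝ (Fin n) → ℝ) (r l : ℝ)
    (x : EuclideanSpace ℝ (Fin n)) : ℝ :=
  (r ^ 2 - ‖x‖ ^ 2) * l ^ 2 / (l ^ 2 * gradSq f x + ((f x ^ 2 - l) ^ 2 + l ^ 4))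

lemma objective_den_pos (f : EuclideanSpace ℝ (Fin n) → ℝ) {l : ℝ} (hl : 0 < l)
    (x : EuclideanSpace ℝ (Fin n)) : 0 < l ^ 2 * gradSq f x + ((f x ^ 2 - l) ^ 2 + l ^ 4) := by
  have : 0 ≤ gradSq f x := Finset.sum_nonneg fun i _ => sq_nonneg _
  positivity

lemma contDiffOn_objective {f : EuclideanSpace ℝ (Fin n) → ℝ} {U : Set (EuclideanSpace ℝ (Fin n))}
    (hU : IsOpen U) (hf : AnalyticOnNhd ℝ f U) (r : ℝ) {l : ℝ} (hl : 0 < l) :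
    ContDiffOn ℝ 1 (objective f r l) U := by
  have h2 : ContDiffOn ℝ 2 f U := hf.contDiffOn hU.uniqueDiffOn
  have h1 : ContDiffOn ℝ 1 (fderiv ℝ f) U := h2.fderiv_of_isOpen hU (by norm_num)
  have h0 : ContDiffOn ℝ 1 f U := h2.of_le (by norm_num)
  refine ContDiffOn.div ?_ ?_ fun x _ => (objective_den_pos f hl x).ne'
  · have : ContDiff ℝ 1 fun x : EuclideanSpace ℝ (Fin n) => ‖x‖ ^ 2 := contDiff_norm_sq ℝ
    exact ((contDiff_const.sub this).mul contDiff_const).contDiffOn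
  · refine (contDiffOn_const.mul
      (ContDiffOn.sum fun i _ => (h1.clm_apply contDiffOn_const).pow 2)).add
      ((((h0.pow 2).sub contDiffOn_const).pow 2).add contDiffOn_const)

/-- Evaluation of a polynomial with coefficients in `ℝ[λ]` on the graph of `f`, at `λ = l`. -/
noncomputable def graphEval (f : EuclideanSpace ℝ (Fin n) → ℝ) (l : ℝ)
    (x : EuclideanSpace ℝ (Fin n)) : MvPolynomial (Fin (n + 1)) (Polynomial ℝ) →+* ℝ :=
  (eval (Fin.snoc (fun i => x i) (f x))).comp (map (Polynomial.evalRingHom l))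

lemma graphEval_C (f : EuclideanSpace ℝ (Fin n) → ℝ) (l : ℝ) (x : EuclideanSpace ℝ (Fin n))
    (p : Polynomial ℝ) : graphEval f l x (C p) = p.eval l := by
  simp [graphEval]

lemma graphEval_X_castSucc (f : EuclideanSpace ℝ (Fin n) → ℝ) (l : ℝ)
    (x : EuclideanSpace ℝ (Fin n)) (i : Fin n) : graphEval f l x (X i.castSucc) = x i := by
  simp [graphEval]

lemma graphEval_X_last (f : EuclideanSpace ℝ (Fin n) → ℝ) (l : ℝ)
    (x : EuclideanSpace ℝ (Fin n)) : graphEval f l x (X (Fin.last n)) = f x := by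
  simp [graphEval]

lemma graphEval_map_C (f : EuclideanSpace ℝ (Fin n) → ℝ) (l : ℝ)
    (x : EuclideanSpace ℝ (Fin n)) (Q : MvPolynomial (Fin (n + 1)) ℝ) :
    graphEval f l x (map Polynomial.C Q) = eval (Fin.snoc (fun i => x i) (f x)) Q := by
  simp only [graphEval, RingHom.comp_apply, map_map]
  congr 1
  convert map_id Q
  ext; simp

lemma hasFDerivAt_graphEval {f : EuclideanSpace ℝ (Fin n) → ℝ} {l : ℝ}
    {x : EuclideanSpace ℝ (Fin n)} (hf : DifferentiableAt ℝ f x)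
    (p : MvPolynomial (Fin (n + 1)) (Polynomial ℝ)) :
    HasFDerivAt (fun y => graphEval f l y p)
      (∑ i : Fin n, graphEval f l x (pderiv i.castSucc p) • EuclideanSpace.proj (𝕜 := ℝ) i +
        graphEval f l x (pderiv (Fin.last n) p) • fderiv ℝ f x) x := by
  have hv : ∀ i : Fin (n + 1), HasFDerivAt
      (fun y : EuclideanSpace ℝ (Fin n) => (Fin.snoc (fun i => y i) (f y) : Fin (n + 1) → ℝ) i)
      ((Fin.snoc (fun i => EuclideanSpace.proj (𝕜 := ℝ) i) (fderiv ℝ f x) :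
        Fin (n + 1) → (EuclideanSpace ℝ (Fin n) →L[ℝ] ℝ)) i) x := by
    intro i
    refine Fin.lastCases ?_ (fun j => ?_) i
    · simpa using hf.hasFDerivAt
    · simpa using (EuclideanSpace.proj j : EuclideanSpace ℝ (Fin n) →L[ℝ] ℝ).hasFDerivAt (x := x)
  have := MvPolynomial.hasFDerivAt_eval hv (map (Polynomial.evalRingHom l) p)
  rw [Fin.sum_univ_castSucc] at this
  simpa [graphEval, pderiv_map] using this

lemma fderiv_graphEval_single {f : EuclideanSpace ℝ (Fin n) → ℝ} {l : ℝ}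
    {x : EuclideanSpace ℝ (Fin n)} (hf : DifferentiableAt ℝ f x)
    (p : MvPolynomial (Fin (n + 1)) (Polynomial ℝ)) (i : Fin n) :
    fderiv ℝ (fun y => graphEval f l y p) x (EuclideanSpace.single i 1) =
      graphEval f l x (pderiv i.castSucc p) +
        graphEval f l x (pderiv (Fin.last n) p) * fderiv ℝ f x (EuclideanSpace.single i 1) := by
  rw [(hasFDerivAt_graphEval hf p).fderiv]
  simp [sum_apply]

/-- On the zero set of `Q` this represents `∂Q/∂y` times the derivative along `xᵢ`. -/
noncomputable def graphDeriv (Q : MvPolynomial (Fin (n + 1)) (Polynomial ℝ)) (i : Fin n)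
    (p : MvPolynomial (Fin (n + 1)) (Polynomial ℝ)) : MvPolynomial (Fin (n + 1)) (Polynomial ℝ) :=
  pderiv i.castSucc p * pderiv (Fin.last n) Q - pderiv (Fin.last n) p * pderiv i.castSucc Q

/-- The numerator of the objective, on the graph. -/
noncomputable def objNum (r : ℝ) (Q : MvPolynomial (Fin (n + 1)) (Polynomial ℝ)) :
    MvPolynomial (Fin (n + 1)) (Polynomial ℝ) :=
  (C (Polynomial.C (r ^ 2)) - ∑ i : Fin n, X i.castSucc ^ 2) * C (Polynomial.X ^ 2) *
    pderiv (Fin.last n) Q ^ 2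

/-- The denominator of the objective, on the graph. -/
noncomputable def objDen (Q : MvPolynomial (Fin (n + 1)) (Polynomial ℝ)) :
    MvPolynomial (Fin (n + 1)) (Polynomial ℝ) :=
  C (Polynomial.X ^ 2) * ∑ i : Fin n, pderiv i.castSucc Q ^ 2 +
    ((X (Fin.last n) ^ 2 - C Polynomial.X) ^ 2 + C (Polynomial.X ^ 4)) * pderiv (Fin.last n) Q ^ 2

lemma totalDegree_mul_le_of_le {σ R : Type*} [CommSemiring R] {p q : MvPolynomial σ R} {a b : ℕ}
    (hp : p.totalDegree ≤ a) (hq : q.totalDegree ≤ b) : (p * q).totalDegree ≤ a + b :=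
  (totalDegree_mul _ _).trans (Nat.add_le_add hp hq)

lemma totalDegree_pow_le_of_le {σ R : Type*} [CommSemiring R] {p : MvPolynomial σ R} {a : ℕ}
    (hp : p.totalDegree ≤ a) (k : ℕ) : (p ^ k).totalDegree ≤ k * a :=
  (totalDegree_pow _ _).trans (Nat.mul_le_mul_left _ hp)

lemma totalDegree_sub_le_of_le {σ R : Type*} [CommRing R] {p q : MvPolynomial σ R} {a : ℕ}
    (hp : p.totalDegree ≤ a) (hq : q.totalDegree ≤ a) : (p - q).totalDegree ≤ a :=
  (totalDegree_sub _ _).trans (max_le hp hq)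

lemma totalDegree_add_le_of_le {σ R : Type*} [CommSemiring R] {p q : MvPolynomial σ R} {a : ℕ}
    (hp : p.totalDegree ≤ a) (hq : q.totalDegree ≤ a) : (p + q).totalDegree ≤ a :=
  (totalDegree_add _ _).trans (max_le hp hq)

variable {Q : MvPolynomial (Fin (n + 1)) (Polynomial ℝ)} {d : ℕ}

lemma totalDegree_pderiv_le_of_le (hQ : Q.totalDegree ≤ d) (i : Fin (n + 1)) :
    (pderiv i Q).totalDegree ≤ d :=
  (totalDegree_pderiv_le i Q).trans (by omega)

lemma totalDegree_graphDeriv_le (hQ : Q.totalDegree ≤ d) (i : Fin n)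
    {p : MvPolynomial (Fin (n + 1)) (Polynomial ℝ)} {e : ℕ} (hp : p.totalDegree ≤ e) :
    (graphDeriv Q i p).totalDegree ≤ e + d :=
  totalDegree_sub_le_of_le
    (totalDegree_mul_le_of_le (totalDegree_pderiv_le_of_le hp _) (totalDegree_pderiv_le_of_le hQ _))
    (totalDegree_mul_le_of_le (totalDegree_pderiv_le_of_le hp _) (totalDegree_pderiv_le_of_le hQ _))

lemma totalDegree_objNum_le (hQ : Q.totalDegree ≤ d) (r : ℝ) :
    (objNum r Q).totalDegree ≤ 2 * d + 2 := by
  have h := totalDegree_pow_le_of_le (totalDegree_pderiv_le_of_le hQ (Fin.last n)) 2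
  refine (totalDegree_mul_le_of_le (a := 2) (b := 2 * d) ?_ h).trans (by omega)
  refine (totalDegree_mul_le_of_le (a := 2) (b := 0) ?_ (by rw [totalDegree_C])).trans le_rfl
  refine totalDegree_sub_le_of_le (by rw [totalDegree_C]; omega)
    (totalDegree_finsetSum_le fun i _ => ?_)
  exact totalDegree_pow_le_of_le (a := 1) (by rw [totalDegree_X]) 2

lemma totalDegree_objDen_le (hQ : Q.totalDegree ≤ d) : (objDen Q).totalDegree ≤ 2 * d + 4 := by
  have h := fun i => totalDegree_pow_le_of_le (totalDegree_pderiv_le_of_le hQ i) 2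
  refine totalDegree_add_le_of_le ?_ ?_
  · refine (totalDegree_mul_le_of_le (a := 0) (b := 2 * d) (by rw [totalDegree_C])
      (totalDegree_finsetSum_le fun i _ => h _)).trans (by omega)
  · refine (totalDegree_mul_le_of_le (a := 4) (b := 2 * d) ?_ (h _)).trans (by omega)
    refine totalDegree_add_le_of_le ?_ (by rw [totalDegree_C]; omega)
    refine totalDegree_pow_le_of_le (a := 2) ?_ 2
    refine totalDegree_sub_le_of_le ?_ (by rw [totalDegree_C]; omega)
    exact totalDegree_pow_le_of_le (a := 1) (by rw [totalDegree_X]) 2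

variable {f : EuclideanSpace ℝ (Fin n) → ℝ} {U : Set (EuclideanSpace ℝ (Fin n))} {l : ℝ}
  {x : EuclideanSpace ℝ (Fin n)}

lemma graphEval_graphDeriv (hU : IsOpen U) (hx : x ∈ U) (hf : DifferentiableAt ℝ f x)
    (hQ : ∀ y ∈ U, graphEval f l y Q = 0) (i : Fin n)
    (p : MvPolynomial (Fin (n + 1)) (Polynomial ℝ)) :
    graphEval f l x (graphDeriv Q i p) =
      fderiv ℝ (fun y => graphEval f l y p) x (EuclideanSpace.single i 1) *
        graphEval f l x (pderiv (Fin.last n) Q) := by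
  have h0 : fderiv ℝ (fun y => graphEval f l y Q) x = 0 := by
    have : (fun y => graphEval f l y Q) =ᶠ[nhds x] fun _ => (0 : ℝ) :=
      Filter.mem_of_superset (hU.mem_nhds hx) hQ
    rw [this.fderiv_eq]
    simp
  have h1 := fderiv_graphEval_single hf (l := l) Q i
  rw [h0] at h1
  rw [fderiv_graphEval_single hf, graphDeriv, map_sub, map_mul, map_mul]
  simp only [zero_apply] at h1
  linear_combination graphEval f l x (pderiv (Fin.last n) p) * h1

lemma objective_mul_graphEval_objDen (hU : IsOpen U) (hx : x ∈ U) (hf : DifferentiableAt ℝ f x)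
    (hQ : ∀ y ∈ U, graphEval f l y Q = 0) (r : ℝ) (hl : 0 < l) :
    objective f r l x * graphEval f l x (objDen Q) = graphEval f l x (objNum r Q) := by
  have h1 : ∀ i : Fin n, graphEval f l x (pderiv i.castSucc Q) =
      - (graphEval f l x (pderiv (Fin.last n) Q) * fderiv ℝ f x (EuclideanSpace.single i 1)) := by
    intro i
    have h := graphEval_graphDeriv hU hx hf hQ i (X (Fin.last n))
    simp only [graphDeriv, graphEval_X_last] at h
    rw [pderiv_X_self, pderiv_X_of_ne (Fin.castSucc_lt_last i).ne'] at h
    simp only [map_sub, map_mul, map_one, map_zero] at h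
    linarith
  have hden := (objective_den_pos f hl x).ne'
  have hD : graphEval f l x (objDen Q) =
      (l ^ 2 * gradSq f x + ((f x ^ 2 - l) ^ 2 + l ^ 4)) *
        graphEval f l x (pderiv (Fin.last n) Q) ^ 2 := by
    simp only [objDen, gradSq, map_add, map_mul, map_sum, map_pow, map_sub, h1, graphEval_C,
      graphEval_X_last, Polynomial.eval_X, neg_sq, mul_pow, ← Finset.mul_sum]
    ring
  have hN : graphEval f l x (objNum r Q) =
      (r ^ 2 - ‖x‖ ^ 2) * l ^ 2 * graphEval f l x (pderiv (Fin.last n) Q) ^ 2 := by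
    simp only [objNum, map_mul, map_sum, map_pow, map_sub, graphEval_C,
      graphEval_X_castSucc, Polynomial.eval_C, Polynomial.eval_X,
      EuclideanSpace.real_norm_sq_eq]
  rw [hD, hN, objective]
  field_simp

lemma graphEval_objDen_ne_zero (hl : 0 < l)
    (hne : graphEval f l x (pderiv (Fin.last n) Q) ≠ 0) : graphEval f l x (objDen Q) ≠ 0 := by
  have : 0 < graphEval f l x (objDen Q) := by
    simp only [objDen, map_add, map_mul, map_sum, map_pow, map_sub, graphEval_C,
      graphEval_X_last, Polynomial.eval_X]
    have : 0 ≤ ∑ i : Fin n, graphEval f l x (pderiv i.castSucc Q) ^ 2 :=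
      Finset.sum_nonneg fun i _ => sq_nonneg _
    have h3 := sq_nonneg (f x ^ 2 - l)
    generalize (f x ^ 2 - l) ^ 2 = v at *
    generalize (∑ i : Fin n, graphEval f l x (pderiv i.castSucc Q) ^ 2) = u at *
    have h2 : 0 < graphEval f l x (pderiv (Fin.last n) Q) ^ 2 := by positivity
    generalize graphEval f l x (pderiv (Fin.last n) Q) ^ 2 = w at *
    positivity
  exact this.ne'

/-- The common denominator of the partial derivatives of the objective, on the graph. -/
noncomputable def objDerivDen (Q : MvPolynomial (Fin (n + 1)) (Polynomial ℝ)) :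
    MvPolynomial (Fin (n + 1)) (Polynomial ℝ) :=
  objDen Q ^ 2 * pderiv (Fin.last n) Q

/-- The numerators of the partial derivatives of the objective, on the graph. -/
noncomputable def objDerivNum (r : ℝ) (Q : MvPolynomial (Fin (n + 1)) (Polynomial ℝ)) (i : Fin n) :
    MvPolynomial (Fin (n + 1)) (Polynomial ℝ) :=
  graphDeriv Q i (objNum r Q) * objDen Q - objNum r Q * graphDeriv Q i (objDen Q)

lemma totalDegree_objDerivDen_le (hQ : Q.totalDegree ≤ d) :
    (objDerivDen Q).totalDegree ≤ 5 * d + 8 :=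
  (totalDegree_mul_le_of_le (totalDegree_pow_le_of_le (totalDegree_objDen_le hQ) 2)
    (totalDegree_pderiv_le_of_le hQ _)).trans (by omega)

lemma totalDegree_objDerivNum_le (hQ : Q.totalDegree ≤ d) (r : ℝ) (i : Fin n) :
    (objDerivNum r Q i).totalDegree ≤ 5 * d + 8 := by
  have h1 := totalDegree_objNum_le hQ r
  have h2 := totalDegree_objDen_le hQ
  exact totalDegree_sub_le_of_le
    ((totalDegree_mul_le_of_le (totalDegree_graphDeriv_le hQ i h1) h2).trans (by omega))
    ((totalDegree_mul_le_of_le h1 (totalDegree_graphDeriv_le hQ i h2)).trans (by omega))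

lemma graphEval_objDerivNum (hU : IsOpen U) (hf : AnalyticOnNhd ℝ f U) (hx : x ∈ U)
    (hQ : ∀ y ∈ U, graphEval f l y Q = 0) (r : ℝ) (hl : 0 < l) (i : Fin n) :
    graphEval f l x (objDerivNum r Q i) =
      fderiv ℝ (objective f r l) x (EuclideanSpace.single i 1) *
        graphEval f l x (objDerivDen Q) := by
  have hfx : ∀ y ∈ U, DifferentiableAt ℝ f y := fun y hy => (hf y hy).differentiableAt
  have hψ : DifferentiableAt ℝ (objective f r l) x :=
    ((contDiffOn_objective hU hf r hl).differentiableOn one_ne_zero).differentiableAt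
      (hU.mem_nhds hx)
  have hev : (fun y => graphEval f l y (objNum r Q)) =ᶠ[nhds x]
      fun y => objective f r l y * graphEval f l y (objDen Q) :=
    Filter.mem_of_superset (hU.mem_nhds hx) fun y hy =>
      (objective_mul_graphEval_objDen hU hy (hfx y hy) hQ r hl).symm
  have h1 : fderiv ℝ (fun y => graphEval f l y (objNum r Q)) x (EuclideanSpace.single i 1) =
      objective f r l x * fderiv ℝ (fun y => graphEval f l y (objDen Q)) x
        (EuclideanSpace.single i 1) + graphEval f l x (objDen Q) *
          fderiv ℝ (objective f r l) x (EuclideanSpace.single i 1) := by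
    rw [hev.fderiv_eq, fderiv_fun_mul hψ (hasFDerivAt_graphEval (hfx x hx) _).differentiableAt]
    simp
  have h2 := objective_mul_graphEval_objDen hU hx (hfx x hx) hQ r hl
  simp only [objDerivNum, objDerivDen, map_sub, map_mul, map_pow,
    graphEval_graphDeriv hU hx (hfx x hx) hQ, h1, ← h2]
  ring

end

section
open MvPolynomial Metric

variable {n d : ℕ} {f : EuclideanSpace ℝ (Fin n) → ℝ} {U : Set (EuclideanSpace ℝ (Fin n))}
  {P : MvPolynomial (Fin (n + 1)) ℝ}

lemma analyticAt_eval_of_analyticAt {σ E : Type*} [Fintype σ] [NormedAddCommGroup E]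
    [NormedSpace ℝ E] {v : E → σ → ℝ} {x : E} (hv : ∀ i, AnalyticAt ℝ (fun y => v y i) x)
    (p : MvPolynomial σ ℝ) : AnalyticAt ℝ (fun y => eval (v y) p) x := by
  induction p using MvPolynomial.induction_on with
  | C a => simpa using analyticAt_const
  | add p q hp hq => simp only [map_add]; exact hp.add hq
  | mul_X p j hp => simp only [map_mul, eval_X]; exact hp.mul (hv j)

lemma MvPolynomial.totalDegree_map_le {σ R S : Type*} [CommSemiring R] [CommSemiring S]
    (φ : R →+* S) (p : MvPolynomial σ R) : (map φ p).totalDegree ≤ p.totalDegree :=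
  Finset.sup_mono (support_map_subset φ p)

lemma dense_eval_graph_ne_zero (hUc : IsPreconnected U) (hf : AnalyticOnNhd ℝ f U)
    (hne : ∃ x ∈ U, eval (Fin.snoc (fun i => x i) (f x)) P ≠ 0)
    {V : Set (EuclideanSpace ℝ (Fin n))} (hVo : IsOpen V) (hVU : V ⊆ U) (hV : V.Nonempty) :
    ∃ x ∈ V, eval (Fin.snoc (fun i => x i) (f x)) P ≠ 0 := by
  by_contra! hcon
  obtain ⟨y, hy⟩ := hV
  have han : AnalyticOnNhd ℝ
      (fun x : EuclideanSpace ℝ (Fin n) => eval (Fin.snoc (fun i => x i) (f x)) P) U := by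
    intro x hx
    refine analyticAt_eval_of_analyticAt (fun i => ?_) P
    refine Fin.lastCases ?_ (fun j => ?_) i
    · simpa using hf x hx
    · simpa using (EuclideanSpace.proj j : EuclideanSpace ℝ (Fin n) →L[ℝ] ℝ).analyticAt x
  obtain ⟨x, hx, hxne⟩ := hne
  exact hxne (han.eqOn_zero_of_preconnected_of_eventuallyEq_zero hUc (hVU hy)
    (Filter.mem_of_superset (hVo.mem_nhds hy) hcon) hx)

lemma exists_objective_relation (hU : IsOpen U) (hUc : IsPreconnected U)
    (hf : AnalyticOnNhd ℝ f U) (hP : P ≠ 0) (hPd : P.totalDegree ≤ d)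
    (hPf : ∀ x ∈ U, eval (Fin.snoc (fun i => x i) (f x)) P = 0)
    (hPne : ∃ x ∈ U, eval (Fin.snoc (fun i => x i) (f x)) (pderiv (Fin.last n) P) ≠ 0)
    {A : ℕ} (hA : d * (5 * d + 8) ^ n ≤ A) {r : ℝ} (hr : ball 0 r ⊆ U) :
    ∃ B, ∀ (G : ℝ → EuclideanSpace ℝ (Fin n) → ℝ)
      (Gp : MvPolynomial (Fin (n + 1)) (Polynomial ℝ)), Gp.totalDegree ≤ 5 * d + 9 →
      (∀ l, 0 < l → ContinuousOn (G l) (ball 0 r)) →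
      (∀ l, 0 < l → ∀ x ∈ ball 0 r, graphEval f l x Gp =
        G l x * graphEval f l x (objDerivDen (map Polynomial.C P))) →
      ∃ c : ℕ → (Fin n →₀ ℕ) → Polynomial ℝ, (∃ a ≤ A, ∃ b ∈ monos n B, c a b ≠ 0) ∧
        ∀ l, 0 < l → ∀ x ∈ ball 0 r, ∑ a ∈ Finset.range (A + 1), ∑ b ∈ monos n B,
          (c a b).eval l * (G l x ^ a *
            ∏ i, (fderiv ℝ (objective f r l) x (EuclideanSpace.single i 1)) ^ b i) = 0 := by
  obtain ⟨B, hB⟩ := exists_algebraic_relation (R := Polynomial ℝ) n d (5 * d + 9) (5 * d + 8) A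
    (by omega) (by omega) hA
  refine ⟨B, fun G Gp hGp hGc hG => ?_⟩
  set Q : MvPolynomial (Fin (n + 1)) (Polynomial ℝ) := map Polynomial.C P with hQdef
  have hQd : Q.totalDegree ≤ d := (totalDegree_map_le _ _).trans hPd
  have hQ0 : Q ≠ 0 := (map_ne_zero_iff _ (map_injective _ Polynomial.C_injective)).2 hP
  have hQf : ∀ l, ∀ x ∈ U, graphEval f l x Q = 0 := fun l x hx => by
    rw [hQdef, graphEval_map_C, hPf x hx]
  obtain ⟨c, hc, q, hq⟩ := hB Q Gp (objDerivDen Q) (objDerivNum r Q) hQ0 hQd hGp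
    (totalDegree_objDerivDen_le hQd) (totalDegree_objDerivNum_le hQd r)
  refine ⟨c, hc, fun l hl => ?_⟩
  have hΔ : ∀ x, graphEval f l x (pderiv (Fin.last n) Q) =
      eval (Fin.snoc (fun i => x i) (f x)) (pderiv (Fin.last n) P) := fun x => by
    rw [hQdef, pderiv_map, graphEval_map_C]
  have hgood : ∀ x ∈ ball (0 : EuclideanSpace ℝ (Fin n)) r,
      graphEval f l x (pderiv (Fin.last n) Q) ≠ 0 →
      ∑ a ∈ Finset.range (A + 1), ∑ b ∈ monos n B, (c a b).eval l * (G l x ^ a *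
        ∏ i, (fderiv ℝ (objective f r l) x (EuclideanSpace.single i 1)) ^ b i) = 0 := by
    intro x hx hne
    have hH : graphEval f l x (objDerivDen Q) ≠ 0 := by
      rw [objDerivDen, map_mul, map_pow]
      exact mul_ne_zero (pow_ne_zero 2 (graphEval_objDen_ne_zero hl hne)) hne
    have h1 := congrArg (graphEval f l x) hq
    rw [map_mul, hQf l x (hr hx), zero_mul] at h1
    have h2 : graphEval f l x (objDerivDen Q) ^ (A + B) *
        ∑ a ∈ Finset.range (A + 1), ∑ b ∈ monos n B, (c a b).eval l * (G l x ^ a *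
          ∏ i, (fderiv ℝ (objective f r l) x (EuclideanSpace.single i 1)) ^ b i) = 0 := by
      rw [← h1]
      simp only [map_sum, map_mul, map_pow, map_prod, graphEval_C, Finset.mul_sum,
        hG l hl x hx, graphEval_objDerivNum hU hf (hr hx) (hQf l) r hl]
      refine Finset.sum_congr rfl fun a ha => Finset.sum_congr rfl fun b hb => ?_
      have ha' : A = a + (A - a) := by have := Finset.mem_range.1 ha; omega
      have hb' : B = ∑ i, b i + (B - ∑ i, b i) := by have := mem_monos.1 hb; omega
      have e : graphEval f l x (objDerivDen Q) ^ (A + B) =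
          graphEval f l x (objDerivDen Q) ^ a * graphEval f l x (objDerivDen Q) ^ (A - a) *
          ((∏ i, graphEval f l x (objDerivDen Q) ^ b i) *
            graphEval f l x (objDerivDen Q) ^ (B - ∑ i, b i)) := by
        rw [Finset.prod_pow_eq_pow_sum, ← pow_add, ← pow_add, ← pow_add, ← ha', ← hb']
      rw [e]
      simp only [mul_pow, Finset.prod_mul_distrib]
      ring
    exact (mul_eq_zero.1 h2).resolve_left (pow_ne_zero _ hH)
  have hcont : ContinuousOn (fun x => ∑ a ∈ Finset.range (A + 1), ∑ b ∈ monos n B,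
      (c a b).eval l * (G l x ^ a *
        ∏ i, (fderiv ℝ (objective f r l) x (EuclideanSpace.single i 1)) ^ b i)) (ball 0 r) := by
    have h3 : ContinuousOn (fderiv ℝ (objective f r l)) (ball 0 r) :=
      ((contDiffOn_objective hU hf r hl).continuousOn_fderiv_of_isOpen hU le_rfl).mono hr
    refine continuousOn_finsetSum _ fun a _ => continuousOn_finsetSum _ fun b _ => ?_
    refine continuousOn_const.mul (((hGc l hl).pow a).mul ?_)
    exact continuousOn_finsetProd _ fun i _ => (h3.clm_apply continuousOn_const).pow _
  intro x hx
  by_contra hne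
  have hopen := hcont.isOpen_inter_preimage isOpen_ball (isOpen_compl_singleton (x := (0 : ℝ)))
  obtain ⟨y, hy, hyne⟩ := dense_eval_graph_ne_zero hUc hf hPne hopen
    (Set.inter_subset_left.trans hr) ⟨x, hx, hne⟩
  exact hy.2 (hgood y hy.1 (by rwa [hΔ]))

lemma exists_algebraic_maximizer (hU : IsOpen U) (hUc : IsPreconnected U)
    (hf : AnalyticOnNhd ℝ f U) (hP : P ≠ 0) (hPd : P.totalDegree ≤ d)
    (hPf : ∀ x ∈ U, eval (Fin.snoc (fun i => x i) (f x)) P = 0)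
    (hPne : ∃ x ∈ U, eval (Fin.snoc (fun i => x i) (f x)) (pderiv (Fin.last n) P) ≠ 0)
    {A : ℕ} (hA : d * (5 * d + 8) ^ n ≤ A) {r : ℝ} (hr0 : 0 < r) (hr : closedBall 0 r ⊆ U) :
    ∃ z : ℝ → EuclideanSpace ℝ (Fin n), ∃ q : Polynomial (Polynomial ℝ),
      ∃ w : Fin n → Polynomial (Polynomial ℝ), q ≠ 0 ∧ q.natDegree ≤ A ∧ (∀ i, w i ≠ 0) ∧
      ∀ l, 0 < l → z l ∈ ball 0 r ∧
        (∀ y ∈ closedBall 0 r, objective f r l y ≤ objective f r l (z l)) ∧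
        (q.map (Polynomial.evalRingHom l)).eval (objective f r l (z l)) = 0 ∧
        ∀ i, ((w i).map (Polynomial.evalRingHom l)).eval (z l i) = 0 := by
  classical
  have hball : ball (0 : EuclideanSpace ℝ (Fin n)) r ⊆ U := ball_subset_closedBall.trans hr
  obtain ⟨B, hB⟩ := exists_objective_relation hU hUc hf hP hPd hPf hPne hA hball
  have hψ : ∀ l, 0 < l → ContDiffOn ℝ 1 (objective f r l) U :=
    fun l hl => contDiffOn_objective hU hf r hl
  have hψc : ∀ l, 0 < l → ContinuousOn (objective f r l) (closedBall 0 r) :=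
    fun l hl => (hψ l hl).continuousOn.mono hr
  have hmax : ∀ l, 0 < l → ∃ z ∈ ball (0 : EuclideanSpace ℝ (Fin n)) r,
      (∀ y ∈ closedBall 0 r, objective f r l y ≤ objective f r l z) ∧
      ∀ G : EuclideanSpace ℝ (Fin n) → ℝ, ContinuousOn G (closedBall 0 r) →
        ∀ S ⊆ monos n B, ∀ b₀ ∈ S,
        (∀ b ∈ S, wt B b₀ ≤ wt B b) → ∀ q : (Fin n →₀ ℕ) → Polynomial ℝ,
        (∀ x ∈ ball 0 r, ∑ b ∈ S, (q b).eval (G x) *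
          ∏ i, (fderiv ℝ (objective f r l) x (EuclideanSpace.single i 1)) ^ b i = 0) →
        (q b₀).eval (G z) = 0 := by
    intro l hl
    refine exists_selected_maximizer n B hr0 (hψc l hl) ?_ ?_ ?_
    · refine div_pos ?_ (objective_den_pos f hl 0)
      rw [norm_zero, zero_pow two_ne_zero, sub_zero]
      positivity
    · intro x hx
      simp [objective, hx]
    · exact fun x hx => ((hψ l hl).differentiableOn one_ne_zero).differentiableAt
        (hU.mem_nhds (hball hx))
  choose! z hzb hzmax hzsel using hmax
  have key : ∀ (G : ℝ → EuclideanSpace ℝ (Fin n) → ℝ)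
      (Gp : MvPolynomial (Fin (n + 1)) (Polynomial ℝ)), Gp.totalDegree ≤ 5 * d + 9 →
      (∀ l, 0 < l → ContinuousOn (G l) (closedBall 0 r)) →
      (∀ l, 0 < l → ∀ x ∈ ball 0 r, graphEval f l x Gp =
        G l x * graphEval f l x (objDerivDen (map Polynomial.C P))) →
      ∃ q : Polynomial (Polynomial ℝ), q ≠ 0 ∧ q.natDegree ≤ A ∧
        ∀ l, 0 < l → (q.map (Polynomial.evalRingHom l)).eval (G l (z l)) = 0 := by
    intro G Gp h1 h2 h3
    obtain ⟨c, ⟨a₀, ha₀, b₁, hb₁, hc⟩, hrel⟩ :=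
      hB G Gp h1 (fun l hl => (h2 l hl).mono ball_subset_closedBall) h3
    let q : (Fin n →₀ ℕ) → Polynomial (Polynomial ℝ) := fun b =>
      ∑ a ∈ Finset.range (A + 1), Polynomial.monomial a (c a b)
    have hcoeff : ∀ a ≤ A, ∀ b, (q b).coeff a = c a b := by
      intro a ha b
      simp only [q, Polynomial.finsetSum_coeff, Polynomial.coeff_monomial]
      rw [Finset.sum_ite_eq' _ _ _, if_pos (Finset.mem_range.2 (by omega))]
    let S := (monos n B).filter fun b => q b ≠ 0
    have hS : S.Nonempty := ⟨b₁, by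
      refine Finset.mem_filter.2 ⟨hb₁, fun h => hc ?_⟩
      rw [← hcoeff a₀ ha₀, h, Polynomial.coeff_zero]⟩
    obtain ⟨b₀, hb₀, hmin⟩ := Finset.exists_min_image S (wt B) hS
    refine ⟨q b₀, (Finset.mem_filter.1 hb₀).2, ?_, fun l hl => ?_⟩
    · refine Polynomial.natDegree_sum_le_of_forall_le _ _ fun a ha => ?_
      exact (Polynomial.natDegree_monomial_le _).trans (by have := Finset.mem_range.1 ha; omega)
    · refine hzsel l hl (G l) (h2 l hl) S (Finset.filter_subset _ _) b₀ hb₀ hmin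
        (fun b => (q b).map (Polynomial.evalRingHom l)) fun x hx => ?_
      rw [← hrel l hl x hx, Finset.sum_comm, Finset.sum_filter_of_ne]
      · refine Finset.sum_congr rfl fun b _ => ?_
        simp only [q, Polynomial.map_sum, Polynomial.map_monomial, Polynomial.eval_finsetSum,
          Polynomial.eval_monomial, Finset.sum_mul, Polynomial.coe_evalRingHom, mul_assoc]
      · intro b _ hne h0
        simp [h0] at hne
  have hQd : (map Polynomial.C P : MvPolynomial (Fin (n + 1)) (Polynomial ℝ)).totalDegree ≤ d :=
    (totalDegree_map_le _ _).trans hPd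
  have hQf : ∀ l, ∀ x ∈ U, graphEval f l x (map Polynomial.C P) = 0 := fun l x hx => by
    rw [graphEval_map_C, hPf x hx]
  obtain ⟨q, hq0, hqd, hq⟩ := key (objective f r)
    (objNum r (map Polynomial.C P) * objDen (map Polynomial.C P) *
      pderiv (Fin.last n) (map Polynomial.C P))
    ((totalDegree_mul_le_of_le (totalDegree_mul_le_of_le (totalDegree_objNum_le hQd r)
      (totalDegree_objDen_le hQd)) (totalDegree_pderiv_le_of_le hQd _)).trans (by omega))
    hψc (fun l hl x hx => by
      rw [map_mul, map_mul, ← objective_mul_graphEval_objDen hU (hball hx)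
        (hf x (hball hx)).differentiableAt (hQf l) r hl, objDerivDen, map_mul, map_pow]
      ring)
  have hcoord : ∀ i : Fin n, ∃ q : Polynomial (Polynomial ℝ), q ≠ 0 ∧ q.natDegree ≤ A ∧
      ∀ l, 0 < l → (q.map (Polynomial.evalRingHom l)).eval (z l i) = 0 := fun i =>
    key (fun _ x => x i) (X i.castSucc * objDerivDen (map Polynomial.C P))
      ((totalDegree_mul_le_of_le (a := 1) (by rw [totalDegree_X])
        (totalDegree_objDerivDen_le hQd)).trans (by omega))
      (fun l hl => by fun_prop)
      (fun l hl x hx => by rw [map_mul, graphEval_X_castSucc])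
  choose w hw0 hwd hw using hcoord
  exact ⟨z, q, w, hq0, hqd, hw0, fun l hl =>
    ⟨hzb l hl, hzmax l hl, hq l hl, fun i => hw i l hl⟩⟩

end

lemma EuclideanSpace.norm_sq_dual {n : ℕ} (L : EuclideanSpace ℝ (Fin n) →L[ℝ] ℝ) :
    ‖L‖ ^ 2 = ∑ i, (L (EuclideanSpace.single i 1)) ^ 2 := by
  rw [← (InnerProductSpace.toDual ℝ (EuclideanSpace ℝ (Fin n))).symm.norm_map L,
    EuclideanSpace.real_norm_sq_eq]
  refine Finset.sum_congr rfl fun i _ => ?_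
  have h := InnerProductSpace.toDual_symm_apply (x := EuclideanSpace.single i (1 : ℝ)) (y := L)
  rw [EuclideanSpace.inner_single_right] at h
  simp only [one_mul, conj_trivial] at h
  rw [h]

lemma gradSq_eq_norm_sq {n : ℕ} (f : EuclideanSpace ℝ (Fin n) → ℝ)
    (x : EuclideanSpace ℝ (Fin n)) : gradSq f x = ‖fderiv ℝ f x‖ ^ 2 :=
  (EuclideanSpace.norm_sq_dual _).symm

section
open Filter Topology

lemma AnalyticAt.false_of_deriv_le {F : ℝ → ℝ} (hF : AnalyticAt ℝ F 0) (h0 : F 0 = 0)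
    {𝒱 : Filter ℝ} [𝒱.NeBot] (h𝒱 : 𝒱 ≤ 𝓝[>] 0) (hne : ∀ᶠ s in 𝒱, F s ≠ 0) {K : ℝ}
    (hK : ∀ᶠ s in 𝒱, |deriv F s| ≤ K * |F s|) : False := by
  have h𝒱0 : 𝒱 ≤ 𝓝 0 := h𝒱.trans nhdsWithin_le_nhds
  have hev : ¬ ∀ᶠ s in 𝓝 0, F s = 0 := fun h => by
    obtain ⟨s, h1, h2⟩ := (hne.and (h𝒱0 h)).exists
    exact h1 h2
  obtain ⟨a, h, hh, hh0, hFh⟩ := (hF.exists_eventuallyEq_pow_smul_nonzero_iff).2 hev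
  simp only [sub_zero, smul_eq_mul] at hFh
  have ha : a ≠ 0 := by
    rintro rfl
    have := hFh.self_of_nhds
    simp [h0] at this
    exact hh0 this.symm
  have hder : ∀ᶠ s in 𝓝 (0 : ℝ), s * deriv F s = F s * a + s ^ a * (s * deriv h s) := by
    filter_upwards [hFh.eventually_nhds, hh.eventually_analyticAt] with s hs hhs
    replace hs : F =ᶠ[𝓝 s] fun x => x ^ a * h x := hs
    have h1 : deriv F s = a * s ^ (a - 1) * h s + s ^ a * deriv h s := by
      rw [hs.deriv_eq]
      exact ((hasDerivAt_pow a s).mul hhs.differentiableAt.hasDerivAt).deriv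
    rw [h1, hs.eq_of_nhds]
    obtain ⟨b, rfl⟩ := Nat.exists_eq_succ_of_ne_zero ha
    simp only [Nat.succ_eq_add_one, Nat.add_sub_cancel]
    ring
  have hlim1 : Tendsto (fun s => a * |h s| - |s * deriv h s|) 𝒱 (𝓝 (a * |h 0| - |0 * deriv h 0|)) :=
    ((continuousAt_const.mul hh.continuousAt.abs).sub
      (continuousAt_id.mul hh.deriv.continuousAt).abs).tendsto.mono_left h𝒱0
  have hlim2 : Tendsto (fun s => K * |s| * |h s|) 𝒱 (𝓝 (K * |0| * |h 0|)) :=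
    ((continuousAt_const.mul continuousAt_id.abs).mul hh.continuousAt.abs).tendsto.mono_left h𝒱0
  have hle : ∀ᶠ s in 𝒱, a * |h s| - |s * deriv h s| ≤ K * |s| * |h s| := by
    filter_upwards [hK, h𝒱0 hder, h𝒱0 hFh, h𝒱 self_mem_nhdsWithin] with s h1 h2 h3 h4
    have hs : 0 < s := h4
    have hsa : 0 < |s ^ a| := abs_pos.2 (pow_pos hs a).ne'
    rw [h3] at h1 h2
    have h5 : |s| * |deriv F s| ≤ |s| * (K * |s ^ a * h s|) :=
      mul_le_mul_of_nonneg_left h1 (abs_nonneg s)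
    rw [← abs_mul, h2] at h5
    have h6 : s ^ a * h s * a + s ^ a * (s * deriv h s) = s ^ a * (a * h s + s * deriv h s) := by
      ring
    have h7 : a * |h s| - |s * deriv h s| ≤ |a * h s + s * deriv h s| := by
      have := abs_sub_abs_le_abs_sub (a * h s) (-(s * deriv h s))
      rw [abs_neg, sub_neg_eq_add, abs_mul, Nat.abs_cast] at this
      exact this
    rw [h6, abs_mul, abs_mul] at h5
    refine h7.trans ?_
    refine le_of_mul_le_mul_left (h5.trans_eq ?_) hsa
    ring
  have := le_of_tendsto_of_tendsto hlim1 hlim2 hle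
  simp only [zero_mul, abs_zero, sub_zero, mul_zero] at this
  have h8 : 0 < (a : ℝ) * |h 0| := mul_pos (by exact_mod_cast Nat.pos_of_ne_zero ha) (abs_pos.2 hh0)
  linarith

lemma exists_common_puiseux {n : ℕ} {𝒰 : Filter ℝ} (h𝒰 : 𝒰 ≤ 𝓝[>] 0)
    {z : ℝ → EuclideanSpace ℝ (Fin n)} (h : ∀ i, IsPuiseux 𝒰 fun s => z s i) :
    ∃ e : ℕ, 0 < e ∧ ∃ ψ : ℝ → EuclideanSpace ℝ (Fin n), AnalyticAt ℝ ψ 0 ∧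
      ∀ᶠ s in 𝒰, z s = ψ (s ^ ((e : ℝ)⁻¹)) := by
  choose e he ψ hψ hz using h
  refine ⟨∏ i, e i, Finset.prod_pos fun i _ => he i,
    fun t => WithLp.toLp 2 fun i => ψ i (t ^ ((∏ j, e j) / e i)), ?_, ?_⟩
  · have h1 : AnalyticAt ℝ (fun t : ℝ => fun i => ψ i (t ^ ((∏ j, e j) / e i))) 0 := by
      rw [analyticAt_pi_iff]
      intro i
      refine AnalyticAt.comp_of_eq (hψ i) (analyticAt_id.pow _) ?_
      have h2 : (∏ j, e j) / e i ≠ 0 :=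
        (Nat.div_pos (Nat.le_of_dvd (Finset.prod_pos fun i _ => he i)
          (Finset.dvd_prod_of_mem e (Finset.mem_univ i))) (he i)).ne'
      simp [h2]
    exact AnalyticAt.fun_comp
      ((EuclideanSpace.equiv (Fin n) ℝ).symm.toContinuousLinearMap.analyticAt _) h1
  · filter_upwards [eventually_all.2 hz, h𝒰 self_mem_nhdsWithin] with s hs hs0
    have hs0 : 0 < s := hs0
    ext i
    rw [hs i]
    simp only
    congr 1
    obtain ⟨c, hc⟩ := Finset.dvd_prod_of_mem e (Finset.mem_univ i)
    have hc0 : (c : ℝ) ≠ 0 := by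
      rintro h0
      have h0 : c = 0 := by exact_mod_cast h0
      have := Finset.prod_pos (s := Finset.univ) fun i _ => he i
      simp [hc, h0] at this
    rw [hc, Nat.mul_div_cancel_left _ (he i), ← Real.rpow_natCast, ← Real.rpow_mul hs0.le]
    congr 1
    have := he i
    push_cast
    field_simp
end

section
open Filter Topology Metric

variable {n : ℕ} {f : EuclideanSpace ℝ (Fin n) → ℝ} {U : Set (EuclideanSpace ℝ (Fin n))}

lemma bounds_of_objective_ge {r l C : ℝ} {x : EuclideanSpace ℝ (Fin n)} (hl : 0 < l) (hC : 1 ≤ C)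
    (h : 1 / C ≤ objective f r l x * l) (hsmall : C * r ^ 2 * l ≤ 1 / 4) :
    f x ≠ 0 ∧ f x ^ 2 ≤ 2 * l ∧ ‖fderiv ℝ f x‖ ^ 2 ≤ 2 * C * r ^ 2 * f x ^ 2 := by
  rw [← gradSq_eq_norm_sq]
  have hg : 0 ≤ gradSq f x := Finset.sum_nonneg fun i _ => sq_nonneg _
  have hden := objective_den_pos f hl x
  have hC0 : 0 < C := by linarith
  rw [objective, div_mul_eq_mul_div, div_le_div_iff₀ hC0 hden, one_mul] at h
  have h1 : l ^ 2 * gradSq f x + ((f x ^ 2 - l) ^ 2 + l ^ 4) ≤ C * r ^ 2 * l * l ^ 2 := by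
    refine h.trans ?_
    have : 0 ≤ ‖x‖ ^ 2 * l ^ 2 * l * C := by positivity
    nlinarith
  have hl2 : 0 < l ^ 2 := by positivity
  have hl4 : 0 < l ^ 4 := by positivity
  have h2 : gradSq f x ≤ C * r ^ 2 * l := by
    refine le_of_mul_le_mul_left ?_ hl2
    nlinarith [sq_nonneg (f x ^ 2 - l)]
  have h3 : (f x ^ 2 - l) ^ 2 ≤ (l / 2) ^ 2 := by
    have : C * r ^ 2 * l * l ^ 2 ≤ 1 / 4 * l ^ 2 := mul_le_mul_of_nonneg_right hsmall hl2.le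
    have : 0 ≤ l ^ 2 * gradSq f x := by positivity
    nlinarith
  have h4 := abs_le_of_sq_le_sq h3 (by positivity)
  rw [abs_le] at h4
  refine ⟨fun h0 => ?_, by linarith [h4.2], ?_⟩
  · rw [h0] at h4
    norm_num at h4
    linarith
  · have : 0 ≤ C * r ^ 2 := by positivity
    nlinarith [h4.1]

lemma exists_maximum_bound (hf : AnalyticOnNhd ℝ f U) {A : ℕ} {r : ℝ}
    (hr : closedBall 0 r ⊆ U) {z : ℝ → EuclideanSpace ℝ (Fin n)}
    {q : Polynomial (Polynomial ℝ)} {w : Fin n → Polynomial (Polynomial ℝ)}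
    (hq0 : q ≠ 0) (hqd : q.natDegree ≤ A) (hw0 : ∀ i, w i ≠ 0)
    (hz : ∀ l, 0 < l → z l ∈ ball 0 r) (hpos : ∀ l, 0 < l → 0 < objective f r l (z l))
    (hq : ∀ l, 0 < l → (q.map (Polynomial.evalRingHom l)).eval (objective f r l (z l)) = 0)
    (hw : ∀ l, 0 < l → ∀ i, ((w i).map (Polynomial.evalRingHom l)).eval (z l i) = 0) :
    ∃ C, 1 ≤ C ∧ ∀ᶠ l in 𝓝[>] 0, (objective f r l (z l) * l) ^ A ≤ C * l := by
  obtain ⟨C, hC, hdich⟩ := newton_dichotomy hq0 hqd (M := fun l => objective f r l (z l))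
    (by filter_upwards [self_mem_nhdsWithin] with l hl using ⟨hpos l hl, hq l hl⟩)
  refine ⟨C, hC, ?_⟩
  by_contra hcon
  have hfreq : ∃ᶠ l in 𝓝[>] (0 : ℝ), 1 / C ≤ objective f r l (z l) * l := by
    rw [Filter.not_eventually] at hcon
    exact (hcon.and_eventually hdich).mono fun l hl => hl.2.resolve_left hl.1
  have : (𝓝[>] (0 : ℝ) ⊓ 𝓟 {l | 1 / C ≤ objective f r l (z l) * l}).NeBot :=
    frequently_mem_iff_neBot.1 hfreq
  set 𝒰 : Ultrafilter ℝ := Ultrafilter.of (𝓝[>] (0 : ℝ) ⊓ 𝓟 {l | 1 / C ≤ objective f r l (z l) * l})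
  have h𝒰' := Ultrafilter.of_le (𝓝[>] (0 : ℝ) ⊓ 𝓟 {l | 1 / C ≤ objective f r l (z l) * l})
  have h𝒰 : (𝒰 : Filter ℝ) ≤ 𝓝[>] 0 := h𝒰'.trans inf_le_left
  have hge : ∀ᶠ l in (𝒰 : Filter ℝ), 1 / C ≤ objective f r l (z l) * l :=
    h𝒰'.trans inf_le_right (mem_principal_self _)
  have h𝒰pos : ∀ᶠ l in (𝒰 : Filter ℝ), 0 < l := h𝒰 self_mem_nhdsWithin
  obtain ⟨e, he, ψ, hψ, hzψ⟩ := exists_common_puiseux h𝒰 (z := z) fun i =>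
    isPuiseux_of_root h𝒰 (hw0 i) (K := r)
      (by
        filter_upwards [h𝒰pos] with l hl
        exact (PiLp.norm_apply_le (z l) i).trans (mem_ball_zero_iff.1 (hz l hl)).le)
      (by filter_upwards [h𝒰pos] with l hl using hw l hl i)
  have hρ := tendsto_rpow_inv_nhdsGT_zero he
  set 𝒱 : Filter ℝ := map (fun s : ℝ => s ^ ((e : ℝ)⁻¹)) 𝒰
  have h𝒱 : 𝒱 ≤ 𝓝[>] 0 := hρ.mono_left h𝒰
  have h𝒱0 : 𝒱 ≤ 𝓝 0 := h𝒱.trans nhdsWithin_le_nhds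
  have hψ0 : ψ 0 ∈ closedBall (0 : EuclideanSpace ℝ (Fin n)) r := by
    refine isClosed_closedBall.mem_of_tendsto (hψ.continuousAt.tendsto.mono_left h𝒱0) ?_
    rw [eventually_map]
    filter_upwards [h𝒰pos, hzψ] with l hl h
    rw [← h]
    exact ball_subset_closedBall (hz l hl)
  have hfψ : AnalyticAt ℝ f (ψ 0) := hf _ (hr hψ0)
  have hF : AnalyticAt ℝ (fun s => f (ψ s)) 0 := hfψ.comp hψ
  have hsmall : ∀ᶠ l in (𝒰 : Filter ℝ), C * r ^ 2 * l ≤ 1 / 4 := by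
    have : Tendsto (fun l : ℝ => C * r ^ 2 * l) (𝓝 0) (𝓝 (C * r ^ 2 * 0)) :=
      (tendsto_id (α := ℝ)).const_mul _
    rw [mul_zero] at this
    exact h𝒰 (nhdsWithin_le_nhds ((this.eventually (gt_mem_nhds (by norm_num : (0 : ℝ) < 1 / 4))).mono
      fun l hl => le_of_lt hl))
  have hprop : ∀ᶠ l in (𝒰 : Filter ℝ), f (ψ (l ^ ((e : ℝ)⁻¹))) ≠ 0 ∧
      f (ψ (l ^ ((e : ℝ)⁻¹))) ^ 2 ≤ 2 * l ∧
      ‖fderiv ℝ f (ψ (l ^ ((e : ℝ)⁻¹)))‖ ^ 2 ≤ 2 * C * r ^ 2 * f (ψ (l ^ ((e : ℝ)⁻¹))) ^ 2 := by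
    filter_upwards [h𝒰pos, hzψ, hsmall, hge] with l hl h1 h2 h3
    rw [← h1]
    exact bounds_of_objective_ge hl hC h3 h2
  have hF0 : f (ψ 0) = 0 := by
    have h1 : Tendsto (fun l : ℝ => f (ψ (l ^ ((e : ℝ)⁻¹))) ^ 2) 𝒰 (𝓝 (f (ψ 0) ^ 2)) :=
      ((hF.continuousAt.tendsto.mono_left h𝒱0).comp tendsto_map).pow 2
    have h2 : Tendsto (fun l : ℝ => 2 * l) 𝒰 (𝓝 (2 * 0)) :=
      ((tendsto_id (α := ℝ)).const_mul 2).mono_left (h𝒰.trans nhdsWithin_le_nhds)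
    have h3 := le_of_tendsto_of_tendsto h1 h2 (hprop.mono fun l h => h.2.1)
    rw [mul_zero] at h3
    exact pow_eq_zero_iff two_ne_zero |>.1 (le_antisymm h3 (sq_nonneg _))
  have hbd : ∀ᶠ s in 𝓝 (0 : ℝ), ‖deriv ψ s‖ ≤ ‖deriv ψ 0‖ + 1 :=
    (hψ.deriv.continuousAt.norm.eventually (gt_mem_nhds (lt_add_one _))).mono fun s hs => le_of_lt hs
  have hder : ∀ᶠ s in 𝓝 (0 : ℝ), deriv (fun s => f (ψ s)) s = fderiv ℝ f (ψ s) (deriv ψ s) := by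
    filter_upwards [hψ.eventually_analyticAt,
      hψ.continuousAt.eventually hfψ.eventually_analyticAt] with s h1 h2
    exact fderiv_comp_deriv s h2.differentiableAt h1.differentiableAt
  refine hF.false_of_deriv_le hF0 h𝒱 (K := √(2 * C * r ^ 2) * (‖deriv ψ 0‖ + 1)) ?_ ?_
  · rw [eventually_map]
    exact hprop.mono fun l h => h.1
  · have h1 : ∀ᶠ s in 𝒱, ‖fderiv ℝ f (ψ s)‖ ^ 2 ≤ 2 * C * r ^ 2 * f (ψ s) ^ 2 := by
      rw [eventually_map]
      exact hprop.mono fun l h => h.2.2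
    filter_upwards [h1, h𝒱0 hbd, h𝒱0 hder] with s h2 h3 h4
    rw [h4]
    have h5 : ‖fderiv ℝ f (ψ s)‖ ≤ √(2 * C * r ^ 2) * |f (ψ s)| := by
      rw [← Real.sqrt_sq_eq_abs, ← Real.sqrt_mul (by positivity)]
      exact Real.le_sqrt_of_sq_le h2
    calc |fderiv ℝ f (ψ s) (deriv ψ s)| ≤ ‖fderiv ℝ f (ψ s)‖ * ‖deriv ψ s‖ :=
          (fderiv ℝ f (ψ s)).le_opNorm _
      _ ≤ √(2 * C * r ^ 2) * |f (ψ s)| * (‖deriv ψ 0‖ + 1) := by gcongr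
      _ = _ := by ring
end

section
open Filter Topology Metric MvPolynomial

variable {n : ℕ} {f : EuclideanSpace ℝ (Fin n) → ℝ} {U : Set (EuclideanSpace ℝ (Fin n))}

lemma pow_le_of_maximum_bound {m : ℕ} {a C g l : ℝ} (ha : 0 < a) (hC : 0 < C) (hg : 0 ≤ g)
    (hl : 0 < l) (h : (a / (g + l ^ 2) * l) ^ (m + 1) ≤ C * l)
    (hsmall : C * 2 ^ (m + 1) * l ^ (m + 2) < a ^ (m + 1)) :
    l ^ m ≤ C * 2 ^ (m + 1) / a ^ (m + 1) * g ^ (m + 1) := by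
  have hden : 0 < g + l ^ 2 := by positivity
  rw [div_mul_eq_mul_div, div_pow, div_le_iff₀ (by positivity), mul_pow] at h
  have h1 : a ^ (m + 1) * l ^ m ≤ C * (g + l ^ 2) ^ (m + 1) := by
    refine le_of_mul_le_mul_right ?_ hl
    calc a ^ (m + 1) * l ^ m * l = a ^ (m + 1) * l ^ (m + 1) := by ring
      _ ≤ _ := h
      _ = _ := by ring
  rcases le_total g (l ^ 2) with hle | hle
  · exfalso
    have h2 : C * (g + l ^ 2) ^ (m + 1) ≤ C * (2 * l ^ 2) ^ (m + 1) := by gcongr; linarith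
    have h3 : a ^ (m + 1) * l ^ m ≤ (C * 2 ^ (m + 1) * l ^ (m + 2)) * l ^ m :=
      (h1.trans h2).trans_eq (by ring)
    exact absurd (le_of_mul_le_mul_right h3 (by positivity)) (not_le.2 hsmall)
  · have h2 : C * (g + l ^ 2) ^ (m + 1) ≤ C * (2 * g) ^ (m + 1) := by gcongr; linarith
    rw [div_mul_eq_mul_div, le_div_iff₀ (by positivity)]
    calc l ^ m * a ^ (m + 1) = a ^ (m + 1) * l ^ m := mul_comm _ _
      _ ≤ _ := h1.trans h2
      _ = _ := by ring

lemma exists_gradient_inequality_of_maximum_bound {m : ℕ} {r C : ℝ} (hr : 0 < r) (hC : 0 < C)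
    (hf : ContinuousAt f 0) (hf0 : f 0 = 0) {z : ℝ → EuclideanSpace ℝ (Fin n)}
    (hmax : ∀ l, 0 < l → ∀ y ∈ closedBall 0 r, objective f r l y ≤ objective f r l (z l))
    (hM : ∀ᶠ l in 𝓝[>] 0, (objective f r l (z l) * l) ^ (m + 1) ≤ C * l) :
    ∃ K, 0 < K ∧ ∀ᶠ x in 𝓝 (0 : EuclideanSpace ℝ (Fin n)), f x ≠ 0 →
      |f x| ^ m ≤ K * ‖fderiv ℝ f x‖ ^ (m + 1) := by
  set a : ℝ := 3 * r ^ 2 / 4 with ha_def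
  have ha : 0 < a := by positivity
  have hsmall : ∀ᶠ l in 𝓝 (0 : ℝ), C * 2 ^ (m + 1) * l ^ (m + 2) < a ^ (m + 1) := by
    have h1 : Tendsto (fun l : ℝ => C * 2 ^ (m + 1) * l ^ (m + 2)) (𝓝 0)
        (𝓝 (C * 2 ^ (m + 1) * 0 ^ (m + 2))) := ((tendsto_id (α := ℝ)).pow _).const_mul _
    refine h1.eventually (gt_mem_nhds ?_)
    rw [zero_pow (by omega), mul_zero]
    positivity
  have hev := (eventually_nhdsWithin_iff.1 hM).and hsmall
  have hf2 : Tendsto (fun x => f x ^ 2) (𝓝 0) (𝓝 0) := by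
    have := hf.tendsto.pow 2
    rwa [hf0, zero_pow two_ne_zero] at this
  refine ⟨√(C * 2 ^ (m + 1) / a ^ (m + 1)), by positivity, ?_⟩
  filter_upwards [hf2.eventually hev, ball_mem_nhds (0 : EuclideanSpace ℝ (Fin n)) (half_pos hr)]
    with x hx hxr hne
  have hl : 0 < f x ^ 2 := by positivity
  rw [mem_ball_zero_iff] at hxr
  have h1 : a / (‖fderiv ℝ f x‖ ^ 2 + (f x ^ 2) ^ 2) ≤ objective f r (f x ^ 2) (z (f x ^ 2)) := by
    refine le_trans ?_ (hmax _ hl x (mem_closedBall_zero_iff.2 (by linarith)))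
    have e : objective f r (f x ^ 2) x =
        (r ^ 2 - ‖x‖ ^ 2) / (‖fderiv ℝ f x‖ ^ 2 + (f x ^ 2) ^ 2) := by
      rw [objective, gradSq_eq_norm_sq]
      have : 0 < ‖fderiv ℝ f x‖ ^ 2 + (f x ^ 2) ^ 2 := by positivity
      field_simp
      ring
    rw [e]
    gcongr
    nlinarith [norm_nonneg x]
  have h2 : (a / (‖fderiv ℝ f x‖ ^ 2 + (f x ^ 2) ^ 2) * f x ^ 2) ^ (m + 1) ≤ C * f x ^ 2 := by
    refine le_trans ?_ (hx.1 hl)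
    gcongr
  have h3 := pow_le_of_maximum_bound ha hC (sq_nonneg _) hl h2 hx.2
  refine abs_le_of_sq_le_sq' ?_ (by positivity) |>.2
  rw [mul_pow, Real.sq_sqrt (by positivity)]
  calc (|f x| ^ m) ^ 2 = (f x ^ 2) ^ m := by rw [← pow_mul, mul_comm, pow_mul, sq_abs]
    _ ≤ _ := h3
    _ = _ := by ring

variable {P : MvPolynomial (Fin (n + 1)) ℝ} {d : ℕ}

lemma exists_gradient_inequality (hU : IsOpen U) (hUc : IsPreconnected U)
    (h0 : (0 : EuclideanSpace ℝ (Fin n)) ∈ U) (hf : AnalyticOnNhd ℝ f U) (hf0 : f 0 = 0)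
    (hP : P ≠ 0) (hPd : P.totalDegree ≤ d)
    (hPf : ∀ x ∈ U, eval (Fin.snoc (fun i => x i) (f x)) P = 0)
    (hPne : ∃ x ∈ U, eval (Fin.snoc (fun i => x i) (f x)) (pderiv (Fin.last n) P) ≠ 0)
    {m : ℕ} (hm : d * (5 * d + 8) ^ n ≤ m + 1) :
    ∃ K, 0 < K ∧ ∀ᶠ x in 𝓝 (0 : EuclideanSpace ℝ (Fin n)), f x ≠ 0 →
      |f x| ^ m ≤ K * ‖fderiv ℝ f x‖ ^ (m + 1) := by
  obtain ⟨r, hr, hrU⟩ := nhds_basis_closedBall.mem_iff.1 (hU.mem_nhds h0)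
  obtain ⟨z, q, w, hq0, hqd, hw0, h⟩ :=
    exists_algebraic_maximizer hU hUc hf hP hPd hPf hPne hm hr hrU
  have hpos : ∀ l, 0 < l → 0 < objective f r l (z l) := fun l hl =>
    lt_of_lt_of_le (div_pos (by rw [norm_zero, zero_pow two_ne_zero, sub_zero]; positivity)
      (objective_den_pos f hl 0)) ((h l hl).2.1 0 (mem_closedBall_self hr.le))
  obtain ⟨C, hC, hM⟩ := exists_maximum_bound hf hrU hq0 hqd hw0 (fun l hl => (h l hl).1) hpos
    (fun l hl => (h l hl).2.2.1) (fun l hl => (h l hl).2.2.2)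
  exact exists_gradient_inequality_of_maximum_bound hr (by linarith) (hf 0 h0).continuousAt hf0
    (fun l hl => (h l hl).2.1) hM

lemma fderiv_zero_ne_zero_of_totalDegree_le_one (hU : IsOpen U) (hUc : IsPreconnected U)
    (h0 : (0 : EuclideanSpace ℝ (Fin n)) ∈ U) (hf : AnalyticOnNhd ℝ f U) (hf0 : f 0 = 0)
    (hfne : ∃ x ∈ U, f x ≠ 0) (hPd : P.totalDegree ≤ 1)
    (hPf : ∀ x ∈ U, eval (Fin.snoc (fun i => x i) (f x)) P = 0)
    (hPne : ∃ x ∈ U, eval (Fin.snoc (fun i => x i) (f x)) (pderiv (Fin.last n) P) ≠ 0) :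
    fderiv ℝ f 0 ≠ 0 := by
  intro hz
  have hconst : ∀ i, ∃ a, pderiv i P = C a := fun i => by
    have := totalDegree_pderiv_le i P
    exact ⟨_, totalDegree_eq_zero_iff_eq_C.1 (by omega)⟩
  choose a ha using hconst
  have hlast : a (Fin.last n) ≠ 0 := by
    obtain ⟨x, hx, hne⟩ := hPne
    simpa [ha] using hne
  have hder : ∀ x ∈ U, ∀ i : Fin n,
      a i.castSucc + a (Fin.last n) * fderiv ℝ f x (EuclideanSpace.single i 1) = 0 := by
    intro x hx i
    have h1 := fderiv_graphEval_single (l := 0) (hf x hx).differentiableAt (map Polynomial.C P) i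
    have h2 : (fun y => graphEval f 0 y (map Polynomial.C P)) =ᶠ[𝓝 x] fun _ => (0 : ℝ) :=
      mem_of_superset (hU.mem_nhds hx) fun y hy => by
        change graphEval f 0 y (map Polynomial.C P) = 0
        rw [graphEval_map_C, hPf y hy]
    rw [h2.fderiv_eq] at h1
    simp only [pderiv_map, graphEval_map_C, ha, eval_C] at h1
    simpa using h1.symm
  have hfd : ∀ x ∈ U, fderiv ℝ f x = 0 := by
    intro x hx
    have : ‖fderiv ℝ f x‖ ^ 2 = ‖fderiv ℝ f 0‖ ^ 2 := by
      rw [EuclideanSpace.norm_sq_dual, EuclideanSpace.norm_sq_dual]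
      refine Finset.sum_congr rfl fun i _ => ?_
      congr 1
      refine mul_left_cancel₀ hlast ?_
      linarith [hder x hx i, hder 0 h0 i]
    rw [hz, norm_zero, zero_pow two_ne_zero] at this
    exact norm_eq_zero.1 (pow_eq_zero_iff two_ne_zero |>.1 this)
  obtain ⟨x, hx, hne⟩ := hfne
  refine hne ?_
  rw [← hf0]
  exact hU.is_const_of_fderiv_eq_zero hUc
    (fun y hy => (hf y hy).differentiableAt.differentiableWithinAt)
    hfd hx h0

lemma mul_pow_le_of_two_le {d : ℕ} (hd : 2 ≤ d) (n : ℕ) :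
    d * (5 * d + 8) ^ n ≤ (2 * d - 1) ^ (3 * n + 1) := by
  obtain ⟨e, rfl⟩ := Nat.exists_eq_add_of_le hd
  have h1 : 2 * (2 + e) - 1 = 2 * e + 3 := by omega
  rw [h1, pow_succ, pow_mul, mul_comm]
  refine Nat.mul_le_mul (Nat.pow_le_pow_left ?_ n) (by omega)
  ring_nf
  nlinarith [Nat.zero_le (e ^ 2), Nat.zero_le (e ^ 3)]

/-- A Łojasiewicz gradient inequality with an exponent controlled by the degree. -/
lemma exists_lojasiewicz_exponent (hU : IsOpen U) (hUc : IsPreconnected U)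
    (h0 : (0 : EuclideanSpace ℝ (Fin n)) ∈ U) (hf : AnalyticOnNhd ℝ f U) (hf0 : f 0 = 0)
    (hfne : ∃ x ∈ U, f x ≠ 0) (hP : P ≠ 0)
    (hPf : ∀ x ∈ U, eval (Fin.snoc (fun i => x i) (f x)) P = 0) {k : ℕ}
    (hk : k = 2 * (2 * P.totalDegree - 1) ^ (3 * n + 1)) :
    ∃ m, 2 * m + 2 ≤ k ∧ ∃ K, 0 < K ∧ ∀ᶠ x in 𝓝 (0 : EuclideanSpace ℝ (Fin n)), f x ≠ 0 →
      |f x| ^ m ≤ K * ‖fderiv ℝ f x‖ ^ (m + 1) := by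
  obtain ⟨Q, hQ, hQd, hQf, hQne⟩ := exists_annihilator_pderiv_ne_zero hU h0 hP hPf
  rcases Nat.lt_or_ge 1 P.totalDegree with h2 | h1
  · have hle := mul_pow_le_of_two_le h2 n
    have hpos : 0 < P.totalDegree * (5 * P.totalDegree + 8) ^ n := by positivity
    refine ⟨P.totalDegree * (5 * P.totalDegree + 8) ^ n - 1, by omega, ?_⟩
    exact exists_gradient_inequality hU hUc h0 hf hf0 hQ hQd hQf hQne (by omega)
  · have hd : P.totalDegree = 1 := by
      refine le_antisymm h1 (Nat.pos_of_ne_zero fun h => hP ?_)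
      rw [totalDegree_eq_zero_iff_eq_C] at h
      have := hPf 0 h0
      rw [h, eval_C] at this
      rw [h, this, C_0]
    have hne := fderiv_zero_ne_zero_of_totalDegree_le_one hU hUc h0 hf hf0 hfne (hQd.trans h1)
      hQf hQne
    have hpos : 0 < ‖fderiv ℝ f 0‖ := norm_pos_iff.2 hne
    refine ⟨0, by rw [hk, hd]; norm_num, (‖fderiv ℝ f 0‖ / 2)⁻¹, by positivity, ?_⟩
    have hc : ContinuousAt (fun x => ‖fderiv ℝ f x‖) 0 := (hf 0 h0).fderiv.continuousAt.norm
    filter_upwards [hc.eventually (lt_mem_nhds (half_lt_self hpos))] with x hx _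
    rw [pow_zero, zero_add, pow_one, inv_mul_eq_div, le_div_iff₀ (by positivity), one_mul]
    exact hx.le
end

section
open Filter Topology Metric

variable {E : Type*} [NormedAddCommGroup E] [InnerProductSpace ℝ E]

lemma exists_zero_of_norm_fderiv_ge [ProperSpace E] {φ : E → ℝ} {x : E} {R c : ℝ} (hR : 0 < R)
    (hφ : ∀ y, 0 ≤ φ y) (hcont : ContinuousOn φ (closedBall x R))
    (hdiff : ∀ y ∈ ball x R, φ y ≠ 0 → DifferentiableAt ℝ φ y ∧ c ≤ ‖fderiv ℝ φ y‖)
    (hRc : 2 * φ x < c * R) : ∃ p ∈ closedBall x R, φ p = 0 := by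
  obtain ⟨p, hp, hmin⟩ := (isCompact_closedBall x R).exists_isMinOn
    ⟨x, mem_closedBall_self hR.le⟩
    (hcont.add (f := φ) (g := fun y => φ x / R ^ 2 * ‖y - x‖ ^ 2) (by fun_prop))
  refine ⟨p, hp, ?_⟩
  by_contra hne
  have hppos : 0 < φ p := lt_of_le_of_ne (hφ p) (Ne.symm hne)
  have hx : φ p + φ x / R ^ 2 * ‖p - x‖ ^ 2 ≤ φ x := by
    have := hmin (mem_closedBall_self hR.le)
    simpa using this
  have hpb : p ∈ ball x R := by
    rw [mem_ball, dist_eq_norm]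
    by_contra hge
    have h1 : R ^ 2 ≤ ‖p - x‖ ^ 2 := by gcongr; exact not_lt.1 hge
    have h2 : φ x / R ^ 2 * R ^ 2 ≤ φ x / R ^ 2 * ‖p - x‖ ^ 2 :=
      mul_le_mul_of_nonneg_left h1 (div_nonneg (hφ x) (by positivity))
    rw [div_mul_cancel₀ _ (by positivity)] at h2
    linarith
  obtain ⟨hd, hc⟩ := hdiff p hpb hne
  have hloc : IsLocalMin (fun y => φ y + φ x / R ^ 2 * ‖y - x‖ ^ 2) p :=
    hmin.isLocalMin (mem_of_superset (isOpen_ball.mem_nhds hpb) ball_subset_closedBall)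
  have h3 := ((hasFDerivAt_id p).sub_const x).norm_sq.const_mul (φ x / R ^ 2)
  have h4 := hloc.hasFDerivAt_eq_zero (hd.hasFDerivAt.add h3)
  have h5 : ‖fderiv ℝ φ p‖ ≤ φ x / R ^ 2 * (2 * R) := by
    rw [eq_neg_of_add_eq_zero_left h4, norm_neg]
    refine ContinuousLinearMap.opNorm_le_bound _ (by have := hφ x; positivity) fun v => ?_
    simp only [id, smul_apply, ContinuousLinearMap.comp_apply, ContinuousLinearMap.id_apply,
      innerSL_apply_apply, nsmul_eq_mul, smul_eq_mul, Real.norm_eq_abs, abs_mul,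
      abs_of_nonneg (div_nonneg (hφ x) (sq_nonneg R)), Nat.cast_ofNat, abs_two]
    have h6 := abs_real_inner_le_norm (p - x) v
    have h7 : ‖p - x‖ ≤ R := by rw [← dist_eq_norm]; exact hpb.le
    have := hφ x
    calc _ ≤ φ x / R ^ 2 * (2 * (R * ‖v‖)) := by
          gcongr
          exact h6.trans (by gcongr)
      _ = _ := by ring
  have h8 : φ x / R ^ 2 * (2 * R) = 2 * φ x / R := by field_simp
  rw [h8] at h5
  have h9 := (le_div_iff₀ hR).1 (hc.trans h5)
  linarith

lemma norm_fderiv_rpow_sq {f : E → ℝ} {m : ℕ} {K : ℝ} {x : E} (hK : 0 < K)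
    (hf : DifferentiableAt ℝ f x) (hne : f x ≠ 0)
    (hineq : |f x| ^ m ≤ K * ‖fderiv ℝ f x‖ ^ (m + 1)) :
    DifferentiableAt ℝ (fun y => (f y ^ 2) ^ ((2 * (m + 1 : ℝ))⁻¹)) x ∧
      (K ^ (((m : ℝ) + 1)⁻¹) * (m + 1))⁻¹ ≤
        ‖fderiv ℝ (fun y => (f y ^ 2) ^ ((2 * (m + 1 : ℝ))⁻¹)) x‖ := by
  have h1 : HasFDerivAt (fun y => f y ^ 2) ((2 * f x) • fderiv ℝ f x) x := by
    simpa using hf.hasFDerivAt.pow 2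
  have hpos : 0 < f x ^ 2 := by positivity
  have h2 := h1.rpow_const (p := (2 * (m + 1 : ℝ))⁻¹) (Or.inl hpos.ne')
  refine ⟨h2.differentiableAt, ?_⟩
  rw [h2.fderiv, norm_smul, norm_smul]
  have ha : 0 < |f x| := abs_pos.2 hne
  have hm : (0 : ℝ) < (m : ℝ) + 1 := by positivity
  have hroot : ∀ y : ℝ, 0 ≤ y → (y ^ (m + 1)) ^ (((m : ℝ) + 1)⁻¹) = y := fun y hy => by
    rw [← Real.rpow_natCast, ← Real.rpow_mul hy]
    push_cast
    rw [mul_inv_cancel₀ hm.ne', Real.rpow_one]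
  have h3 : (|f x| ^ m) ^ (((m : ℝ) + 1)⁻¹) ≤ K ^ (((m : ℝ) + 1)⁻¹) * ‖fderiv ℝ f x‖ := by
    calc (|f x| ^ m) ^ (((m : ℝ) + 1)⁻¹) ≤ (K * ‖fderiv ℝ f x‖ ^ (m + 1)) ^ (((m : ℝ) + 1)⁻¹) :=
          Real.rpow_le_rpow (by positivity) hineq (by positivity)
      _ = _ := by rw [Real.mul_rpow hK.le (by positivity), hroot _ (norm_nonneg _)]
  have h4 : (f x ^ 2) ^ ((2 * (m + 1 : ℝ))⁻¹ - 1) * |f x| * (|f x| ^ m) ^ (((m : ℝ) + 1)⁻¹) = 1 := by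
    rw [← sq_abs, ← Real.rpow_natCast, ← Real.rpow_natCast, ← Real.rpow_mul ha.le,
      ← Real.rpow_mul ha.le]
    nth_rewrite 2 [← Real.rpow_one |f x|]
    rw [← Real.rpow_add ha, ← Real.rpow_add ha]
    convert Real.rpow_zero |f x| using 2
    push_cast
    field_simp
    ring
  have hKpos : 0 < K ^ (((m : ℝ) + 1)⁻¹) := Real.rpow_pos_of_pos hK _
  rw [inv_le_iff_one_le_mul₀ (by positivity)]
  have h5 : 0 ≤ (f x ^ 2) ^ ((2 * (m + 1 : ℝ))⁻¹ - 1) * |f x| := by positivity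
  have h6 := mul_le_mul_of_nonneg_left h3 h5
  rw [h4] at h6
  refine h6.trans_eq ?_
  rw [Real.norm_eq_abs, Real.norm_eq_abs, abs_mul, abs_mul, abs_two,
    abs_of_pos (a := (2 * (m + 1 : ℝ))⁻¹) (by positivity),
    abs_of_nonneg (a := (f x ^ 2) ^ ((2 * (m + 1 : ℝ))⁻¹ - 1)) (by positivity)]
  field_simp

/-- A Łojasiewicz gradient inequality bounds the gradient below by a power of the distance to the
zero set. -/
lemma exists_near_zero_of_gradient_inequality [ProperSpace E] {f : E → ℝ} {m : ℕ} {K : ℝ}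
    (hK : 0 < K) (hf0 : f 0 = 0) (hf : ∀ᶠ x in 𝓝 0, DifferentiableAt ℝ f x)
    (hineq : ∀ᶠ x in 𝓝 0, f x ≠ 0 → |f x| ^ m ≤ K * ‖fderiv ℝ f x‖ ^ (m + 1)) :
    ∃ C, 0 < C ∧ ∀ᶠ x in 𝓝 0, f x ≠ 0 →
      ∃ p, f p = 0 ∧ ‖x - p‖ ≤ ‖x‖ ∧ ‖x - p‖ ^ m ≤ C * ‖fderiv ℝ f x‖ := by
  set b : ℝ := (2 * (m + 1 : ℝ))⁻¹ with hb
  have hb0 : 0 < b := by positivity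
  set c : ℝ := (K ^ (((m : ℝ) + 1)⁻¹) * (m + 1))⁻¹ with hc
  have hc0 : 0 < c := by positivity
  set φ : E → ℝ := fun y => (f y ^ 2) ^ b with hφ
  obtain ⟨ρ, hρ, hball⟩ := Metric.eventually_nhds_iff_ball.1 (hf.and hineq)
  have hφc : ContinuousOn φ (ball 0 ρ) := fun y hy =>
    (((hball y hy).1.continuousAt.pow 2).rpow_const (Or.inr hb0.le)).continuousWithinAt
  have hφ0 : φ 0 = 0 := by simp [hφ, hf0, hb0.ne']
  have hφnn : ∀ y, 0 ≤ φ y := fun y => by positivity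
  have hφz : ∀ y, φ y = 0 → f y = 0 := fun y hy => by
    by_contra hne
    have : 0 < φ y := Real.rpow_pos_of_pos (by positivity) _
    linarith
  have hφpow : ∀ y, φ y ^ (m + 1) = |f y| := fun y => by
    rw [hφ, ← Real.rpow_natCast, ← Real.rpow_mul (by positivity), ← Real.sqrt_sq_eq_abs,
      Real.sqrt_eq_rpow]
    congr 1
    rw [hb]
    push_cast
    field_simp
  have hsmall : ∀ᶠ x in 𝓝 (0 : E), 3 / c * φ x < ρ / 2 := by
    have : ContinuousAt (fun x => 3 / c * φ x) 0 :=
      continuousAt_const.mul (hφc.continuousAt (ball_mem_nhds 0 hρ))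
    refine this.eventually (gt_mem_nhds ?_)
    simp only [hφ0, mul_zero]
    positivity
  refine ⟨(3 / c) ^ m * (K + 1), by positivity, ?_⟩
  filter_upwards [hsmall, ball_mem_nhds (0 : E) (half_pos hρ)] with x hx hxρ hne
  rw [mem_ball_zero_iff] at hxρ
  have hxball : x ∈ ball (0 : E) ρ := by rw [mem_ball_zero_iff]; linarith
  have hsub : closedBall x (3 / c * φ x) ⊆ ball 0 ρ := by
    refine (closedBall_subset_ball' ?_)
    rw [dist_zero_right]
    linarith
  have hφx : 0 < φ x := lt_of_le_of_ne (hφnn x) fun h => hne (hφz x h.symm)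
  obtain ⟨p, hp, hp0⟩ := exists_zero_of_norm_fderiv_ge (φ := φ) (x := x) (R := 3 / c * φ x) (c := c)
    (by positivity) hφnn (hφc.mono hsub)
    (fun y hy hyne => norm_fderiv_rpow_sq hK (hball y (hsub (ball_subset_closedBall hy))).1
      (fun h => hyne (by simp [hφ, h, hb0.ne']))
      ((hball y (hsub (ball_subset_closedBall hy))).2
        (fun h => hyne (by simp [hφ, h, hb0.ne']))))
    (by field_simp; linarith)
  have hbound : ‖x - p‖ ^ m ≤ (3 / c) ^ m * (K + 1) * ‖fderiv ℝ f x‖ := by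
    have h1 : ‖x - p‖ ≤ 3 / c * φ x := by
      rw [← dist_eq_norm, dist_comm]
      exact hp
    refine le_of_pow_le_pow_left₀ (n := m + 1) m.succ_ne_zero (by positivity) ?_
    calc (‖x - p‖ ^ m) ^ (m + 1) ≤ ((3 / c * φ x) ^ m) ^ (m + 1) := by gcongr
      _ = ((3 / c) ^ m) ^ (m + 1) * (φ x ^ (m + 1)) ^ m := by ring
      _ ≤ ((3 / c) ^ m) ^ (m + 1) * (K * ‖fderiv ℝ f x‖ ^ (m + 1)) := by
        rw [hφpow]
        gcongr
        exact (hball x hxball).2 hne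
      _ ≤ ((3 / c) ^ m) ^ (m + 1) * ((K + 1) ^ (m + 1) * ‖fderiv ℝ f x‖ ^ (m + 1)) := by
        gcongr
        exact (by linarith : K ≤ K + 1).trans (le_self_pow₀ (by linarith) m.succ_ne_zero)
      _ = _ := by rw [mul_assoc, mul_pow, mul_pow]
  rcases le_total ‖x - p‖ ‖x‖ with hle | hle
  · exact ⟨p, hφz p hp0, hle, hbound⟩
  · refine ⟨0, hf0, by rw [sub_zero], le_trans ?_ hbound⟩
    rw [sub_zero]
    gcongr
end

section
open Filter Topology Metric

lemma exists_norm_le_mul_pow_of_jet_eq_zero {E : Type} [NormedAddCommGroup E] [NormedSpace ℝ E]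
    {Z : Set E} (h0 : (0 : E) ∈ Z) (k : ℕ) :
    ∀ {F : Type} [NormedAddCommGroup F] [NormedSpace ℝ F] {g : E → F}, ContDiffAt ℝ k g 0 →
      (∀ᶠ p in 𝓝 0, p ∈ Z → ∀ i ≤ k, iteratedFDeriv ℝ i g p = 0) → ∀ ε > 0,
      ∃ ρ > 0, ∀ x ∈ ball (0 : E) ρ, ∀ p ∈ ball (0 : E) ρ, p ∈ Z → ‖g x‖ ≤ ε * ‖x - p‖ ^ k := by
  induction k with
  | zero =>
    intro F _ _ g hg hjet ε hε
    have hg0 : g 0 = 0 := by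
      have := hjet.self_of_nhds h0 0 le_rfl
      rwa [iteratedFDeriv_zero_eq_comp, Function.comp_apply, LinearIsometryEquiv.map_eq_zero_iff]
        at this
    have hc := hg.continuousAt
    rw [Metric.continuousAt_iff] at hc
    obtain ⟨ρ, hρ, h⟩ := hc ε hε
    refine ⟨ρ, hρ, fun x hx p _ _ => ?_⟩
    have := h hx
    rw [hg0, dist_zero_right] at this
    simpa using this.le
  | succ k ih =>
    intro F _ _ g hg hjet ε hε
    have hd : ContDiffAt ℝ k (fderiv ℝ g) 0 := hg.fderiv_right (by norm_cast)
    have hjet' : ∀ᶠ p in 𝓝 0, p ∈ Z → ∀ i ≤ k, iteratedFDeriv ℝ i (fderiv ℝ g) p = 0 := by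
      filter_upwards [hjet] with p hp hpZ i hi
      rw [← norm_eq_zero, norm_iteratedFDeriv_fderiv, hp hpZ (i + 1) (by omega), norm_zero]
    obtain ⟨ρ₁, hρ₁, h₁⟩ := ih hd hjet' ε hε
    have hdiff : ∀ᶠ x in 𝓝 0, DifferentiableAt ℝ g x :=
      (hg.eventually (by simp)).mono fun x hx => hx.differentiableAt (by simp)
    obtain ⟨ρ₂, hρ₂, h₂⟩ := Metric.eventually_nhds_iff_ball.1 (hdiff.and hjet)
    refine ⟨min ρ₁ ρ₂, lt_min hρ₁ hρ₂, fun x hx p hp hpZ => ?_⟩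
    have hgp : g p = 0 := by
      have := (h₂ p (ball_subset_ball (min_le_right _ _) hp)).2 hpZ 0 (by omega)
      rwa [iteratedFDeriv_zero_eq_comp, Function.comp_apply, LinearIsometryEquiv.map_eq_zero_iff]
        at this
    have hseg : segment ℝ p x ⊆ ball 0 (min ρ₁ ρ₂) := (convex_ball 0 _).segment_subset hp hx
    have hmv := (convex_segment (𝕜 := ℝ) p x).norm_image_sub_le_of_norm_fderiv_le (f := g)
      (C := ε * ‖x - p‖ ^ k)
      (fun y hy => (h₂ y (ball_subset_ball (min_le_right _ _) (hseg hy))).1)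
      (fun y hy => by
        refine (h₁ y (ball_subset_ball (min_le_left _ _) (hseg hy)) p
          (ball_subset_ball (min_le_left _ _) hp) hpZ).trans ?_
        have : ‖y - p‖ ≤ ‖x - p‖ := by
          obtain ⟨a, b, ha, hb, hab, rfl⟩ := hy
          have : a • p + b • x - p = b • (x - p) := by
            rw [← sub_eq_zero]
            have : a = 1 - b := by linarith
            subst this
            module
          rw [this, norm_smul, Real.norm_of_nonneg hb]
          exact mul_le_of_le_one_left (norm_nonneg _) (by linarith)
        gcongr)
      (left_mem_segment ℝ p x) (right_mem_segment ℝ p x)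
    rw [hgp, sub_zero] at hmv
    exact hmv.trans_eq (by ring)
end

open Filter Topology Metric in
theorem exists_lipschitz_displacement {E : Type*} [NormedAddCommGroup E] [InnerProductSpace ℝ E]
    {f₁ f₂ : E → ℝ} {v : E → E} (hv : ContDiffAt ℝ 1 v 0)
    (hd₁ : ∀ᶠ x in 𝓝 0, DifferentiableAt ℝ f₁ x) (hd₂ : ∀ᶠ x in 𝓝 0, DifferentiableAt ℝ f₂ x)
    (hg₁ : ∀ᶠ x in 𝓝 0, ‖fderiv ℝ f₁ x - innerSL ℝ (v x)‖ ≤ ‖v x‖ / 32)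
    (hg₂ : ∀ᶠ x in 𝓝 0, ‖fderiv ℝ f₂ x - innerSL ℝ (v x)‖ ≤ ‖v x‖ / 32)
    (hu : ∀ ε > 0, ∀ᶠ x in 𝓝 0, |f₁ x - f₂ x| ≤ ε * ‖v x‖ ^ 2) :
    ∃ ρ > 0, ∃ φ : E → E, (∀ x ∈ ball 0 ρ, f₁ (x + φ x) = f₂ x) ∧
      (∀ x, f₁ x = f₂ x → φ x = 0) ∧
      ∀ x ∈ ball 0 ρ, ∀ y ∈ ball 0 ρ, ‖φ x - φ y‖ ≤ 1 / 2 * ‖x - y‖ := by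
  obtain ⟨L₀, t, ht, hL₀⟩ := hv.exists_lipschitzOnWith
  have hb : ∀ᶠ x in 𝓝 (0 : E), ‖v x‖ < ‖v 0‖ + 1 :=
    hv.continuousAt.norm.eventually (gt_mem_nhds (by simp))
  obtain ⟨r, hr, hball⟩ := Metric.eventually_nhds_iff_ball.1
    (hd₁.and (hd₂.and (hg₁.and (hg₂.and (hb.and ht)))))
  set L : ℝ := L₀ + 1 with hL
  have hL1 : 1 ≤ L := by rw [hL]; linarith [L₀.coe_nonneg]
  set M : ℝ := ‖v 0‖ + 1 with hM
  have hM0 : 0 < M := by positivity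
  have hlip : ∀ x ∈ ball (0 : E) r, ∀ y ∈ ball (0 : E) r, ‖v x - v y‖ ≤ L * ‖x - y‖ := by
    intro x hx y hy
    have := hL₀.norm_sub_le (hball x hx).2.2.2.2.2 (hball y hy).2.2.2.2.2
    exact this.trans (by gcongr; rw [hL]; linarith)
  obtain ⟨c, hc, hcL, hcM⟩ : ∃ c : ℝ, 0 < c ∧ 2 * c * L ≤ 1 / 32 ∧ 2 * c * M ≤ r / 2 := by
    refine ⟨min (1 / (64 * L)) (r / (4 * M)), by positivity, ?_, ?_⟩
    · have := min_le_left (1 / (64 * L)) (r / (4 * M))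
      calc _ ≤ 2 * (1 / (64 * L)) * L := by gcongr
        _ = 1 / 32 := by field_simp; norm_num
    · have := min_le_right (1 / (64 * L)) (r / (4 * M))
      calc _ ≤ 2 * (r / (4 * M)) * M := by gcongr
        _ = r / 2 := by field_simp; norm_num
  set η : ℝ := c / 4 with hη
  have hη0 : 0 < η := by positivity
  have hηL : η * L ≤ 1 / 16 := by rw [hη]; nlinarith
  obtain ⟨r', hr', hu'⟩ := Metric.eventually_nhds_iff_ball.1 (hu (η / 2) (by positivity))
  set ρ := min (r / 2) r' with hρ
  have hρr : ∀ x ∈ ball (0 : E) ρ, ‖x‖ < r / 2 ∧ x ∈ ball (0 : E) r ∧ x ∈ ball (0 : E) r' := by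
    intro x hx
    rw [mem_ball_zero_iff] at hx
    have h1 := hx.trans_le (min_le_left _ _)
    have h2 := hx.trans_le (min_le_right _ _)
    exact ⟨h1, by rw [mem_ball_zero_iff]; linarith, by rwa [mem_ball_zero_iff]⟩
  have hsub : ∀ x ∈ ball (0 : E) ρ, closedBall x (2 * c * ‖v x‖) ⊆ ball 0 r := by
    intro x hx y hy
    have h1 := hρr x hx
    have h2 : ‖v x‖ ≤ M := (hball x h1.2.1).2.2.2.2.1.le
    rw [mem_closedBall, dist_eq_norm] at hy
    rw [mem_ball_zero_iff]
    have h3 : 2 * c * ‖v x‖ ≤ 2 * c * M := by gcongr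
    have h4 := norm_add_le (y - x) x
    rw [sub_add_cancel] at h4
    linarith [h1.1]
  have hnear : ∀ x ∈ ball (0 : E) ρ, ∀ y ∈ closedBall x (2 * c * ‖v x‖),
      ‖v y - v x‖ ≤ ‖v x‖ / 32 := by
    intro x hx y hy
    have h1 := hlip y (hsub x hx hy) x (hρr x hx).2.1
    rw [mem_closedBall, dist_eq_norm] at hy
    calc _ ≤ L * (2 * c * ‖v x‖) := h1.trans (by gcongr)
      _ = (2 * c * L) * ‖v x‖ := by ring
      _ ≤ 1 / 32 * ‖v x‖ := by gcongr
      _ = _ := by ring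
  have hgrad : ∀ g : E → ℝ, (∀ y ∈ ball (0 : E) r, DifferentiableAt ℝ g y) →
      (∀ y ∈ ball (0 : E) r, ‖fderiv ℝ g y - innerSL ℝ (v y)‖ ≤ ‖v y‖ / 32) →
      ∀ x ∈ ball (0 : E) ρ, ∀ y ∈ closedBall x (2 * c * ‖v x‖),
      ∀ z ∈ closedBall x (2 * c * ‖v x‖),
      |g y - g z - inner ℝ (v x) (y - z)| ≤ ‖v x‖ / 8 * ‖y - z‖ := by
    intro g hg hgv x hx y hy z hz
    have := (convex_closedBall x (2 * c * ‖v x‖)).norm_image_sub_le_of_norm_fderiv_le'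
      (f := g) (φ := innerSL ℝ (v x)) (C := ‖v x‖ / 8) (𝕜 := ℝ)
      (fun w hw => hg w (hsub x hx hw)) (fun w hw => ?_) hz hy
    · simpa using this
    · have h1 := hgv w (hsub x hx hw)
      have h2 := hnear x hx w hw
      have h3 : ‖v w‖ ≤ ‖v x‖ + ‖v x‖ / 32 := by
        have := norm_add_le (v w - v x) (v x)
        rw [sub_add_cancel] at this
        linarith
      have h4 : ‖innerSL ℝ (v w) - innerSL ℝ (v x)‖ = ‖v w - v x‖ := by
        rw [← map_sub, innerSL_apply_norm]
      have h5 := norm_add_le (fderiv ℝ g w - innerSL ℝ (v w))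
        (innerSL ℝ (v w) - innerSL ℝ (v x))
      rw [sub_add_sub_cancel, h4] at h5
      linarith [norm_nonneg (v x)]
  have hG₁ := hgrad f₁ (fun y hy => (hball y hy).1) (fun y hy => (hball y hy).2.2.1)
  have hG₂ := hgrad f₂ (fun y hy => (hball y hy).2.1) (fun y hy => (hball y hy).2.2.2.1)
  have hex : ∀ x ∈ ball (0 : E) ρ, ∃ s ∈ Set.Icc (-η) η, f₁ (x + s • v x) = f₂ x := by
    intro x hx
    have hxu : |f₁ x - f₂ x| ≤ η / 2 * ‖v x‖ ^ 2 := hu' x (hρr x hx).2.2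
    have hmem : ∀ s ∈ Set.Icc (-η) η, x + s • v x ∈ closedBall x (2 * c * ‖v x‖) := by
      intro s hs
      rw [mem_closedBall, dist_eq_norm, add_sub_cancel_left, norm_smul, Real.norm_eq_abs]
      gcongr
      exact (abs_le.2 hs).trans (by rw [hη]; linarith)
    have hx0 : x ∈ closedBall x (2 * c * ‖v x‖) := mem_closedBall_self (by positivity)
    have hval : ∀ s ∈ Set.Icc (-η) η,
        |f₁ (x + s • v x) - f₁ x - s * ‖v x‖ ^ 2| ≤ |s| * ‖v x‖ ^ 2 / 8 := by
      intro s hs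
      have := hG₁ x hx _ (hmem s hs) x hx0
      rw [add_sub_cancel_left, inner_smul_right, real_inner_self_eq_norm_sq, norm_smul,
        Real.norm_eq_abs] at this
      exact this.trans (le_of_eq (by ring))
    have hcont : ContinuousOn (fun s : ℝ => f₁ (x + s • v x)) (Set.Icc (-η) η) := by
      intro s hs
      have h1 : ContinuousAt f₁ (x + s • v x) :=
        (hball _ (hsub x hx (hmem s hs))).1.continuousAt
      exact (ContinuousAt.comp (f := fun s : ℝ => x + s • v x) h1
        (by fun_prop)).continuousWithinAt
    have hle : -η ≤ η := by linarith
    have hl := abs_le.1 (hval (-η) ⟨le_rfl, hle⟩)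
    have hrr := abs_le.1 (hval η ⟨hle, le_rfl⟩)
    rw [abs_neg, abs_of_pos hη0] at hl
    rw [abs_of_pos hη0] at hrr
    have hxu' := abs_le.1 hxu
    have hpos : 0 ≤ η * ‖v x‖ ^ 2 := by positivity
    exact intermediate_value_Icc hle hcont ⟨by linarith, by linarith⟩
  have hφ : ∀ x, ∃ w : E, (f₁ x = f₂ x → w = 0) ∧ (x ∈ ball (0 : E) ρ →
      ∃ s ∈ Set.Icc (-η) η, w = s • v x ∧ f₁ (x + w) = f₂ x) := by
    intro x
    by_cases h : f₁ x = f₂ x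
    · exact ⟨0, fun _ => rfl, fun _ => ⟨0, ⟨by linarith, hη0.le⟩, by simp, by simpa using h⟩⟩
    · by_cases hx : x ∈ ball (0 : E) ρ
      · obtain ⟨s, hs, hs'⟩ := hex x hx
        exact ⟨s • v x, fun h' => absurd h' h, fun _ => ⟨s, hs, rfl, hs'⟩⟩
      · exact ⟨0, fun _ => rfl, fun h' => absurd h' hx⟩
  choose φ hφ0 hφ1 using hφ
  refine ⟨ρ, by positivity, φ, fun x hx => ?_, hφ0, ?_⟩
  · obtain ⟨s, -, -, h⟩ := hφ1 x hx
    exact h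
  have key : ∀ x ∈ ball (0 : E) ρ, ∀ y ∈ ball (0 : E) ρ, ‖v y‖ ≤ ‖v x‖ →
      ‖φ x - φ y‖ ≤ 1 / 2 * ‖x - y‖ := by
    intro x hx y hy hxy
    obtain ⟨s, hs, hsx, hfx⟩ := hφ1 x hx
    obtain ⟨s', hs', hsy, hfy⟩ := hφ1 y hy
    have hsa := abs_le.2 hs
    have hsa' := abs_le.2 hs'
    have hnx : ‖φ x‖ ≤ η * ‖v x‖ := by
      rw [hsx, norm_smul, Real.norm_eq_abs]; gcongr
    have hny : ‖φ y‖ ≤ η * ‖v x‖ := by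
      rw [hsy, norm_smul, Real.norm_eq_abs]; gcongr
    rcases le_or_gt (c * ‖v x‖) ‖x - y‖ with hfar | hclose
    · have := norm_sub_le (φ x) (φ y)
      rw [hη] at hnx hny
      linarith
    have hv0 : 0 < ‖v x‖ := by
      by_contra h
      have : ‖v x‖ = 0 := le_antisymm (not_lt.1 h) (norm_nonneg _)
      rw [this, mul_zero] at hclose
      exact absurd hclose (not_lt.2 (norm_nonneg _))
    have hcv : 0 < c * ‖v x‖ := by positivity
    have m1 : x ∈ closedBall x (2 * c * ‖v x‖) := mem_closedBall_self (by positivity)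
    have m2 : y ∈ closedBall x (2 * c * ‖v x‖) := by
      rw [mem_closedBall, dist_comm, dist_eq_norm]; linarith
    have m3 : x + φ x ∈ closedBall x (2 * c * ‖v x‖) := by
      rw [mem_closedBall, dist_eq_norm, add_sub_cancel_left]
      rw [hη] at hnx
      linarith
    have m4 : y + φ y ∈ closedBall x (2 * c * ‖v x‖) := by
      rw [mem_closedBall, dist_eq_norm]
      have := norm_add_le (y - x) (φ y)
      rw [norm_sub_rev y x] at this
      rw [hη] at hny
      have h : y + φ y - x = y - x + φ y := by abel
      rw [h]
      linarith
    have e1 := abs_le.1 (hG₁ x hx _ m3 _ m4)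
    have e2 := abs_le.1 (hG₂ x hx _ m1 _ m2)
    rw [hfx, hfy] at e1
    have hsplit : x + φ x - (y + φ y) = (x - y) + (φ x - φ y) := by abel
    rw [hsplit, inner_add_right] at e1
    have htri : ‖v x‖ / 8 * ‖(x - y) + (φ x - φ y)‖
        ≤ ‖v x‖ / 8 * (‖x - y‖ + ‖φ x - φ y‖) := by
      gcongr
      exact norm_add_le _ _
    have hinner : |inner ℝ (v x) (φ x - φ y)|
        ≤ ‖v x‖ / 8 * (2 * ‖x - y‖ + ‖φ x - φ y‖) := by
      rw [abs_le]
      constructor <;> linarith [e1.1, e1.2, e2.1, e2.2]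
    have hdec : φ x - φ y = (s - s') • v x + s' • (v x - v y) := by
      rw [hsx, hsy, sub_smul, smul_sub]; abel
    have hrem : ‖s' • (v x - v y)‖ ≤ 1 / 16 * ‖x - y‖ := by
      rw [norm_smul, Real.norm_eq_abs]
      calc |s'| * ‖v x - v y‖ ≤ η * (L * ‖x - y‖) := by
            gcongr
            exact hlip x (hρr x hx).2.1 y (hρr y hy).2.1
        _ = (η * L) * ‖x - y‖ := by ring
        _ ≤ _ := by gcongr
    have hin : |s - s'| * ‖v x‖ ^ 2 ≤ |inner ℝ (v x) (φ x - φ y)|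
        + ‖v x‖ * ‖s' • (v x - v y)‖ := by
      have h1 : (s - s') * ‖v x‖ ^ 2 = inner ℝ (v x) (φ x - φ y)
          - inner ℝ (v x) (s' • (v x - v y)) := by
        rw [hdec, inner_add_right, inner_smul_right, real_inner_self_eq_norm_sq]; ring
      rw [← abs_of_nonneg (sq_nonneg ‖v x‖), ← abs_mul, h1]
      refine (abs_sub _ _).trans ?_
      gcongr
      exact abs_real_inner_le_norm _ _
    have hA : |s - s'| * ‖v x‖ ≤ 1 / 8 * (2 * ‖x - y‖ + ‖φ x - φ y‖) + 1 / 16 * ‖x - y‖ := by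
      refine le_of_mul_le_mul_left ?_ hv0
      have := mul_le_mul_of_nonneg_left hrem hv0.le
      nlinarith
    have hB : ‖φ x - φ y‖ ≤ |s - s'| * ‖v x‖ + 1 / 16 * ‖x - y‖ := by
      conv_lhs => rw [hdec]
      refine (norm_add_le _ _).trans ?_
      rw [norm_smul, Real.norm_eq_abs]
      gcongr
    linarith [norm_nonneg (x - y)]
  intro x hx y hy
  rcases le_total ‖v y‖ ‖v x‖ with h | h
  · exact key x hx y hy h
  · rw [norm_sub_rev, norm_sub_rev x y]
    exact key y hy x hx h

section
open Filter Topology Metric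

lemma eventually_norm_le_of_jet_eq_zero {E F : Type} [NormedAddCommGroup E] [NormedSpace ℝ E]
    [NormedAddCommGroup F] [NormedSpace ℝ F] {Z : Set E} (h0 : (0 : E) ∈ Z) {k l M : ℕ} {C : ℝ}
    {w : E → ℝ} (hC : 0 < C) (hlk : l * M ≤ k)
    (hw : ∀ᶠ x in 𝓝 0, ∃ p ∈ Z, ‖x - p‖ ≤ ‖x‖ ∧ ‖x - p‖ ^ M ≤ C * w x)
    {g : E → F} (hg : ContDiffAt ℝ k g 0)
    (hgZ : ∀ᶠ p in 𝓝 0, p ∈ Z → ∀ i ≤ k, iteratedFDeriv ℝ i g p = 0) {ε : ℝ} (hε : 0 < ε) :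
    ∀ᶠ x in 𝓝 0, ‖g x‖ ≤ ε * w x ^ l := by
  obtain ⟨ρ, hρ, h⟩ := exists_norm_le_mul_pow_of_jet_eq_zero h0 k hg hgZ (ε / C ^ l)
    (by positivity)
  filter_upwards [hw, ball_mem_nhds (0 : E) (show 0 < min (ρ / 2) 1 by positivity)]
  rintro x ⟨p, hpZ, hpx, hpw⟩ hx
  rw [mem_ball_zero_iff] at hx
  have h1 := hx.trans_le (min_le_left _ _)
  have h2 := hx.trans_le (min_le_right _ _)
  have hp : p ∈ ball (0 : E) ρ := by
    rw [mem_ball_zero_iff]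
    have := norm_sub_le x (x - p)
    rw [sub_sub_cancel] at this
    linarith
  calc ‖g x‖ ≤ ε / C ^ l * ‖x - p‖ ^ k :=
        h x (by rw [mem_ball_zero_iff]; linarith) p hp hpZ
    _ ≤ ε / C ^ l * ‖x - p‖ ^ (l * M) := by
        have := pow_le_pow_of_le_one (norm_nonneg (x - p)) (hpx.trans h2.le) hlk
        gcongr
    _ = ε / C ^ l * (‖x - p‖ ^ M) ^ l := by rw [← pow_mul, mul_comm l M]
    _ ≤ ε / C ^ l * (C * w x) ^ l := by gcongr
    _ = ε * w x ^ l := by rw [mul_pow]; field_simp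

lemma eventually_iteratedFDeriv_sub_eq_zero {E : Type*} [NormedAddCommGroup E] [NormedSpace ℝ E]
    {Z W : Set E} {k : ℕ} {f g : E → ℝ} (hf : ContDiffAt ℝ k f 0) (hg : ContDiffAt ℝ k g 0)
    (hW : W ∈ 𝓝 0)
    (h : ∀ a ∈ Z ∩ W, ∀ i ≤ k, iteratedFDeriv ℝ i f a = iteratedFDeriv ℝ i g a) :
    ∀ᶠ p in 𝓝 0, p ∈ Z → ∀ i ≤ k, iteratedFDeriv ℝ i (f - g) p = 0 := by
  filter_upwards [hf.eventually (by simp), hg.eventually (by simp), hW] with p hfp hgp hpW hpZ i hi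
  have hik : ((i : ℕ∞) : WithTop ℕ∞) ≤ ((k : ℕ∞) : WithTop ℕ∞) := by exact_mod_cast hi
  rw [iteratedFDeriv_sub_apply (hfp.of_le hik) (hgp.of_le hik), h p ⟨hpZ, hpW⟩ i hi, sub_self]

/-- A displacement field that is Lipschitz with constant `1 / 2` generates an isotopy. -/
lemma exists_isotopy_of_lipschitz_displacement {E : Type*} [NormedAddCommGroup E]
    [NormedSpace ℝ E] {Ω : Set E} {φ : E → E}
    (hφ : ∀ x ∈ Ω, ∀ y ∈ Ω, ‖φ x - φ y‖ ≤ 1 / 2 * ‖x - y‖) :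
    ContinuousOn (fun p : E × ℝ => p.1 + p.2 • φ p.1) (Ω ×ˢ Set.Icc (0 : ℝ) 1) ∧
      ∀ t ∈ Set.Icc (0 : ℝ) 1, Topology.IsEmbedding fun x : Ω => (x : E) + t • φ x := by
  have hc : ContinuousOn φ Ω := by
    refine (LipschitzOnWith.of_dist_le_mul (K := 1 / 2) fun x hx y hy => ?_).continuousOn
    simpa [dist_eq_norm] using hφ x hx y hy
  refine ⟨?_, fun t ht => ?_⟩
  · have h1 : ContinuousOn (fun p : E × ℝ => φ p.1) (Ω ×ˢ Set.Icc (0 : ℝ) 1) :=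
      hc.comp continuousOn_fst fun p hp => hp.1
    exact continuousOn_fst.add (continuousOn_snd.smul h1)
  · have hl : LipschitzWith 2 fun x : Ω => (x : E) + t • φ x := by
      refine LipschitzWith.of_dist_le_mul fun x y => ?_
      rw [Subtype.dist_eq, dist_eq_norm, dist_eq_norm, add_sub_add_comm, ← smul_sub]
      refine (norm_add_le _ _).trans ?_
      rw [norm_smul, Real.norm_eq_abs, abs_of_nonneg ht.1]
      have h1 := hφ x x.2 y y.2
      have h2 := mul_le_of_le_one_left (norm_nonneg (φ x - φ y)) ht.2
      have h3 := norm_nonneg ((x : E) - y)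
      push_cast
      linarith
    have ha : AntilipschitzWith 2 fun x : Ω => (x : E) + t • φ x := by
      refine AntilipschitzWith.of_le_mul_dist fun x y => ?_
      rw [Subtype.dist_eq, dist_eq_norm, dist_eq_norm, add_sub_add_comm, ← smul_sub]
      have h0 := norm_sub_le_norm_add ((x : E) - y) (t • (φ x - φ y))
      rw [norm_smul, Real.norm_eq_abs, abs_of_nonneg ht.1] at h0
      have h1 := hφ x x.2 y y.2
      have h2 := mul_le_of_le_one_left (norm_nonneg (φ x - φ y)) ht.2
      push_cast
      linarith
    exact (ha.isUniformEmbedding hl.uniformContinuous).isEmbedding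

end

theorem stmt_16 (n : ℕ) (U : Set (EuclideanSpace ℝ (Fin n))) (hUopen : IsOpen U)
    (hUconn : IsConnected U) (h0U : (0 : EuclideanSpace ℝ (Fin n)) ∈ U)
    (f : EuclideanSpace ℝ (Fin n) → ℝ) (hf : AnalyticOnNhd ℝ f U)
    (hfne : ∃ x ∈ U, f x ≠ 0) (hf0 : f 0 = 0)
    (P : MvPolynomial (Fin (n + 1)) ℝ) (hPirr : Irreducible P)
    (hPf : ∀ x ∈ U, MvPolynomial.eval (Fin.snoc (fun i => x i) (f x)) P = 0)
    (d : ℕ) (hd : d = P.totalDegree)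
    (Z : Set (EuclideanSpace ℝ (Fin n))) (hZ : Z = {x ∈ U | f x = 0})
    (k : ℕ) (hk : k = 2 * (2 * d - 1) ^ (3 * n + 1))
    (U₁ U₂ : Set (EuclideanSpace ℝ (Fin n)))
    (hU₁ : IsOpen U₁) (h0U₁ : (0 : EuclideanSpace ℝ (Fin n)) ∈ U₁)
    (hU₂ : IsOpen U₂) (h0U₂ : (0 : EuclideanSpace ℝ (Fin n)) ∈ U₂)
    (f₁ f₂ : EuclideanSpace ℝ (Fin n) → ℝ)
    (hf₁ : ContDiffOn ℝ k f₁ U₁) (hf₂ : ContDiffOn ℝ k f₂ U₂)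
    (hreal₁ : ∃ W ∈ nhds (0 : EuclideanSpace ℝ (Fin n)), W ⊆ U₁ ∧
      ∀ a ∈ Z ∩ W, ∀ i ≤ k, iteratedFDeriv ℝ i f a = iteratedFDeriv ℝ i f₁ a)
    (hreal₂ : ∃ W ∈ nhds (0 : EuclideanSpace ℝ (Fin n)), W ⊆ U₂ ∧
      ∀ a ∈ Z ∩ W, ∀ i ≤ k, iteratedFDeriv ℝ i f a = iteratedFDeriv ℝ i f₂ a) :
    ∃ Ω : Set (EuclideanSpace ℝ (Fin n)), IsOpen Ω ∧
      (0 : EuclideanSpace ℝ (Fin n)) ∈ Ω ∧ Ω ⊆ U₁ ∩ U₂ ∧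
      ∃ H : EuclideanSpace ℝ (Fin n) → ℝ → EuclideanSpace ℝ (Fin n),
        ContinuousOn (fun p : EuclideanSpace ℝ (Fin n) × ℝ => H p.1 p.2)
          (Ω ×ˢ Set.Icc (0 : ℝ) 1) ∧
        (∀ x ∈ Ω, H x 0 = x) ∧
        (∀ x ∈ Ω ∩ Z, ∀ t ∈ Set.Icc (0 : ℝ) 1, H x t = x) ∧
        (∀ t ∈ Set.Icc (0 : ℝ) 1, Topology.IsEmbedding fun x : Ω => H x t) ∧
        (∀ x ∈ Ω, H x 1 ∈ U₁ ∧ f₁ (H x 1) = f₂ x) := by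
  obtain ⟨m, hmk, K, hK, hineq⟩ := exists_lojasiewicz_exponent hUopen hUconn.isPreconnected h0U hf
    hf0 hfne hPirr.ne_zero hPf (hd ▸ hk)
  have hUn : U ∈ nhds (0 : EuclideanSpace ℝ (Fin n)) := hUopen.mem_nhds h0U
  have hfd : ∀ᶠ x in nhds 0, DifferentiableAt ℝ f x := by
    filter_upwards [hUn] with x hx using (hf x hx).differentiableAt
  obtain ⟨C, hC, hnear⟩ := exists_near_zero_of_gradient_inequality hK hf0 hfd hineq
  have h0Z : (0 : EuclideanSpace ℝ (Fin n)) ∈ Z := by rw [hZ]; exact ⟨h0U, hf0⟩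
  have hw : ∀ᶠ x in nhds (0 : EuclideanSpace ℝ (Fin n)),
      ∃ p ∈ Z, ‖x - p‖ ≤ ‖x‖ ∧ ‖x - p‖ ^ (m + 1) ≤ C * ‖fderiv ℝ f x‖ := by
    obtain ⟨r, hr, hrU⟩ := Metric.mem_nhds_iff.1 hUn
    filter_upwards [hnear, Metric.ball_mem_nhds 0 (show 0 < min (r / 2) 1 by positivity)]
      with x hx hxr
    rw [mem_ball_zero_iff] at hxr
    have h1 := hxr.trans_le (min_le_left _ _)
    have h2 := hxr.trans_le (min_le_right _ _)
    by_cases hfx : f x = 0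
    · have hxU : x ∈ U := hrU (by rw [mem_ball_zero_iff]; linarith)
      refine ⟨x, by rw [hZ]; exact ⟨hxU, hfx⟩, by simp, ?_⟩
      rw [sub_self, norm_zero, zero_pow m.succ_ne_zero]
      positivity
    · obtain ⟨p, hp0, hpx, hpw⟩ := hx hfx
      have hpU : p ∈ U := by
        apply hrU
        rw [mem_ball_zero_iff]
        have := norm_sub_le x (x - p)
        rw [sub_sub_cancel] at this
        linarith
      refine ⟨p, by rw [hZ]; exact ⟨hpU, hp0⟩, hpx, le_trans ?_ hpw⟩
      exact pow_le_pow_of_le_one (norm_nonneg _) (hpx.trans h2.le) m.le_succ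
  have hfa : AnalyticAt ℝ f 0 := hf 0 h0U
  have hcf : ContDiffAt ℝ k f 0 := hfa.contDiffAt
  have hc₁ : ContDiffAt ℝ k f₁ 0 := hf₁.contDiffAt (hU₁.mem_nhds h0U₁)
  have hc₂ : ContDiffAt ℝ k f₂ 0 := hf₂.contDiffAt (hU₂.mem_nhds h0U₂)
  obtain ⟨W₁, hW₁, -, hj₁⟩ := hreal₁
  obtain ⟨W₂, hW₂, -, hj₂⟩ := hreal₂
  have hk1 : ((k - 1 : ℕ) : WithTop ℕ∞) + 1 ≤ k := by
    have : k - 1 + 1 ≤ k := by omega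
    exact_mod_cast this
  have hk0 : (k : WithTop ℕ∞) ≠ 0 := by
    have : k ≠ 0 := by omega
    exact_mod_cast this
  have hgrad : ∀ g : EuclideanSpace ℝ (Fin n) → ℝ, ContDiffAt ℝ k g 0 → ∀ W ∈ nhds 0,
      (∀ a ∈ Z ∩ W, ∀ i ≤ k, iteratedFDeriv ℝ i f a = iteratedFDeriv ℝ i g a) →
      ∀ᶠ x in nhds 0, ‖fderiv ℝ g x - fderiv ℝ f x‖ ≤ ‖fderiv ℝ f x‖ / 32 := by
    intro g hg W hW hj
    have hz : ∀ᶠ p in nhds 0, p ∈ Z → ∀ i ≤ k - 1, iteratedFDeriv ℝ i (fderiv ℝ (f - g)) p = 0 := by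
      filter_upwards [eventually_iteratedFDeriv_sub_eq_zero hcf hg hW hj] with p hp hpZ i hi
      rw [← norm_eq_zero, norm_iteratedFDeriv_fderiv, hp hpZ (i + 1) (by omega), norm_zero]
    have := eventually_norm_le_of_jet_eq_zero (l := 1) h0Z hC (by omega) hw
      ((hcf.sub hg).fderiv_right hk1) hz (ε := 1 / 32) (by norm_num)
    filter_upwards [this, hfd, hg.eventually (by simp)] with x hx hfx hgx
    rw [fderiv_fun_sub hfx (hgx.differentiableAt hk0), norm_sub_rev] at hx
    linarith
  set v : EuclideanSpace ℝ (Fin n) → EuclideanSpace ℝ (Fin n) :=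
    fun x => (InnerProductSpace.toDual ℝ _).symm (fderiv ℝ f x) with hv
  have hvn : ∀ x, ‖v x‖ = ‖fderiv ℝ f x‖ := fun x => LinearIsometryEquiv.norm_map _ _
  have hvi : ∀ x, innerSL ℝ (v x) = fderiv ℝ f x := fun x => by
    ext y
    rw [innerSL_apply_apply, InnerProductSpace.toDual_symm_apply]
  have hvd : ContDiffAt ℝ 1 v 0 :=
    (InnerProductSpace.toDual ℝ (EuclideanSpace ℝ (Fin n))).symm.contDiff.contDiffAt.comp
      (0 : EuclideanSpace ℝ (Fin n)) hfa.fderiv.contDiffAt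
  obtain ⟨ρ, hρ, φ, hφ, hφ0, hφl⟩ := exists_lipschitz_displacement (f₁ := f₁) (f₂ := f₂) hvd
    ((hc₁.eventually (by simp)).mono fun x hx => hx.differentiableAt hk0)
    ((hc₂.eventually (by simp)).mono fun x hx => hx.differentiableAt hk0)
    (by simpa only [hvn, hvi] using hgrad f₁ hc₁ W₁ hW₁ hj₁)
    (by simpa only [hvn, hvi] using hgrad f₂ hc₂ W₂ hW₂ hj₂)
    (fun ε hε => by
      have hz := eventually_iteratedFDeriv_sub_eq_zero (Z := Z) hc₁ hc₂ (Filter.inter_mem hW₁ hW₂)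
        fun a ha i hi => (hj₁ a ⟨ha.1, ha.2.1⟩ i hi).symm.trans (hj₂ a ⟨ha.1, ha.2.2⟩ i hi)
      have := eventually_norm_le_of_jet_eq_zero (l := 2) h0Z hC (by omega) hw
        (hc₁.sub hc₂) hz hε
      simpa only [hvn, Real.norm_eq_abs, Pi.sub_apply] using this)
  have heq : ∀ x ∈ Z ∩ (W₁ ∩ W₂), f₁ x = f₂ x := by
    intro x hx
    have h := (hj₁ x ⟨hx.1, hx.2.1⟩ 0 k.zero_le).symm.trans (hj₂ x ⟨hx.1, hx.2.2⟩ 0 k.zero_le)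
    simpa using congrArg (fun T => T 0) h
  obtain ⟨δ, hδ, hball⟩ := Metric.mem_nhds_iff.1 (Filter.inter_mem (Filter.inter_mem hW₁ hW₂)
    (Filter.inter_mem (hU₁.mem_nhds h0U₁) (hU₂.mem_nhds h0U₂)))
  have hr : 0 < min ρ (δ / 2) := by positivity
  have hΩ : ∀ x ∈ Metric.ball (0 : EuclideanSpace ℝ (Fin n)) (min ρ (δ / 2)),
      x ∈ Metric.ball (0 : EuclideanSpace ℝ (Fin n)) ρ ∧ ‖x‖ < δ / 2 ∧ x ∈ Metric.ball 0 δ := by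
    intro x hx
    rw [mem_ball_zero_iff] at hx
    have h1 := hx.trans_le (min_le_left _ _)
    have h2 := hx.trans_le (min_le_right _ _)
    exact ⟨by rwa [mem_ball_zero_iff], h2, by rw [mem_ball_zero_iff]; linarith⟩
  have hφZ : ∀ x ∈ Metric.ball (0 : EuclideanSpace ℝ (Fin n)) (min ρ (δ / 2)), x ∈ Z → φ x = 0 :=
    fun x hx hxZ => hφ0 x (heq x ⟨hxZ, (hball (hΩ x hx).2.2).1⟩)
  obtain ⟨hcont, hemb⟩ := exists_isotopy_of_lipschitz_displacement
    (Ω := Metric.ball (0 : EuclideanSpace ℝ (Fin n)) (min ρ (δ / 2))) (φ := φ)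
    fun x hx y hy => hφl x (hΩ x hx).1 y (hΩ y hy).1
  refine ⟨Metric.ball 0 (min ρ (δ / 2)), Metric.isOpen_ball, Metric.mem_ball_self hr,
    fun x hx => (hball (hΩ x hx).2.2).2, fun x t => x + t • φ x, hcont, by simp, ?_, hemb, ?_⟩
  · intro x hx t _
    simp [hφZ x hx.1 hx.2]
  · intro x hx
    simp only [one_smul]
    refine ⟨(hball ?_).2.1, hφ x (hΩ x hx).1⟩
    have h1 := hφl x (hΩ x hx).1 0 (Metric.mem_ball_self hρ)
    rw [hφZ 0 (Metric.mem_ball_self hr) h0Z, sub_zero, sub_zero] at h1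
    rw [mem_ball_zero_iff]
    linarith [norm_add_le x (φ x), (hΩ x hx).2.1]
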